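/- Let α, β, γ be partitions with at most n parts. There exist n×n complex Hermitian matrices A and B with ordered spectra α and β respectively such that A + B has ordered spectrum γ, if and only if |γ| = |α| + |β| and the Littlewood–Richardson coefficient c^γ_{αβ} is nonzero. -/

import Mathlib

/-- A partition: a weakly decreasing, finitely supported sequence of nonnegative
integers (indexed from 0, so `f 0` is the first part `λ₁`). -/
def IsPartition (f : ℕ → ℕ) : Prop := Antitone f ∧ ∃ N, ∀ n, N ≤ n → f n = 0

/-- For `σ = (σ₁ ≥ σ₂ ≥ …)`, `sminus σ = σ₋ = (σ₁, σ₃, σ₅, …)` (0-indexed). -/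
def sminus (σ : ℕ → ℕ) : ℕ → ℕ := fun k => σ (2 * k)

/-- For `σ = (σ₁ ≥ σ₂ ≥ …)`, `splus σ = σ₊ = (σ₂, σ₄, σ₆, …)` (0-indexed). -/
def splus (σ : ℕ → ℕ) : ℕ → ℕ := fun k => σ (2 * k + 1)

/-- `dup ν = ν⁽²⁾ = (ν₁, ν₁, ν₂, ν₂, …)`: every part of `ν` is duplicated. -/
def dup (ν : ℕ → ℕ) : ℕ → ℕ := fun k => ν (k / 2)

/-- Cell `(i, j)` (row `i`, column `j`, 0-based) lies in the skew diagram `ν/λ`. -/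
def InSkew (lam ν : ℕ → ℕ) (c : ℕ × ℕ) : Prop := lam c.1 ≤ c.2 ∧ c.2 < ν c.1

/-- `T` is a Littlewood–Richardson filling of shape `ν/λ` and weight `μ`:
a semistandard skew tableau of shape `ν/λ` (entries `k+1` encode the label `k+1`,
cells outside the shape carry `0`) whose content is `μ` and whose reverse reading
word (rows top to bottom, each row right to left) is a lattice word. -/
def IsLRFilling (lam mu ν : ℕ → ℕ) (T : ℕ × ℕ → ℕ) : Prop :=
  (∀ c, ¬ InSkew lam ν c → T c = 0) ∧
  (∀ c, InSkew lam ν c → 1 ≤ T c) ∧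
  (∀ i j j', InSkew lam ν (i, j) → InSkew lam ν (i, j') → j ≤ j' →
    T (i, j) ≤ T (i, j')) ∧
  (∀ i j, InSkew lam ν (i, j) → InSkew lam ν (i + 1, j) → T (i, j) < T (i + 1, j)) ∧
  (∀ k, Nat.card {c : ℕ × ℕ | T c = k + 1} = mu k) ∧
  (∀ r c k l, k < l →
    Nat.card {x : ℕ × ℕ | T x = l + 1 ∧ (x.1 < r ∨ (x.1 = r ∧ c ≤ x.2))} ≤
    Nat.card {x : ℕ × ℕ | T x = k + 1 ∧ (x.1 < r ∨ (x.1 = r ∧ c ≤ x.2))})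

/-- The Littlewood–Richardson coefficient `c^ν_{λμ}`: the number of
Littlewood–Richardson fillings of shape `ν/λ` and weight `μ`. -/
noncomputable def LR (lam mu ν : ℕ → ℕ) : ℕ :=
  Nat.card {T : ℕ × ℕ → ℕ // IsLRFilling lam mu ν T}

open Polynomial in
/-- `μ` (weakly decreasing) is the ordered spectrum of the real matrix `A`:
the characteristic polynomial of `A` is `∏ i (X - μ i)`, i.e. the `μ i` are the
eigenvalues of `A` with multiplicity, listed in weakly decreasing order. -/
def HasOrdSpecR {n : ℕ} (A : Matrix (Fin n) (Fin n) ℝ) (μ : Fin n → ℝ) : Prop :=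
  Antitone μ ∧ A.charpoly = ∏ i, (X - C (μ i))

open Polynomial in
/-- `μ` (weakly decreasing, real) is the ordered spectrum of the complex matrix `A`. -/
def HasOrdSpecC {n : ℕ} (A : Matrix (Fin n) (Fin n) ℂ) (μ : Fin n → ℝ) : Prop :=
  Antitone μ ∧ A.charpoly = ∏ i, (X - C ((μ i : ℂ)))

/-- For `σ = (σ₁ ≥ … ≥ σ_{2p})`, `sminusR σ = σ₋ = (σ₁, σ₃, …, σ_{2p-1})`. -/
def sminusR {p : ℕ} (σ : Fin (2 * p) → ℝ) : Fin p → ℝ :=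
  fun i => σ ⟨2 * i.1, by have := i.2; omega⟩

/-- For `σ = (σ₁ ≥ … ≥ σ_{2p})`, `splusR σ = σ₊ = (σ₂, σ₄, …, σ_{2p})`. -/
def splusR {p : ℕ} (σ : Fin (2 * p) → ℝ) : Fin p → ℝ :=
  fun i => σ ⟨2 * i.1 + 1, by have := i.2; omega⟩

/-- For `ν = (ν₁ ≥ … ≥ ν_p)`, `dupR ν = ν⁽²⁾ = (ν₁, ν₁, ν₂, ν₂, …, ν_p, ν_p)`. -/
def dupR {p : ℕ} (ν : Fin p → ℝ) : Fin (2 * p) → ℝ :=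
  fun i => ν ⟨i.1 / 2, by have := i.2; omega⟩


set_option linter.all false
set_option linter.unusedSectionVars false
set_option linter.unusedVariables false
set_option linter.unusedSimpArgs false
namespace HornE
open Submodule Module

variable {k V : Type*} [Field k] [AddCommGroup V] [Module k V]

/-- shift by `d`. -/
def sh (d : ℤ) : (ℤ → V) →ₗ[k] (ℤ → V) where
  toFun x := fun u => x (u - d)
  map_add' _ _ := rfl
  map_smul' _ _ := rfl

@[simp] lemma sh_apply (d : ℤ) (x : ℤ → V) (u : ℤ) : sh (k := k) d x u = x (u - d) := rfl

lemma sh_sh (d e : ℤ) (x : ℤ → V) : sh (k := k) d (sh (k := k) e x) = sh (k := k) (d + e) x := by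
  funext u; simp [sub_sub]

lemma sh_zero (x : ℤ → V) : sh (k := k) 0 x = x := by funext u; simp

lemma map_sh_sh (d e : ℤ) (L : Submodule k (ℤ → V)) :
    (L.map (sh e)).map (sh d) = L.map (sh (d + e)) := by
  rw [← Submodule.map_comp]; congr 1; ext x; simp [sub_sub]

lemma map_sh_zero (L : Submodule k (ℤ → V)) : L.map (sh 0) = L := by
  have : (sh 0 : (ℤ → V) →ₗ[k] (ℤ → V)) = LinearMap.id := by ext x; simp
  rw [this, Submodule.map_id]

lemma sh_inj (d : ℤ) : Function.Injective (sh (k := k) (V := V) d) := by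
  intro x y h
  have := congrArg (sh (k := k) (-d)) h
  simpa [sh_sh, sh_zero] using this

/-- elements vanishing below `s`. -/
def Os (k : Type*) {V : Type*} [Field k] [AddCommGroup V] [Module k V] (s : ℤ) :
    Submodule k (ℤ → V) where
  carrier := {x | ∀ u, u < s → x u = 0}
  add_mem' := by intro a b ha hb u hu; simp [ha u hu, hb u hu]
  zero_mem' := by intro u _; rfl
  smul_mem' := by intro c x hx u hu; simp [hx u hu]

lemma mem_Os {s : ℤ} {x : ℤ → V} : x ∈ Os k s ↔ ∀ u, u < s → x u = 0 := Iff.rfl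

lemma Os_anti {s s' : ℤ} (h : s ≤ s') : (Os k s' : Submodule k (ℤ → V)) ≤ Os k s :=
  fun _ hx u hu => hx u (lt_of_lt_of_le hu h)

lemma map_sh_Os (d s : ℤ) : (Os k s : Submodule k (ℤ → V)).map (sh d) = Os k (s + d) := by
  apply le_antisymm
  · rintro _ ⟨x, hx, rfl⟩ u hu
    exact hx _ (by linarith)
  · intro x hx
    refine ⟨sh (-d) x, ?_, by rw [sh_sh]; simp [sh_zero]⟩
    intro u hu
    exact hx _ (by linarith)

/-- sequences with all values in `F`. -/
def hat (F : Submodule k V) : Submodule k (ℤ → V) where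
  carrier := {x | ∀ u, x u ∈ F}
  add_mem' := by intro a b ha hb u; exact F.add_mem (ha u) (hb u)
  zero_mem' := by intro u; exact F.zero_mem
  smul_mem' := by intro c x hx u; exact F.smul_mem _ (hx u)

lemma mem_hat {F : Submodule k V} {x : ℤ → V} : x ∈ hat F ↔ ∀ u, x u ∈ F := Iff.rfl

/-- elementary modification -/
def mm (F : Submodule k V) (L : Submodule k (ℤ → V)) : Submodule k (ℤ → V) :=
  L ⊔ (L ⊓ hat F).map (sh (-1))

lemma mm_mono (F : Submodule k V) : Monotone (mm F) := by
  intro L L' h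
  exact sup_le_sup h (Submodule.map_mono (inf_le_inf_right _ h))

lemma le_mm (F : Submodule k V) (L : Submodule k (ℤ → V)) : L ≤ mm F L := le_sup_left

def Stab (L : Submodule k (ℤ → V)) : Prop := ∀ x ∈ L, sh (k := k) 1 x ∈ L

lemma mm_stab {F : Submodule k V} {L : Submodule k (ℤ → V)} (h : Stab L) : Stab (mm F L) := by
  intro x hx
  obtain ⟨a, ha, b, ⟨g, hg, rfl⟩, rfl⟩ := Submodule.mem_sup.1 hx
  rw [map_add]
  refine Submodule.add_mem _ (le_mm _ _ (h a ha)) (le_mm _ _ ?_)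
  rw [sh_sh]; simpa [sh_zero] using hg.1

lemma mm_le_Os {F : Submodule k V} {L : Submodule k (ℤ → V)} {s : ℤ} (h : L ≤ Os k s) :
    mm F L ≤ Os k (s - 1) := by
  refine sup_le (h.trans (Os_anti (by linarith))) ?_
  refine (Submodule.map_mono (inf_le_left.trans h)).trans ?_
  rw [map_sh_Os]; exact le_of_eq (by congr 1)

/-- iterated modification -/
def mmf (Fs : List (Submodule k V)) (L : Submodule k (ℤ → V)) : Submodule k (ℤ → V) :=
  Fs.foldl (fun L F => mm F L) L

@[simp] lemma mmf_nil (L : Submodule k (ℤ → V)) : mmf [] L = L := rfl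
@[simp] lemma mmf_cons (F) (Fs : List (Submodule k V)) (L : Submodule k (ℤ → V)) :
  mmf (F :: Fs) L = mmf Fs (mm F L) := rfl

lemma mmf_mono (Fs : List (Submodule k V)) : Monotone (mmf Fs) := by
  induction Fs with
  | nil => intro a b h; exact h
  | cons F Fs ih => intro a b h; exact ih (mm_mono F h)

lemma le_mmf (Fs : List (Submodule k V)) (L : Submodule k (ℤ → V)) : L ≤ mmf Fs L := by
  induction Fs generalizing L with
  | nil => exact le_rfl
  | cons F Fs ih => exact (le_mm F L).trans (ih _)

lemma mmf_stab (Fs : List (Submodule k V)) {L : Submodule k (ℤ → V)} (h : Stab L) :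
    Stab (mmf Fs L) := by
  induction Fs generalizing L with
  | nil => exact h
  | cons F Fs ih => exact ih (mm_stab h)

lemma mmf_le_Os (Fs : List (Submodule k V)) {L : Submodule k (ℤ → V)} {s : ℤ} (h : L ≤ Os k s) :
    mmf Fs L ≤ Os k (s - Fs.length) := by
  induction Fs generalizing L s with
  | nil => simpa using h
  | cons F Fs ih =>
    refine (ih (mm_le_Os h)).trans (le_of_eq ?_)
    congr 1; push_cast [List.length_cons]; ring

/-- truncation: kills the coordinates `≥ s`. -/
def res (s : ℤ) : (ℤ → V) →ₗ[k] (ℤ → V) where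
  toFun x := fun u => if u < s then x u else 0
  map_add' a b := by funext u; by_cases h : u < s <;> simp [h]
  map_smul' a b := by funext u; by_cases h : u < s <;> simp [h]

lemma res_apply (s : ℤ) (x : ℤ → V) (u : ℤ) :
    res (k := k) s x u = if u < s then x u else 0 := rfl

lemma res_eq_iff {s : ℤ} {x y : ℤ → V} :
    res (k := k) s x = res (k := k) s y ↔ x - y ∈ Os k s := by
  constructor
  · intro h u hu
    have := congrFun h u
    simp only [res_apply, hu, if_true] at this
    simp [this]
  · intro h
    funext u
    simp only [res_apply]
    split_ifs with hu
    · have := h u hu; simpa [sub_eq_zero] using this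
    · rfl

noncomputable def U (s : ℤ) (L : Submodule k (ℤ → V)) : ℕ := finrank k (L.map (res s))

lemma fd [FiniteDimensional k V] {L : Submodule k (ℤ → V)} {lo : ℤ} (h : L ≤ Os k lo) (s : ℤ) :
    FiniteDimensional k (L.map (res s)) := by
  let f : (↥(Finset.Ico lo s) → V) →ₗ[k] (ℤ → V) :=
    { toFun := fun y u => if hu : u ∈ Finset.Ico lo s then y ⟨u, hu⟩ else 0
      map_add' := by intro a b; funext u; dsimp only [Pi.add_apply, Pi.smul_apply, RingHom.id_apply]; split_ifs <;> simp
      map_smul' := by intro a b; funext u; dsimp only [Pi.add_apply, Pi.smul_apply, RingHom.id_apply]; split_ifs <;> simp }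
  have hle : L.map (res s) ≤ LinearMap.range f := by
    rintro _ ⟨x, hx, rfl⟩
    refine ⟨fun u => x u, ?_⟩
    funext u
    simp only [f, LinearMap.coe_mk, AddHom.coe_mk, res_apply, Finset.mem_Ico]
    by_cases h1 : u < s
    · by_cases h2 : lo ≤ u
      · simp [h1, h2]
      · simp [h1, h2, h hx u (by omega)]
    · simp [h1]
  exact Submodule.finiteDimensional_of_le hle

lemma U_sh (d s : ℤ) (L : Submodule k (ℤ → V)) : U s (L.map (sh d)) = U (s - d) L := by
  unfold U
  have : (L.map (sh d)).map (res s) = (L.map (res (s - d))).map (sh d) := by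
    rw [← Submodule.map_comp, ← Submodule.map_comp]
    congr 1
    ext x u
    simp [res_apply]
  rw [this]
  exact ((Submodule.equivMapOfInjective _ (sh_inj d) _).finrank_eq).symm

/-- leading terms in degree `u`. -/
def Wl (u : ℤ) (L : Submodule k (ℤ → V)) : Submodule k V := (L ⊓ Os k u).map (LinearMap.proj u)

lemma Wl_mono (u : ℤ) {L L' : Submodule k (ℤ → V)} (h : L ≤ L') : Wl u L ≤ Wl u L' :=
  Submodule.map_mono (inf_le_inf_right _ h)

lemma Wl_stab {L : Submodule k (ℤ → V)} (h : Stab L) (u : ℤ) : Wl u L ≤ Wl (u + 1) L := by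
  rintro _ ⟨x, ⟨hx, hx'⟩, rfl⟩
  refine ⟨sh 1 x, ⟨h x hx, ?_⟩, by simp⟩
  intro v hv
  exact hx' _ (by linarith)


lemma finrank_map_add {E E' : Type*} [AddCommGroup E] [Module k E] [AddCommGroup E'] [Module k E']
    (f : E →ₗ[k] E') (A : Submodule k E) [FiniteDimensional k A] :
    finrank k (A.map f) + finrank k (A ⊓ LinearMap.ker f : Submodule k E) = finrank k A := by
  have h := LinearMap.finrank_range_add_finrank_ker (f.domRestrict A)
  rw [LinearMap.range_domRestrict] at h
  have e : (LinearMap.ker (f.domRestrict A)).map A.subtype = A ⊓ LinearMap.ker f := by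
    ext x; simp [LinearMap.mem_ker, and_comm]
  rw [← e, finrank_map_subtype_eq]
  exact h

variable [FiniteDimensional k V]

lemma U_succ {L : Submodule k (ℤ → V)} {lo : ℤ} (h : L ≤ Os k lo) (s : ℤ) :
    U (s + 1) L = U s L + finrank k (Wl s L) := by
  have := fd h (s + 1)
  have h1 := finrank_map_add (res (k := k) s) (L.map (res (s + 1)))
  have e1 : (L.map (res (s + 1))).map (res s) = L.map (res s) := by
    rw [← Submodule.map_comp]; congr 1; ext x u
    simp only [LinearMap.comp_apply, res_apply]
    split_ifs <;> first | rfl | omega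
  set K := L.map (res (s + 1)) ⊓ LinearMap.ker (res (k := k) (V := V) s) with hK
  have : FiniteDimensional k K := Submodule.finiteDimensional_of_le (inf_le_left : K ≤ _)
  have h2 := finrank_map_add (LinearMap.proj s : (ℤ → V) →ₗ[k] V) K
  have e2 : K.map (LinearMap.proj s) = Wl s L := by
    ext v
    constructor
    · rintro ⟨_, ⟨⟨x, hx, rfl⟩, hk⟩, rfl⟩
      refine ⟨x, ⟨hx, ?_⟩, by simp [res_apply]⟩
      intro u hu
      have := congrFun (LinearMap.mem_ker.1 hk) u
      simpa [res_apply, hu, show u < s + 1 by omega] using this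
    · rintro ⟨x, ⟨hx, hx'⟩, rfl⟩
      refine ⟨res (s + 1) x, ⟨⟨x, hx, rfl⟩, ?_⟩, by simp [res_apply]⟩
      rw [SetLike.mem_coe, LinearMap.mem_ker]
      funext u
      simp only [res_apply]
      split_ifs with a b
      · exact hx' u a
      · rfl
      · rfl
  have e3 : K ⊓ LinearMap.ker (LinearMap.proj s : (ℤ → V) →ₗ[k] V) = ⊥ := by
    rw [eq_bot_iff]
    rintro _ ⟨⟨⟨x, hx, rfl⟩, hk⟩, hp⟩
    rw [Submodule.mem_bot]
    funext u
    simp only [res_apply]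
    have := congrFun (LinearMap.mem_ker.1 hk) u
    simp only [res_apply] at this
    have hp' : res (k := k) (s + 1) x s = 0 := hp
    simp only [res_apply] at hp'
    split_ifs with a
    · rcases lt_or_eq_of_le (Int.lt_add_one_iff.1 a) with b | b
      · simpa [a, b] using this
      · subst b; simpa using hp'
    · rfl
  rw [e3, finrank_bot, add_zero, e2] at h2
  rw [e1] at h1
  unfold U
  omega

lemma U_add {L : Submodule k (ℤ → V)} {lo : ℤ} (h : L ≤ Os k lo) (s : ℤ) (d m : ℕ)
    (hd : ∀ u, s ≤ u → u < s + d → finrank k (Wl u L) = m) :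
    U (s + d) L = U s L + d * m := by
  induction d with
  | zero => simp
  | succ d ih =>
    have := U_succ h (s + d)
    rw [hd (s + d) (by linarith) (by push_cast; linarith),
      ih (fun u h1 h2 => hd u h1 (by push_cast; linarith))] at this
    rw [show s + ((d + 1 : ℕ) : ℤ) = s + d + 1 by push_cast; ring, this]; ring

lemma U_mono {L L' : Submodule k (ℤ → V)} {lo : ℤ} (h : L' ≤ Os k lo) (s : ℤ)
    (hl : L ≤ L' ⊔ Os k s) : L.map (res s) ≤ L'.map (res s) := by
  rintro _ ⟨x, hx, rfl⟩
  obtain ⟨a, ha, b, hb, rfl⟩ := Submodule.mem_sup.1 (hl hx)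
  refine ⟨a, ha, ?_⟩
  rw [res_eq_iff]
  simpa using hb

lemma sup_of_map_le {L L' : Submodule k (ℤ → V)} {s : ℤ}
    (hl : L.map (res s) ≤ L'.map (res s)) : L ≤ L' ⊔ Os k s := by
  intro x hx
  obtain ⟨y, hy, e⟩ := hl ⟨x, hx, rfl⟩
  rw [res_eq_iff] at e
  rw [show x = y + -(y - x) by abel]
  exact Submodule.add_mem_sup hy (Submodule.neg_mem _ e)

lemma G_stab {F : Submodule k V} {L : Submodule k (ℤ → V)} (h : Stab L) :
    L ⊓ hat F ≤ (L ⊓ hat F).map (sh (-1)) := by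
  intro x hx
  refine ⟨sh 1 x, ⟨h x hx.1, fun u => hx.2 _⟩, by rw [sh_sh]; simp [sh_zero]⟩

lemma U_mm {F : Submodule k V} {L : Submodule k (ℤ → V)} {lo : ℤ} (h : L ≤ Os k lo)
    (hs : Stab L) (s : ℤ) :
    U s (mm F L) ≤ U s L + finrank k (Wl s L ⊓ F : Submodule k V) := by
  have hG : L ⊓ hat F ≤ Os k lo := inf_le_left.trans h
  have hG' : (L ⊓ hat F).map (sh (-1)) ≤ Os k (lo - 1) :=
    (Submodule.map_mono hG).trans (by rw [map_sh_Os]; exact le_of_eq (by congr 1))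
  have i1 := fd h s
  have i2 := fd hG' s
  have h1 := Submodule.finrank_sup_add_finrank_inf_eq (L.map (res s))
    (((L ⊓ hat F).map (sh (-1))).map (res s))
  rw [← Submodule.map_sup] at h1
  have h2 : U s ((L ⊓ hat F).map (sh (-1))) = U s (L ⊓ hat F) + finrank k (Wl s (L ⊓ hat F)) := by
    rw [U_sh, ← U_succ hG]; congr 1
  have h3 : U s (L ⊓ hat F) ≤ finrank k
      (L.map (res s) ⊓ ((L ⊓ hat F).map (sh (-1))).map (res s) : Submodule k (ℤ → V)) := by
    have : FiniteDimensional k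
      (L.map (res s) ⊓ ((L ⊓ hat F).map (sh (-1))).map (res s) : Submodule k (ℤ → V)) :=
      Submodule.finiteDimensional_of_le inf_le_left
    exact Submodule.finrank_mono (le_inf (Submodule.map_mono inf_le_left)
      (Submodule.map_mono (G_stab hs)))
  have h4 : finrank k (Wl s (L ⊓ hat F)) ≤ finrank k (Wl s L ⊓ F : Submodule k V) := by
    refine Submodule.finrank_mono (le_inf (Wl_mono _ inf_le_left) ?_)
    rintro _ ⟨x, ⟨⟨_, hx⟩, _⟩, rfl⟩
    exact hx s
  change finrank k ((mm F L).map (res s)) + _ = U s L + U s ((L ⊓ hat F).map (sh (-1))) at h1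
  change finrank k ((mm F L).map (res s)) ≤ _
  omega

lemma U_mm_large {F : Submodule k V} {L : Submodule k (ℤ → V)} {lo : ℤ} (h : L ≤ Os k lo)
    (hs : Stab L) (s : ℤ) (hO : Os k s ≤ L) :
    U s (mm F L) = U s L + finrank k F := by
  have hG : L ⊓ hat F ≤ Os k lo := inf_le_left.trans h
  have hG' : (L ⊓ hat F).map (sh (-1)) ≤ Os k (lo - 1) :=
    (Submodule.map_mono hG).trans (by rw [map_sh_Os]; exact le_of_eq (by congr 1))
  have i1 := fd h s
  have i2 := fd hG' s
  have h1 := Submodule.finrank_sup_add_finrank_inf_eq (L.map (res s))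
    (((L ⊓ hat F).map (sh (-1))).map (res s))
  rw [← Submodule.map_sup] at h1
  have h2 : U s ((L ⊓ hat F).map (sh (-1))) = U s (L ⊓ hat F) + finrank k (Wl s (L ⊓ hat F)) := by
    rw [U_sh, ← U_succ hG]; congr 1
  have h3 : L.map (res s) ⊓ ((L ⊓ hat F).map (sh (-1))).map (res s) = (L ⊓ hat F).map (res s) := by
    apply le_antisymm
    · rintro _ ⟨⟨x, hx, rfl⟩, ⟨y, hy, e⟩⟩
      have e' := (res_eq_iff.1 e)
      refine ⟨y, ⟨?_, ?_⟩, e⟩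
      · rw [show y = x + (y - x) by abel]
        exact L.add_mem hx (hO e')
      · obtain ⟨g, hg, rfl⟩ := hy
        exact fun u => hg.2 _
    · exact (le_inf (Submodule.map_mono inf_le_left)
      (Submodule.map_mono (G_stab hs)))
  have h4 : Wl s (L ⊓ hat F) = F := by
    apply le_antisymm
    · rintro _ ⟨x, ⟨⟨_, hx⟩, _⟩, rfl⟩
      exact hx s
    · intro v hv
      have hO' : Pi.single s v ∈ Os k (V := V) s := by
        intro u hu
        rw [Pi.single_apply, if_neg (by omega)]
      refine ⟨Pi.single s v, ⟨⟨hO hO', ?_⟩, hO'⟩, by simp⟩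
      intro u
      rw [Pi.single_apply]; split_ifs
      · exact hv
      · exact F.zero_mem
  rw [h3] at h1
  rw [h4] at h2
  change U s (mm F L) + U s (L ⊓ hat F) = U s L + U s ((L ⊓ hat F).map (sh (-1))) at h1
  omega

lemma Wl_mm {F : Submodule k V} {L : Submodule k (ℤ → V)} (hs : Stab L) (u : ℤ) :
    Wl u (mm F L) ≤ Wl (u + 1) L := by
  rintro _ ⟨x, ⟨hx, hx'⟩, rfl⟩
  refine ⟨sh (k := k) 1 x, ⟨?_, ?_⟩, by simp⟩
  · obtain ⟨a, ha, b, ⟨g, hg, rfl⟩, rfl⟩ := Submodule.mem_sup.1 hx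
    rw [map_add]
    refine Submodule.add_mem _ (hs a ha) ?_
    rw [sh_sh]; simpa [sh_zero] using hg.1
  · intro v hv
    exact hx' _ (by linarith)

lemma U_mmf (Fs : List (Submodule k V)) {L : Submodule k (ℤ → V)} {lo : ℤ} (h : L ≤ Os k lo)
    (hs : Stab L) (s : ℤ) (W : Submodule k V) (hW : Wl (s + Fs.length) L ≤ W) :
    U s (mmf Fs L) ≤ U s L + (Fs.map fun F => finrank k (W ⊓ F : Submodule k V)).sum := by
  induction Fs generalizing L lo with
  | nil => simp
  | cons F Fs ih =>
    have h1 := ih (L := mm F L) (mm_le_Os h) (mm_stab hs)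
      ((Wl_mm hs _).trans (by
        rw [List.length_cons] at hW
        push_cast at hW
        rwa [add_assoc]))
    have h2 := U_mm (F := F) h hs s
    have h3 : Wl s L ≤ W := by
      refine le_trans ?_ hW
      have : ∀ m : ℕ, Wl s L ≤ Wl (s + m) L := by
        intro m
        induction m with
        | zero => simp
        | succ m ihm =>
          refine ihm.trans ((Wl_stab hs _).trans (le_of_eq ?_))
          push_cast; rw [add_assoc]
      exact this _
    have h4 : finrank k (Wl s L ⊓ F : Submodule k V) ≤ finrank k (W ⊓ F : Submodule k V) :=
      Submodule.finrank_mono (inf_le_inf_right _ h3)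
    simp only [mmf_cons, List.map_cons, List.sum_cons]
    omega

lemma U_mmf_large (Fs : List (Submodule k V)) {L : Submodule k (ℤ → V)} {lo : ℤ} (h : L ≤ Os k lo)
    (hs : Stab L) (s : ℤ) (hO : Os k s ≤ L) :
    U s (mmf Fs L) = U s L + (Fs.map fun F : Submodule k V => finrank k F).sum := by
  induction Fs generalizing L lo with
  | nil => simp
  | cons F Fs ih =>
    have h1 := ih (L := mm F L) (mm_le_Os h) (mm_stab hs) (hO.trans (le_mm _ _))
    have h2 := U_mm_large (F := F) h hs s hO
    simp only [mmf_cons, List.map_cons, List.sum_cons]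
    omega

theorem exists_fixed_lattice (Fs : List (Submodule k V)) (D : ℕ)
    (hsemi : ∀ W : Submodule k V,
      (Fs.map fun F => finrank k (W ⊓ F : Submodule k V)).sum ≤ D * finrank k W)
    (htop : (Fs.map fun F : Submodule k V => finrank k F).sum = D * finrank k V) :
    ∃ (M : Submodule k (ℤ → V)) (c : ℕ), Os k c ≤ M ∧ M ≤ Os k (-c) ∧ Stab M ∧
      mmf Fs M = M.map (sh (-D)) := by
  set B := Fs.length with hB
  set n := finrank k V with hn
  set c : ℕ := n * (D + B) + D with hc
  let Φ : Submodule k (ℤ → V) → Submodule k (ℤ → V) := fun L => (mmf Fs L).map (sh D)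
  let Ψ : Submodule k (ℤ → V) →o Submodule k (ℤ → V) :=
    ⟨fun L => (Φ L ⊔ Os k c) ⊓ Os k (-c), by
      intro a b hab
      exact inf_le_inf_right _ (sup_le_sup_right (Submodule.map_mono (mmf_mono Fs hab)) _)⟩
  set M := OrderHom.lfp Ψ with hM
  have hfix : (Φ M ⊔ Os k c) ⊓ Os k (-c) = M := OrderHom.map_lfp Ψ
  have hOM : Os k c ≤ M := by
    rw [← hfix]
    exact le_inf le_sup_right (Os_anti (by linarith))
  have hMO : M ≤ Os k (-c) := by rw [← hfix]; exact inf_le_right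
  have hst : Stab M := by
    refine OrderHom.lfp_induction Ψ (p := Stab) ?_ ?_
    · intro a ha _ x hx
      refine ⟨?_, ?_⟩
      · obtain ⟨y, ⟨z, hz, rfl⟩, w, hw, rfl⟩ := Submodule.mem_sup.1 hx.1
        rw [map_add]
        refine Submodule.add_mem_sup ⟨sh 1 z, mmf_stab Fs ha z hz, ?_⟩ ?_
        · rw [sh_sh, sh_sh, add_comm]
        · intro u hu
          exact hw _ (by linarith)
      · intro u hu
        exact hx.2 _ (by linarith)
    · intro S hS x hx
      have : sSup S ≤ (sSup S).comap (sh 1) := by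
        refine sSup_le fun L hL y hy => ?_
        exact (le_sSup hL : L ≤ sSup S) (hS L hL y hy)
      exact this hx
  -- pigeonhole
  have hWm : ∀ (u : ℤ) (m : ℕ), Wl u M ≤ Wl (u + m) M := by
    intro u m
    induction m with
    | zero => simp
    | succ m ihm =>
      refine ihm.trans ((Wl_stab hst _).trans (le_of_eq ?_))
      push_cast; rw [add_assoc]
  have hWm' : ∀ u v : ℤ, u ≤ v → Wl u M ≤ Wl v M := by
    intro u v huv
    have := hWm u (v - u).toNat
    rwa [Int.toNat_of_nonneg (by omega), add_sub_cancel] at this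
  obtain ⟨j, hj, hjj⟩ : ∃ j : ℕ, j ≤ n ∧
      finrank k (Wl ((j * (D + B) : ℕ) : ℤ) M) = finrank k (Wl (((j + 1) * (D + B) : ℕ) : ℤ) M) := by
    by_contra hcon
    push Not at hcon
    have : ∀ j : ℕ, j ≤ n + 1 → j ≤ finrank k (Wl ((j * (D + B) : ℕ) : ℤ) M) := by
      intro j
      induction j with
      | zero => simp
      | succ j ih =>
        intro hj
        have h1 := ih (by omega)
        have h2 := hcon j (by omega)
        have h3 : finrank k (Wl ((j * (D + B) : ℕ) : ℤ) M)
            ≤ finrank k (Wl (((j + 1) * (D + B) : ℕ) : ℤ) M) :=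
          Submodule.finrank_mono (hWm' _ _ (by
            exact_mod_cast Nat.mul_le_mul_right _ (Nat.le_succ j)))
        omega
    have h1 := this (n + 1) le_rfl
    have h2 := Submodule.finrank_le (Wl (((n + 1) * (D + B) : ℕ) : ℤ) M)
    omega
  set s0 : ℤ := ((j * (D + B) : ℕ) : ℤ) with hs0
  have hs1 : (((j + 1) * (D + B) : ℕ) : ℤ) = s0 + D + B := by rw [hs0]; push_cast; ring
  rw [hs1] at hjj
  set W := Wl s0 M with hW
  have hconst : ∀ u, s0 ≤ u → u ≤ s0 + D + B → Wl u M = W := by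
    intro u h1 h2
    refine le_antisymm ?_ (hWm' _ _ h1)
    have : W = Wl (s0 + D + B) M := Submodule.eq_of_le_of_finrank_eq (hWm' _ _ (by omega)) hjj
    rw [this]
    exact hWm' _ _ h2
  have hMf : mmf Fs M ≤ Os k (-c - B) := mmf_le_Os Fs hMO
  have hΦO : Φ M ≤ Os k (-c - B + D) := by
    have := Submodule.map_mono (f := sh (k := k) (V := V) D) hMf
    rwa [map_sh_Os] at this
  have hsc : s0 + D ≤ c := by
    rw [hs0, hc]; push_cast
    have : (j : ℤ) ≤ n := by exact_mod_cast hj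
    nlinarith
  have hUle : U (s0 + D) (Φ M) ≤ U (s0 + D) M := by
    change U (s0 + D) ((mmf Fs M).map (sh D)) ≤ _
    rw [U_sh, add_sub_cancel_right]
    have h1 := U_mmf Fs hMO hst s0 W (by rw [← hB, hconst _ (by omega) (by omega)])
    have h2 := hsemi W
    have h3 := U_add hMO s0 D (finrank k W) (fun u h1 h2 => by rw [hconst u h1 (by omega)])
    omega
  have hmap : M.map (res (s0 + D)) ≤ (Φ M).map (res (s0 + D)) := by
    refine U_mono hΦO _ ?_
    calc M = (Φ M ⊔ Os k c) ⊓ Os k (-c) := hfix.symm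
      _ ≤ Φ M ⊔ Os k c := inf_le_left
      _ ≤ _ := sup_le_sup_left (Os_anti hsc) _
  have hmapeq : M.map (res (s0 + D)) = (Φ M).map (res (s0 + D)) := by
    have := fd hΦO (s0 + D)
    exact Submodule.eq_of_le_of_finrank_le hmap hUle
  have hΦle : Φ M ≤ M := by
    have h1 := sup_of_map_le hmapeq.ge
    have h2 : Φ M ≤ Os k (-c) := h1.trans (sup_le hMO (Os_anti (by omega)))
    calc Φ M ≤ (Φ M ⊔ Os k c) ⊓ Os k (-c) := le_inf le_sup_left h2
      _ = M := hfix
  have hU2 : U (c + D) (Φ M) = U (c + D) M := by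
    change U (c + D) ((mmf Fs M).map (sh D)) = _
    rw [U_sh, add_sub_cancel_right, U_mmf_large Fs hMO hst c hOM, htop]
    refine (U_add hMO c D n (fun u h1 h2 => ?_)).symm
    have : Wl u M = ⊤ := by
      rw [eq_top_iff]
      intro v _
      have hO' : Pi.single u v ∈ Os k (V := V) u := by
        intro u' hu
        rw [Pi.single_apply, if_neg (by omega)]
      exact ⟨Pi.single u v, ⟨hOM (Os_anti h1 hO'), hO'⟩, by simp⟩
    rw [this, finrank_top]
  have hle2 : M ≤ Φ M := by
    have h1 : (Φ M).map (res (c + D : ℤ)) = M.map (res (c + D : ℤ)) := by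
      have := fd hMO (c + D)
      exact Submodule.eq_of_le_of_finrank_le (Submodule.map_mono hΦle) hU2.ge
    refine (sup_of_map_le h1.ge).trans (sup_le le_rfl ?_)
    have h2 : Os k c ≤ mmf Fs M := hOM.trans (le_mmf _ _)
    have := Submodule.map_mono (f := sh (k := k) (V := V) D) h2
    rwa [map_sh_Os] at this
  have hEq : Φ M = M := le_antisymm hΦle hle2
  refine ⟨M, c, hOM, hMO, hst, ?_⟩
  have := congrArg (Submodule.map (sh (k := k) (V := V) (-D))) hEq
  simp only [Φ] at this
  rwa [map_sh_sh, neg_add_cancel, map_sh_zero] at this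

end HornE


set_option linter.all false
namespace HornA
open Finset

/-- Integer-array form of Littlewood-Richardson fillings. -/
def LRArr (n : ℕ) (α β γ : ℕ → ℕ) : Prop :=
  ∃ lam : ℕ → ℕ → ℤ,
    (∀ q, q < n → lam 0 q = α q) ∧ (∀ q, q < n → lam n q = γ q) ∧
    (∀ i q, i < n → q < n → lam i q ≤ lam (i + 1) q) ∧
    (∀ i q, i < n → q + 1 < n → lam (i + 1) (q + 1) ≤ lam i q) ∧
    (∀ i m, i + 1 < n → m < n →
      ∑ q ∈ range (m + 1), (lam (i + 2) q - lam (i + 1) q) ≤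
      ∑ q ∈ range m, (lam (i + 1) q - lam i q)) ∧
    (∀ i, i < n → ∑ q ∈ range n, (lam (i + 1) q - lam i q) = β i)

section

lemma cardK (K : Finset (ℕ × ℕ)) (p : ℕ × ℕ → Prop) [DecidablePred p] (h : ∀ x, p x → x ∈ K) :
    Nat.card {x : ℕ × ℕ | p x} = (K.filter p).card := by
  rw [Nat.card_coe_set_eq, ← Set.ncard_coe_finset]
  congr 1
  ext x
  simp only [Set.mem_setOf_eq, coe_filter]
  exact ⟨fun hx => ⟨h x hx, hx⟩, fun hx => hx.2⟩

lemma card_rows (n m : ℕ) (p : ℕ × ℕ → Prop) [DecidablePred p] :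
    ((range n ×ˢ range m).filter p).card
      = ∑ q ∈ range n, ((range m).filter (fun c => p (q, c))).card := by
  simp only [Finset.card_filter]
  rw [Finset.sum_product]

variable {n : ℕ} {α β γ : ℕ → ℕ}

lemma filling_mem {T : ℕ × ℕ → ℕ} (hγ : Antitone γ) (hγn : ∀ m, n ≤ m → γ m = 0)
    (hT : IsLRFilling α β γ T) (x : ℕ × ℕ) (hx : T x ≠ 0) :
    x ∈ range n ×ˢ range (γ 0) ∧ InSkew α γ x := by
  have h1 : InSkew α γ x := by
    by_contra h
    exact hx (hT.1 x h)
  refine ⟨?_, h1⟩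
  rw [Finset.mem_product, Finset.mem_range, Finset.mem_range]
  constructor
  · by_contra h
    have := hγn x.1 (by omega)
    have := h1.2
    omega
  · exact lt_of_lt_of_le h1.2 (hγ (Nat.zero_le _))

lemma filling_le {T : ℕ × ℕ → ℕ} (hγ : Antitone γ) (hγn : ∀ m, n ≤ m → γ m = 0)
    (hβn : ∀ m, n ≤ m → β m = 0)
    (hT : IsLRFilling α β γ T) (x : ℕ × ℕ) : T x ≤ n := by
  by_contra h
  have h1 := hT.2.2.2.2.1 (T x - 1)
  rw [hβn _ (by omega), cardK (range n ×ˢ range (γ 0)) _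
    (fun y hy => (filling_mem hγ hγn hT y (by omega)).1), Finset.card_eq_zero,
    Finset.filter_eq_empty_iff] at h1
  exact h1 (filling_mem hγ hγn hT x (by omega)).1 (by omega)

lemma lr_to_arr (hα : Antitone α) (hγ : Antitone γ)
    (hβn : ∀ m, n ≤ m → β m = 0) (hγn : ∀ m, n ≤ m → γ m = 0)
    (hsum : ∑ i ∈ range n, γ i = ∑ i ∈ range n, α i + ∑ i ∈ range n, β i)
    {T : ℕ × ℕ → ℕ} (hT : IsLRFilling α β γ T) : LRArr n α β γ := by
  have hmem := filling_mem hγ hγn hT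
  have hle := filling_le hγ hγn hβn hT
  obtain ⟨h0, hpos, hrow, hcol, hcont, hlat⟩ := hT
  set N : ℕ → ℕ → ℕ := fun q k => ((range (γ 0)).filter (fun c => T (q, c) = k + 1)).card with hN
  -- content
  have hβN : ∀ k, ∑ q ∈ range n, N q k = β k := by
    intro k
    rw [← hcont k, cardK (range n ×ˢ range (γ 0)) _ (fun x hx => (hmem x (by omega)).1), card_rows]
  -- partial row counts
  have hrowc : ∀ q i, ∑ k ∈ range i, N q k =
      ((Ico (α q) (γ q)).filter (fun c => T (q, c) ≤ i)).card := by
    intro q i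
    simp only [hN]
    rw [← Finset.card_biUnion]
    · congr 1
      ext c
      simp only [mem_biUnion, mem_range, mem_filter, mem_Ico]
      constructor
      · rintro ⟨k, hk, hc, e⟩
        exact ⟨(hmem (q, c) (by omega)).2, by omega⟩
      · rintro ⟨hc, e⟩
        have := hpos (q, c) hc
        have := (hmem (q, c) (by omega)).1
        rw [Finset.mem_product, Finset.mem_range, Finset.mem_range] at this
        exact ⟨T (q, c) - 1, by omega, this.2, by omega⟩
    · intro a _ b _ hab
      rw [Function.onFun, Finset.disjoint_left]
      intro c hc hc'
      rw [mem_filter] at hc hc'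
      omega
  have hNle : ∀ q i, ∑ k ∈ range i, N q k ≤ γ q - α q := by
    intro q i
    rw [hrowc]
    refine (card_filter_le _ _).trans ?_
    simp
  have hfull : ∀ q, ∑ k ∈ range n, N q k = γ q - α q := by
    intro q
    rw [hrowc, Finset.filter_true_of_mem (fun c _ => hle _)]
    simp
  have hαγ : ∀ q, q < n → α q ≤ γ q := by
    have h1 : ∑ q ∈ range n, (γ q - α q) = ∑ k ∈ range n, β k := by
      rw [← Finset.sum_congr rfl (fun q _ => hfull q), Finset.sum_comm]
      exact Finset.sum_congr rfl (fun k _ => hβN k)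
    have h2 : ∑ q ∈ range n, (γ q) = ∑ q ∈ range n, (α q + (γ q - α q)) := by
      rw [Finset.sum_add_distrib, h1, hsum]
    have h3 := (Finset.sum_eq_sum_iff_of_le (s := range n) (f := γ)
      (g := fun q => α q + (γ q - α q)) (fun q _ => by omega)).1 h2
    intro q hq
    have := h3 q (mem_range.2 hq)
    omega
  -- characterization
  have hchar : ∀ q c i, InSkew α γ (q, c) → (T (q, c) ≤ i ↔ c < α q + ∑ k ∈ range i, N q k) := by
    intro q c i hc
    rw [hrowc]
    have hc1 : α q ≤ c := hc.1
    have hc2 : c < γ q := hc.2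
    constructor
    · intro h
      have : Ico (α q) (c + 1) ⊆ (Ico (α q) (γ q)).filter (fun c => T (q, c) ≤ i) := by
        intro d hd
        rw [mem_Ico] at hd
        rw [mem_filter, mem_Ico]
        refine ⟨⟨hd.1, by omega⟩, ?_⟩
        exact (hrow q d c ⟨hd.1, (by omega : d < γ q)⟩ hc (by omega)).trans h
      have := Finset.card_le_card this
      rw [Nat.card_Ico] at this
      omega
    · intro h
      by_contra hcon
      have : (Ico (α q) (γ q)).filter (fun c => T (q, c) ≤ i) ⊆ Ico (α q) c := by
        intro d hd
        rw [mem_filter, mem_Ico] at hd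
        rw [mem_Ico]
        refine ⟨hd.1.1, ?_⟩
        by_contra hdc
        have := hrow q c d hc ⟨hd.1.1, hd.1.2⟩ (by omega)
        omega
      have := Finset.card_le_card this
      rw [Nat.card_Ico] at this
      omega
  refine ⟨fun i q => ((α q + ∑ k ∈ range i, N q k : ℕ) : ℤ), ?_, ?_, ?_, ?_, ?_, ?_⟩
  · intro q _; simp
  · intro q hq
    beta_reduce
    have := hαγ q hq
    rw [hfull q]
    norm_cast
    omega
  · intro i q _ _
    beta_reduce
    norm_cast
    rw [Finset.sum_range_succ]
    omega
  · intro i q hi hq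
    beta_reduce
    norm_cast
    by_contra hcon
    push Not at hcon
    set x := α q + ∑ k ∈ range i, N q k with hx
    have e1 := hNle (q + 1) (i + 1)
    have e2 := hαγ (q + 1) hq
    have e3 : γ (q + 1) ≤ γ q := hγ (Nat.le_succ q)
    have e4 : α (q + 1) ≤ α q := hα (Nat.le_succ q)
    have s1 : InSkew α γ (q + 1, x) := ⟨by simp only; omega, by simp only; omega⟩
    have s2 : InSkew α γ (q, x) := ⟨by simp only; omega, by simp only; omega⟩
    have t1 := (hchar (q + 1) x (i + 1) s1).2 hcon
    have t2 := mt (hchar q x i s2).1 (by omega)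
    have t3 := hcol q x s2 s1
    omega
  · intro i m hi hm
    have hL := hlat m (α m + ∑ k ∈ range (i + 1), N m k) i (i + 1) (by omega)
    rw [cardK (range n ×ˢ range (γ 0)) _ (fun x hx => (hmem x (by omega)).1), card_rows,
      cardK (range n ×ˢ range (γ 0)) _ (fun x hx => (hmem x (by omega)).1), card_rows] at hL
    have hsub : ∀ (m i q : ℕ), ((α q + ∑ k ∈ range (i + 1), N q k : ℕ) : ℤ) -
        ((α q + ∑ k ∈ range i, N q k : ℕ) : ℤ) = (N q i : ℤ) := by
      intro m i q
      rw [Finset.sum_range_succ]; push_cast; ring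
    simp only [hsub m]
    norm_cast
    have a1 : ∑ q ∈ range (m + 1), N q (i + 1) ≤ ∑ q ∈ range n,
        ((range (γ 0)).filter (fun c => T (q, c) = i + 1 + 1 ∧ (q < m ∨ (q = m ∧
          α m + ∑ k ∈ range (i + 1), N m k ≤ c)))).card := by
      refine (Finset.sum_le_sum (fun q hq => ?_)).trans
        (Finset.sum_le_sum_of_subset (Finset.range_mono (by omega : m + 1 ≤ n)))
      refine Finset.card_le_card ?_
      intro c hc
      rw [mem_filter] at hc ⊢
      rw [mem_range] at hq
      refine ⟨hc.1, hc.2, ?_⟩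
      rcases Nat.lt_or_ge q m with h | h
      · exact Or.inl h
      · obtain rfl : q = m := by omega
        refine Or.inr ⟨rfl, ?_⟩
        have s1 := (hmem (q, c) (by omega)).2
        have := mt (hchar q c (i + 1) s1).2 (by omega)
        omega
    have a2 : ∑ q ∈ range n,
        ((range (γ 0)).filter (fun c => T (q, c) = i + 1 ∧ (q < m ∨ (q = m ∧
          α m + ∑ k ∈ range (i + 1), N m k ≤ c)))).card ≤ ∑ q ∈ range m, N q i := by
      rw [← Finset.sum_subset (Finset.range_mono hm.le)]
      · refine Finset.sum_le_sum (fun q hq => Finset.card_le_card ?_)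
        intro c hc
        rw [mem_filter] at hc ⊢
        exact ⟨hc.1, hc.2.1⟩
      · intro q _ hq
        rw [mem_range] at hq
        rw [Finset.card_eq_zero, Finset.filter_eq_empty_iff]
        rintro c - ⟨h1, h2⟩
        rcases h2 with h2 | ⟨rfl, h2⟩
        · exact hq h2
        · have s1 := (hmem (q, c) (by omega)).2
          have := (hchar q c (i + 1) s1).1 (by omega)
          omega
    exact (a1.trans hL).trans a2
  · intro i hi
    beta_reduce
    rw [← hβN i]
    push_cast
    refine Finset.sum_congr rfl (fun q _ => ?_)
    rw [Finset.sum_range_succ]; ring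


lemma card_downset (n : ℕ) (p : ℕ → Prop) [DecidablePred p] (hp : ∀ i, i + 1 < n → p (i + 1) → p i)
    (i : ℕ) (hi : i < n) : ((range n).filter p).card ≤ i ↔ ¬ p i := by
  have hd : ∀ j, j < n → ∀ d, d ≤ j → p j → p (j - d) := by
    intro j hj d
    induction d with
    | zero => intro _ h; simpa using h
    | succ d ih =>
      intro hd h
      refine hp (j - (d + 1)) (by omega) ?_
      have := ih (by omega) h
      rwa [show j - (d + 1) + 1 = j - d by omega]
  constructor
  · intro h hpi
    have : range (i + 1) ⊆ (range n).filter p := by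
      intro d hdm
      rw [mem_range] at hdm
      rw [mem_filter, mem_range]
      refine ⟨by omega, ?_⟩
      have := hd i hi (i - d) (by omega) hpi
      rwa [show i - (i - d) = d by omega] at this
    have := Finset.card_le_card this
    rw [card_range] at this
    omega
  · intro hpi
    have : (range n).filter p ⊆ range i := by
      intro d hdm
      rw [mem_filter, mem_range] at hdm
      rw [mem_range]
      by_contra hdi
      have := hd d hdm.1 (d - i) (by omega) hdm.2
      rw [show d - (d - i) = i by omega] at this
      exact hpi this
    have := Finset.card_le_card this
    rwa [card_range] at this

lemma arr_to_lr (hα : Antitone α) (hγ : Antitone γ)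
    (hβn : ∀ m, n ≤ m → β m = 0) (hγn : ∀ m, n ≤ m → γ m = 0)
    (h : LRArr n α β γ) : ∃ T, IsLRFilling α β γ T := by
  obtain ⟨lam, h0, hn, h2, h3, h4, h5⟩ := h
  have hmono : ∀ q, q < n → ∀ i j, i ≤ j → j ≤ n → lam i q ≤ lam j q := by
    intro q hq i j hij
    induction j, hij using Nat.le_induction with
    | base => intro _; exact le_rfl
    | succ j hij ih => intro hj; exact (ih (by omega)).trans (h2 j q (by omega) hq)
  have hlo : ∀ q, q < n → ∀ i, i ≤ n → (α q : ℤ) ≤ lam i q := by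
    intro q hq i hi; rw [← h0 q hq]; exact hmono q hq 0 i (by omega) hi
  have hhi : ∀ q, q < n → ∀ i, i ≤ n → lam i q ≤ γ q := by
    intro q hq i hi; rw [← hn q hq]; exact hmono q hq i n hi le_rfl
  classical
  let T : ℕ × ℕ → ℕ := fun x => if InSkew α γ x then
    ((range n).filter (fun i => lam i x.1 ≤ (x.2 : ℤ))).card else 0
  have hrn : ∀ x, InSkew α γ x → x.1 < n := by
    intro x hx
    by_contra hcon
    have := hγn x.1 (by omega)
    have := hx.2
    omega
  have hTle : ∀ x, T x ≤ n := by
    intro x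
    simp only [T]
    split_ifs
    · refine (card_filter_le _ _).trans ?_
      simp
    · omega
  have hchar : ∀ q c i, InSkew α γ (q, c) → i ≤ n → (T (q, c) ≤ i ↔ (c : ℤ) < lam i q) := by
    intro q c i hs hi
    have hq : q < n := hrn _ hs
    rcases Nat.lt_or_ge i n with h | h
    · simp only [T, if_pos hs]
      rw [card_downset n _ (fun j hj hp => (h2 j q (by omega) hq).trans hp) i h, not_le]
    · obtain rfl : i = n := by omega
      rw [hn q hq]
      have h1 : c < γ q := hs.2
      exact ⟨fun _ => by exact_mod_cast h1, fun _ => hTle _⟩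
  have hpos : ∀ c, InSkew α γ c → 1 ≤ T c := by
    rintro ⟨q, c⟩ hs
    by_contra hcon
    have hq : q < n := hrn _ hs
    have := (hchar q c 0 hs (by omega)).1 (by omega)
    rw [h0 q hq] at this
    have h1 : α q ≤ c := hs.1
    norm_cast at this
    omega
  have hT0 : ∀ x, ¬ InSkew α γ x → T x = 0 := fun x hx => by simp only [T, if_neg hx]
  have hlab : ∀ q c i, q < n → i < n → (T (q, c) = i + 1 ↔ lam i q ≤ c ∧ (c : ℤ) < lam (i + 1) q) := by
    intro q c i hq hi
    constructor
    · intro e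
      have hs : InSkew α γ (q, c) := by
        by_contra hcon
        have := hT0 _ hcon
        omega
      have a1 := (hchar q c (i + 1) hs (by omega)).1 (by omega)
      have a2 := mt (hchar q c i hs (by omega)).2 (by omega)
      exact ⟨not_lt.1 a2, a1⟩
    · rintro ⟨e1, e2⟩
      have b1 := hlo q hq i (by omega)
      have b2 := hhi q hq (i + 1) (by omega)
      have hs : InSkew α γ (q, c) := ⟨by simp only; omega, by simp only; omega⟩
      have a1 := (hchar q c (i + 1) hs (by omega)).2 e2
      have a2 := mt (hchar q c i hs (by omega)).1 (by omega)
      omega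
  have hmem : ∀ x, T x ≠ 0 → x ∈ range n ×ˢ range (γ 0) ∧ InSkew α γ x := by
    intro x hx
    have h1 : InSkew α γ x := by
      by_contra h
      exact hx (hT0 x h)
    refine ⟨?_, h1⟩
    rw [Finset.mem_product, Finset.mem_range, Finset.mem_range]
    exact ⟨hrn x h1, lt_of_lt_of_le h1.2 (hγ (Nat.zero_le _))⟩
  have hNrow : ∀ q i, q < n → i < n →
      (((range (γ 0)).filter (fun c => T (q, c) = i + 1)).card : ℤ) = lam (i + 1) q - lam i q := by
    intro q i hq hi
    have e : (range (γ 0)).filter (fun c => T (q, c) = i + 1)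
        = Ico (lam i q).toNat (lam (i + 1) q).toNat := by
      ext c
      rw [mem_filter, hlab q c i hq hi, mem_Ico, mem_range]
      have b1 := hlo q hq i (by omega)
      have b2 := hhi q hq (i + 1) (by omega)
      have b3 : γ q ≤ γ 0 := hγ (Nat.zero_le _)
      omega
    rw [e, Nat.card_Ico]
    have b1 := hlo q hq i (by omega)
    have b2 := h2 i q hi hq
    omega
  have hcnt : ∀ r i, r ≤ n → i < n → ((Nat.card {x : ℕ × ℕ | T x = i + 1 ∧ x.1 < r} : ℕ) : ℤ)
      = ∑ q ∈ range r, (lam (i + 1) q - lam i q) := by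
    intro r i hr hi
    rw [cardK (range n ×ˢ range (γ 0)) _ (fun x hx => (hmem x (by omega)).1), card_rows]
    rw [← Finset.sum_subset (Finset.range_mono hr)]
    · push_cast
      refine Finset.sum_congr rfl (fun q hq => ?_)
      rw [mem_range] at hq
      rw [← hNrow q i (by omega) hi]
      congr 2
      ext c
      simp [hq]
    · intro q _ hq
      rw [mem_range] at hq
      rw [Finset.card_eq_zero, Finset.filter_eq_empty_iff]
      rintro c - ⟨_, h2⟩
      exact hq h2
  have hfin : ∀ i (p : ℕ × ℕ → Prop), {x : ℕ × ℕ | T x = i + 1 ∧ p x}.Finite := by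
    intro i p
    refine Set.Finite.subset (range n ×ˢ range (γ 0)).finite_toSet ?_
    intro x hx
    exact (hmem x (by rw [hx.1]; omega)).1
  have hadj : ∀ r c k,
    Nat.card {x : ℕ × ℕ | T x = (k + 1) + 1 ∧ (x.1 < r ∨ (x.1 = r ∧ c ≤ x.2))} ≤
    Nat.card {x : ℕ × ℕ | T x = k + 1 ∧ (x.1 < r ∨ (x.1 = r ∧ c ≤ x.2))} := by
    intro r c k
    rcases Nat.lt_or_ge (k + 1) n with hk | hk
    · set m := min r (n - 1) with hm
      have b1 : Nat.card {x : ℕ × ℕ | T x = (k + 1) + 1 ∧ (x.1 < r ∨ (x.1 = r ∧ c ≤ x.2))} ≤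
        Nat.card {x : ℕ × ℕ | T x = (k + 1) + 1 ∧ x.1 < m + 1} := by
        refine Nat.card_mono (hfin _ _) ?_
        rintro x ⟨hx, hx'⟩
        have := hrn x (hmem x (by omega)).2
        exact ⟨hx, by omega⟩
      have b2 : Nat.card {x : ℕ × ℕ | T x = k + 1 ∧ x.1 < m} ≤
        Nat.card {x : ℕ × ℕ | T x = k + 1 ∧ (x.1 < r ∨ (x.1 = r ∧ c ≤ x.2))} := by
        refine Nat.card_mono (hfin _ _) ?_
        rintro x ⟨hx, hx'⟩
        exact ⟨hx, by omega⟩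
      have b3 : Nat.card {x : ℕ × ℕ | T x = (k + 1) + 1 ∧ x.1 < m + 1} ≤
          Nat.card {x : ℕ × ℕ | T x = k + 1 ∧ x.1 < m} := by
        have c1 := hcnt (m + 1) (k + 1) (by omega) hk
        have c2 := hcnt m k (by omega) (by omega)
        have c3 := h4 k m hk (by omega)
        have : ((Nat.card {x : ℕ × ℕ | T x = (k + 1) + 1 ∧ x.1 < m + 1} : ℕ) : ℤ) ≤
          ((Nat.card {x : ℕ × ℕ | T x = k + 1 ∧ x.1 < m} : ℕ) : ℤ) := by
          rw [c1, c2]; exact c3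
        exact_mod_cast this
      exact (b1.trans b3).trans b2
    · have : {x : ℕ × ℕ | T x = (k + 1) + 1 ∧ (x.1 < r ∨ (x.1 = r ∧ c ≤ x.2))} = ∅ := by
        ext x
        simp only [Set.mem_setOf_eq, Set.mem_empty_iff_false, iff_false]
        have := hTle x
        omega
      rw [this]; simp
  refine ⟨T, hT0, hpos, ?_, ?_, ?_, ?_⟩
  · intro i j j' hs hs' hjj
    simp only [T, if_pos hs, if_pos hs']
    refine Finset.card_le_card ?_
    intro x hx
    rw [mem_filter] at hx ⊢
    refine ⟨hx.1, hx.2.trans ?_⟩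
    exact_mod_cast hjj
  · intro q c hs hs'
    have hq : q + 1 < n := hrn _ hs'
    by_contra hcon
    have p1 := hpos _ hs
    obtain ⟨i, hi⟩ : ∃ i, T (q, c) = i + 1 := ⟨T (q, c) - 1, by omega⟩
    have hle := hTle (q, c)
    have a1 := (hlab q c i (by omega) (by omega)).1 hi
    have a2 := (hchar (q + 1) c (i + 1) hs' (by omega)).1 (by omega)
    have a3 := h3 i q (by omega) hq
    omega
  · intro k
    rcases Nat.lt_or_ge k n with hk | hk
    · have := hcnt n k le_rfl hk
      rw [h5 k hk] at this
      norm_cast at this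
      rw [← this]
      congr 2
      ext x
      simp only [Set.mem_setOf_eq]
      exact ⟨fun hx => ⟨hx, hrn x (hmem x (by omega)).2⟩, fun hx => hx.1⟩
    · rw [hβn k hk]
      have : {x : ℕ × ℕ | T x = k + 1} = ∅ := by
        ext x
        simp only [Set.mem_setOf_eq, Set.mem_empty_iff_false, iff_false]
        have := hTle x
        omega
      rw [this]; simp
  · intro r c k l hkl
    induction l, hkl using Nat.le_induction with
    | base => exact hadj r c k
    | succ l hl ih => exact (hadj r c l).trans ih

theorem lr_iff_arr (hα : Antitone α) (hγ : Antitone γ)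
    (hβn : ∀ m, n ≤ m → β m = 0) (hγn : ∀ m, n ≤ m → γ m = 0) 
    (hsum : ∑ i ∈ range n, γ i = ∑ i ∈ range n, α i + ∑ i ∈ range n, β i) :
    LR α β γ ≠ 0 ↔ LRArr n α β γ := by
  unfold LR
  rw [Nat.card_ne_zero]
  constructor
  · rintro ⟨⟨T, hT⟩, _⟩
    exact lr_to_arr hα hγ hβn hγn hsum hT
  · intro h
    obtain ⟨T, hT⟩ := arr_to_lr hα hγ hβn hγn h
    refine ⟨⟨T, hT⟩, ?_⟩
    let f : {T : ℕ × ℕ → ℕ // IsLRFilling α β γ T} → (↥(range n ×ˢ range (γ 0)) → Fin (n + 1)) :=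
      fun T x => ⟨T.1 x, Nat.lt_succ_of_le (filling_le hγ hγn hβn T.2 x)⟩
    refine Finite.of_injective f ?_
    intro T T' hTT
    apply Subtype.ext
    funext x
    by_cases hx : x ∈ range n ×ˢ range (γ 0)
    · have := congrFun hTT ⟨x, hx⟩
      simpa [f] using this
    · have e1 : T.1 x = 0 := by
        by_contra h; exact hx (filling_mem hγ hγn T.2 x h).1
      have e2 : T'.1 x = 0 := by
        by_contra h; exact hx (filling_mem hγ hγn T'.2 x h).1
      rw [e1, e2]

end
end HornA


set_option linter.all false
namespace HornB
open Finset Matrix Module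

section gen
variable {K Γ : Type*} [Field K] [LinearOrderedCommGroupWithZero Γ] (v : Valuation K Γ)

/-- integral matrices -/
def IntM {l m : Type*} (M : Matrix l m K) : Prop := ∀ i j, v (M i j) ≤ 1

variable {v}

lemma vprod {ι : Type*} (s : Finset ι) (f : ι → K) : v (∏ i ∈ s, f i) = ∏ i ∈ s, v (f i) :=
  map_prod v f s

lemma vprod_le_one {ι : Type*} (s : Finset ι) (f : ι → K) (h : ∀ i ∈ s, v (f i) ≤ 1) :
    v (∏ i ∈ s, f i) ≤ 1 := by
  rw [vprod]
  exact Finset.prod_le_one' h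

lemma IntM.mul {l m o : Type*} [Fintype m] {A : Matrix l m K} {B : Matrix m o K}
    (hA : IntM v A) (hB : IntM v B) : IntM v (A * B) := by
  intro i j
  rw [Matrix.mul_apply]
  refine v.map_sum_le fun q _ => ?_
  rw [map_mul]
  exact mul_le_one' (hA i q) (hB q j)

lemma IntM.one {m : Type*} [DecidableEq m] : IntM v (1 : Matrix m m K) := by
  intro i j
  rw [Matrix.one_apply]
  split_ifs <;> simp

lemma IntM.det {m : Type*} [DecidableEq m] [Fintype m] {A : Matrix m m K} (hA : IntM v A) :
    v A.det ≤ 1 := by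
  rw [Matrix.det_apply']
  refine v.map_sum_le fun q _ => ?_
  rw [map_mul]
  refine mul_le_one' ?_ (vprod_le_one _ _ fun i _ => hA _ _)
  rcases Int.units_eq_one_or (Equiv.Perm.sign q) with h | h <;> simp [h]

lemma IntM.adjugate {m : Type*} [DecidableEq m] [Fintype m] {A : Matrix m m K} (hA : IntM v A) :
    IntM v A.adjugate := by
  intro i j
  rw [Matrix.adjugate_apply]
  refine IntM.det ?_
  intro a b
  rw [Matrix.updateRow_apply]
  split_ifs
  · rw [Pi.single_apply]; split_ifs <;> simp
  · exact hA _ _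

/-- bound on all maximal minors -/
def Bnd (v : Valuation K Γ) {n r : ℕ} (z : Matrix (Fin n) (Fin r) K) (C : Γ) : Prop :=
  ∀ σ : Fin r → Fin n, v (z.submatrix σ id).det ≤ C

lemma det_mul_sub {n m r : ℕ} (A : Matrix (Fin n) (Fin m) K) (z : Matrix (Fin m) (Fin r) K)
    (σ : Fin r → Fin n) : ((A * z).submatrix σ id).det =
      ∑ τ : Fin r → Fin m, (∏ p, A (σ p) (τ p)) * (z.submatrix τ id).det := by
  have h1 : (A * z).submatrix σ id = fun p => ∑ q, A (σ p) q • z q := by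
    funext p j
    simp [Matrix.mul_apply, Finset.sum_apply]
  have h2 := MultilinearMap.map_sum (Matrix.detRowAlternating (n := Fin r) (R := K)).toMultilinearMap
    (fun p (q : Fin m) => A (σ p) q • z q)
  rw [h1]
  refine h2.trans ?_
  refine Finset.sum_congr rfl fun τ _ => ?_
  exact MultilinearMap.map_smul_univ (Matrix.detRowAlternating (n := Fin r) (R := K)).toMultilinearMap
    (fun p => A (σ p) (τ p)) (fun p => z (τ p))

lemma Bnd.mul {n m r : ℕ} {A : Matrix (Fin n) (Fin m) K} (hA : IntM v A)
    {z : Matrix (Fin m) (Fin r) K} {C : Γ} (h : Bnd v z C) : Bnd v (A * z) C := by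
  intro σ
  rw [det_mul_sub]
  refine v.map_sum_le fun τ _ => ?_
  rw [map_mul]
  calc _ ≤ 1 * C := mul_le_mul' (vprod_le_one _ _ fun p _ => hA _ _) (h τ)
    _ = C := one_mul C

lemma det_diag_sub {n r : ℕ} (d : Fin n → K) (z : Matrix (Fin n) (Fin r) K) (σ : Fin r → Fin n) :
    ((diagonal d * z).submatrix σ id).det = (∏ p, d (σ p)) * (z.submatrix σ id).det := by
  have : (diagonal d * z).submatrix σ id = diagonal (fun p => d (σ p)) * z.submatrix σ id := by
    ext p j
    simp [Matrix.diagonal_mul]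
  rw [this, Matrix.det_mul, Matrix.det_diagonal]

lemma Bnd.diag {n r : ℕ} {z : Matrix (Fin n) (Fin r) K} {C : Γ} (h : Bnd v z C) {π : K}
    (hπ1 : v π < 1) (a : Fin n → ℕ) (m : ℕ)
    (hm : ∀ σ : Fin r → Fin n, (z.submatrix σ id).det ≠ 0 → m ≤ ∑ p, a (σ p)) :
    Bnd v (diagonal (fun i => π ^ a i) * z) (v π ^ m * C) := by
  intro σ
  rw [det_diag_sub, map_mul]
  by_cases h0 : (z.submatrix σ id).det = 0
  · simp [h0]
  · refine mul_le_mul' ?_ (h σ)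
    rw [Finset.prod_pow_eq_pow_sum, map_pow]
    exact pow_le_pow_right_of_le_one' hπ1.le (hm σ h0)

/-- flag subspaces -/
def Fsub {n : ℕ} (g : Matrix (Fin n) (Fin n) K) (a : Fin n → ℕ) (s : ℕ) : Submodule K (Fin n → K) where
  carrier := {x | ∀ i, a i ≤ s → (g *ᵥ x) i = 0}
  add_mem' := by
    intro x y hx hy i hi
    rw [Matrix.mulVec_add, Pi.add_apply, hx i hi, hy i hi, add_zero]
  zero_mem' := by intro i _; simp
  smul_mem' := by
    intro c x hx i hi
    rw [Matrix.mulVec_smul, Pi.smul_apply, hx i hi, smul_zero]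

lemma mem_Fsub {n : ℕ} {g : Matrix (Fin n) (Fin n) K} {a : Fin n → ℕ} {s : ℕ} {x : Fin n → K} :
    x ∈ Fsub g a s ↔ ∀ i, a i ≤ s → (g *ᵥ x) i = 0 := Iff.rfl

lemma dim_le {n r : ℕ} (g : Matrix (Fin n) (Fin n) K) (a : Fin n → ℕ) (S : ℕ) (ha : ∀ i, a i ≤ S)
    (w : Matrix (Fin n) (Fin r) K) (hw : Function.Injective w.mulVec)
    (W : Submodule K (Fin n → K)) (hW : LinearMap.range w.mulVecLin = W)
    (σ : Fin r → Fin n) (hσ : ((g * w).submatrix σ id).det ≠ 0) :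
    ∑ s ∈ range S, finrank K (W ⊓ Fsub g a s : Submodule K (Fin n → K)) ≤ ∑ p, a (σ p) := by
  have key : ∀ s, finrank K (W ⊓ Fsub g a s : Submodule K (Fin n → K)) ≤
      (univ.filter (fun p => s < a (σ p))).card := by
    intro s
    set X := (Fsub g a s).comap w.mulVecLin with hX
    have e : W ⊓ Fsub g a s = X.map w.mulVecLin := by
      rw [hX, Submodule.map_comap_eq, hW]
    rw [e, ← (Submodule.equivMapOfInjective w.mulVecLin hw X).finrank_eq]
    let φ : X →ₗ[K] ({p // s < a (σ p)} → K) :=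
      (LinearMap.funLeft K K (fun p : {p // s < a (σ p)} => p.1)) ∘ₗ
        ((g * w).submatrix σ id).mulVecLin ∘ₗ X.subtype
    have hφ : Function.Injective φ := by
      rw [injective_iff_map_eq_zero]
      rintro ⟨x, hx⟩ h0
      have h1 : ((g * w).submatrix σ id) *ᵥ x = 0 := by
        funext p
        by_cases hp : s < a (σ p)
        · exact congrFun h0 ⟨p, hp⟩
        · have := hx (σ p) (not_lt.1 hp)
          rw [Matrix.mulVecLin_apply, Matrix.mulVec_mulVec] at this
          exact this
      have h2 := Matrix.eq_zero_of_mulVec_eq_zero hσ h1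
      exact Subtype.ext h2
    refine (LinearMap.finrank_le_finrank_of_injective hφ).trans (le_of_eq ?_)
    rw [Module.finrank_fintype_fun_eq_card, Fintype.card_subtype]
  calc _ ≤ ∑ s ∈ range S, (univ.filter (fun p => s < a (σ p))).card :=
        Finset.sum_le_sum fun s _ => key s
    _ = ∑ s ∈ range S, ∑ p, if s < a (σ p) then 1 else 0 := by
        simp only [Finset.card_filter]
    _ = ∑ p, ∑ s ∈ range S, if s < a (σ p) then 1 else 0 := Finset.sum_comm
    _ = ∑ p, a (σ p) := by
      refine Finset.sum_congr rfl fun p _ => ?_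
      rw [← Finset.card_filter]
      have : (range S).filter (fun s => s < a (σ p)) = range (a (σ p)) := by
        ext s; simp only [mem_filter, mem_range]; have := ha (σ p); omega
      rw [this, card_range]


/-- bidiagonal matrices -/
def Bi (n : ℕ) (d e : ℕ → K) : Matrix (Fin n) (Fin n) K := fun p q =>
  if q = p then d p else if (q : ℕ) = p + 1 then e p else 0

lemma Bi_det (n : ℕ) (d e : ℕ → K) : (Bi n d e).det = ∏ p : Fin n, d p := by
  rw [Matrix.det_of_isUpperTriangular]
  · refine Finset.prod_congr rfl fun p _ => ?_
    simp [Bi]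
  · intro p q hpq
    have hpq' : (q : ℕ) < p := hpq
    simp only [Bi]
    rw [if_neg (by intro h; rw [h] at hpq'; omega), if_neg (by omega)]

lemma Bi_mulVec (n : ℕ) (d e : ℕ → K) (y : ℕ → K) (hy : y n = 0) (p : Fin n) :
    (Bi n d e *ᵥ fun q : Fin n => y q) p = d p * y p + e p * y (p + 1) := by
  rw [Matrix.mulVec, dotProduct]
  have h1 : ∀ q : Fin n, Bi n d e p q * y q =
      (if q = p then d p * y q else 0) + (if (q : ℕ) = p + 1 then e p * y q else 0) := by
    intro q
    simp only [Bi]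
    by_cases h : q = p
    · subst h; simp
    · simp [h]
  simp only [h1]
  rw [Finset.sum_add_distrib, Finset.sum_ite_eq' univ p]
  simp only [mem_univ, if_true]
  congr 1
  by_cases hp : (p : ℕ) + 1 < n
  · rw [Finset.sum_eq_single (⟨p + 1, hp⟩ : Fin n)]
    · simp
    · intro b _ hb
      rw [if_neg]
      intro h; apply hb; ext; exact h
    · simp
  · have : (p : ℕ) + 1 = n := by have := p.2; omega
    rw [this, hy, mul_zero]
    refine Finset.sum_eq_zero fun q _ => ?_
    rw [if_neg (by have := q.2; omega)]

lemma diag_Bi (n : ℕ) (x y d e d' e' : ℕ → K) (h1 : ∀ p, p < n → x p * d p = d' p * y p)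
    (h2 : ∀ p, p + 1 < n → x p * e p = e' p * y (p + 1)) :
    diagonal (fun i : Fin n => x i) * Bi n d e = Bi n d' e' * diagonal (fun i : Fin n => y i) := by
  ext p q
  rw [Matrix.diagonal_mul, Matrix.mul_diagonal]
  simp only [Bi]
  split_ifs with a b
  · subst a; exact h1 _ q.2
  · rw [b]; exact h2 _ (by rw [← b]; exact q.2)
  · simp

/-- ordered products -/
def Qf {n : ℕ} (N : ℕ → Matrix (Fin n) (Fin n) K) : ℕ → ℕ → Matrix (Fin n) (Fin n) K
  | _, 0 => 1
  | a, m + 1 => N a * Qf N (a + 1) m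

lemma Qf_add {n : ℕ} (N : ℕ → Matrix (Fin n) (Fin n) K) (a m m' : ℕ) :
    Qf N a (m + m') = Qf N a m * Qf N (a + m) m' := by
  induction m generalizing a with
  | zero => simp [Qf]
  | succ m ih =>
    rw [show m + 1 + m' = (m + m') + 1 by ring]
    simp only [Qf]
    rw [ih, Matrix.mul_assoc, show a + 1 + m = a + (m + 1) by ring]

lemma Qf_int {n : ℕ} {N : ℕ → Matrix (Fin n) (Fin n) K} (h : ∀ i, IntM v (N i)) (a m : ℕ) :
    IntM v (Qf N a m) := by
  induction m generalizing a with
  | zero => exact IntM.one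
  | succ m ih => exact (h a).mul (ih _)

lemma Qf_det {n : ℕ} {N : ℕ → Matrix (Fin n) (Fin n) K} (h : ∀ i, (N i).det = 1) (a m : ℕ) :
    (Qf N a m).det = 1 := by
  induction m generalizing a with
  | zero => simp [Qf]
  | succ m ih => simp [Qf, h, ih]

lemma Qf_det_ne {n : ℕ} {N : ℕ → Matrix (Fin n) (Fin n) K} (h : ∀ i, (N i).det ≠ 0) (a m : ℕ) :
    (Qf N a m).det ≠ 0 := by
  induction m generalizing a with
  | zero => simp [Qf]
  | succ m ih =>
    simp only [Qf, Matrix.det_mul]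
    exact mul_ne_zero (h a) (ih _)

lemma Qf_conj {n : ℕ} {N M : ℕ → Matrix (Fin n) (Fin n) K} {P : ℕ → Matrix (Fin n) (Fin n) K}
    (a m : ℕ) (h : ∀ i, i < a + m → P i * N i = M i * P (i + 1)) :
    P a * Qf N a m = Qf M a m * P (a + m) := by
  induction m generalizing a with
  | zero => simp [Qf]
  | succ m ih =>
    simp only [Qf]
    rw [← Matrix.mul_assoc, h a (by omega), Matrix.mul_assoc, ih (a + 1) (fun i hi => h i (by omega)),
      Matrix.mul_assoc, show a + 1 + m = a + (m + 1) by ring]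

end gen

section main
variable {K Γ : Type*} [Field K] [LinearOrderedCommGroupWithZero Γ] {v : Valuation K Γ}

/-- Extend a vector by zero. -/
def ext0 {n : ℕ} (y : Fin n → K) : ℕ → K := fun q => if h : q < n then y ⟨q, h⟩ else 0

lemma ext0_fin {n : ℕ} (y : Fin n → K) : (fun q : Fin n => ext0 y q) = y := by
  funext q; simp [ext0]

/-- the matrices N_i -/
def Nm (π : K) (n : ℕ) (k : ℕ → ℕ → ℕ) (i : ℕ) : Matrix (Fin n) (Fin n) K :=
  Bi n (fun p => π ^ k i p) (fun p => if i ≤ p then 1 else 0)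

lemma Nm_det {π : K} (hπ0 : π ≠ 0) (n : ℕ) (k : ℕ → ℕ → ℕ) (i : ℕ) : (Nm π n k i).det ≠ 0 := by
  rw [Nm, Bi_det]
  exact Finset.prod_ne_zero_iff.2 fun p _ => pow_ne_zero _ hπ0

lemma Nm_int {π : K} (hπ1 : v π < 1) (n : ℕ) (k : ℕ → ℕ → ℕ) (i : ℕ) : IntM v (Nm π n k i) := by
  intro p q
  simp only [Nm, Bi]
  split_ifs
  · rw [map_pow]; exact pow_le_one' hπ1.le _
  · simp
  · simp
  · simp

lemma solve {π : K} (hπ0 : π ≠ 0) (hπ1 : v π < 1) (n : ℕ) (k : ℕ → ℕ → ℕ) (i : ℕ) (hi : i + 1 < n)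
    (s : ℕ → ℕ → ℕ) (hs : ∀ i m, s i m = ∑ q ∈ range m, k i q)
    (hs1 : ∀ m, m < n → s (i + 1) (m + 1) ≤ s i m) (hs0 : ∀ m, m ≤ i + 1 → s (i + 1) m = 0)
    (c : Fin n → K) (hc : ∀ p : Fin n, v (c p) ≤ v π ^ s i p) :
    ∃ y : Fin n → K, Nm π n k (i + 1) *ᵥ y = c ∧ (∀ p : Fin n, v (y p) ≤ v π ^ s (i + 1) p) ∧
      ∀ p : Fin n, (p : ℕ) ≤ i → y p = c p := by
  have hv0 : v π ≠ 0 := (Valuation.ne_zero_iff v).2 hπ0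
  have hdet := Nm_det hπ0 n k (i + 1)
  obtain ⟨y, hy⟩ : ∃ y, Nm π n k (i + 1) *ᵥ y = c :=
    ⟨(Nm π n k (i + 1))⁻¹ *ᵥ c, by
      rw [Matrix.mulVec_mulVec, Matrix.mul_nonsing_inv _ (isUnit_iff_ne_zero.2 hdet), one_mulVec]⟩
  have heq : ∀ p : Fin n, π ^ k (i + 1) p * ext0 y p +
      (if i + 1 ≤ (p : ℕ) then 1 else 0) * ext0 y (p + 1) = c p := by
    intro p
    rw [← hy]
    conv_rhs => rw [← ext0_fin y]
    rw [Nm, Bi_mulVec n _ _ _ (by simp [ext0])]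
  have hk0 : ∀ p, p ≤ i → k (i + 1) p = 0 := by
    intro p hp
    have h1 := hs0 (p + 1) (by omega)
    rw [hs, Finset.sum_range_succ] at h1
    omega
  have hyc : ∀ p : Fin n, (p : ℕ) ≤ i → y p = c p := by
    intro p hp
    have := heq p
    rw [hk0 p hp, if_neg (by omega)] at this
    simpa [ext0] using this
  refine ⟨y, hy, ?_, hyc⟩
  have main : ∀ d p : ℕ, p + d = n → v (ext0 y p) ≤ v π ^ s (i + 1) p := by
    intro d
    induction d with
    | zero =>
      intro p hp
      have : ext0 y p = 0 := by simp [ext0, show ¬ p < n by omega]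
      rw [this]; simp
    | succ d ih =>
      intro p hp
      have hpn : p < n := by omega
      rcases Nat.lt_or_ge i p with hip | hip
      · have e := heq ⟨p, hpn⟩
        simp only at e
        rw [if_pos (by omega), one_mul] at e
        have e2 : π ^ k (i + 1) p * ext0 y p = c ⟨p, hpn⟩ - ext0 y (p + 1) := by
          rw [← e]; ring
        have e3 : v (π ^ k (i + 1) p * ext0 y p) ≤ v π ^ s (i + 1) (p + 1) := by
          rw [e2]
          refine (v.map_sub _ _).trans (max_le ?_ (ih (p + 1) (by omega)))
          exact (hc ⟨p, hpn⟩).trans (pow_le_pow_right_of_le_one' hπ1.le (hs1 p hpn))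
        rw [map_mul, map_pow, hs (i + 1) (p + 1), Finset.sum_range_succ, ← hs,
          Nat.add_comm (s (i + 1) p) (k (i + 1) p), pow_add] at e3
        exact le_of_mul_le_mul_left e3 (pow_pos (zero_lt_iff.2 hv0) _)
      · rw [hs0 p (by omega), pow_zero]
        have : ext0 y p = c ⟨p, hpn⟩ := by
          rw [← hyc ⟨p, hpn⟩ hip]; simp [ext0, hpn]
        rw [this]
        refine (hc ⟨p, hpn⟩).trans ?_
        exact pow_le_one' hπ1.le _
  intro p
  have := main (n - p) p (by have := p.2; omega)
  simpa [ext0] using this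

lemma solves {π : K} (hπ0 : π ≠ 0) (hπ1 : v π < 1) (n : ℕ) (k : ℕ → ℕ → ℕ)
    (s : ℕ → ℕ → ℕ) (hs : ∀ i m, s i m = ∑ q ∈ range m, k i q)
    (hs1 : ∀ i m, i + 1 < n → m < n → s (i + 1) (m + 1) ≤ s i m)
    (hs0 : ∀ i m, i < n → m ≤ i → s i m = 0) (m : ℕ) :
    ∀ (i : ℕ) (hi : i + m < n) 
    (c : Fin n → K) (hc : ∀ p : Fin n, v (c p) ≤ v π ^ s i p),
    ∃ y : Fin n → K, Qf (Nm π n k) (i + 1) m *ᵥ y = c ∧ (∀ p : Fin n, v (y p) ≤ 1) ∧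
      ∀ p : Fin n, (p : ℕ) ≤ i → y p = c p := by
  induction m with
  | zero =>
    intro i hi c hc
    exact ⟨c, by simp [Qf], fun p => (hc p).trans (pow_le_one' hπ1.le _), fun _ _ => rfl⟩
  | succ m ih =>
    intro i hi c hc
    obtain ⟨y, h1, h2, h3⟩ := solve hπ0 hπ1 n k i (by omega) s hs (fun m hm => hs1 i m (by omega) hm)
      (fun m hm => hs0 (i + 1) m (by omega) hm) c hc
    obtain ⟨y', h1', h2', h3'⟩ := ih (i + 1) (by omega) y h2
    refine ⟨y', ?_, h2', fun p hp => ?_⟩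
    · simp only [Qf]
      rw [← Matrix.mulVec_mulVec, h1', h1]
    · rw [h3' p (by omega), h3 p hp]

lemma exists_col {π : K} (hπ0 : π ≠ 0) (hπ1 : v π < 1) (n : ℕ) (k : ℕ → ℕ → ℕ)
    (s : ℕ → ℕ → ℕ) (hs : ∀ i m, s i m = ∑ q ∈ range m, k i q)
    (hs1 : ∀ i m, i + 1 < n → m < n → s (i + 1) (m + 1) ≤ s i m)
    (hs0 : ∀ i m, i < n → m ≤ i → s i m = 0) (j : Fin n) :
    ∃ y : Fin n → K, (∀ p : Fin n, v (y p) ≤ 1) ∧ (∀ p, p < j → y p = 0) ∧ y j = 1 ∧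
      ∀ p, v ((Qf (Nm π n k) 0 n *ᵥ y) p) ≤ v π ^ s j n := by
  let z : ℕ → K := fun p => if p < j then 0 else if p < n then (-1) ^ (p - j) * π ^ s j p else 0
  have hjn := j.2
  obtain ⟨y, h1, h2, h3⟩ := solves hπ0 hπ1 n k s hs hs1 hs0 (n - 1 - j) j (by omega)
    (fun p : Fin n => z p) (by
      intro p
      simp only [z]
      split_ifs
      · simp
      · rw [map_mul, map_pow, map_pow, Valuation.map_neg, map_one, one_pow, one_mul]
      · simp)
  refine ⟨y, h2, ?_, ?_, ?_⟩
  · intro p hp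
    have hp' : (p : ℕ) < j := hp
    rw [h3 p hp'.le]
    simp [z, hp']
  · rw [h3 j le_rfl]
    simp [z, hs0 j j hjn le_rfl]
  · have e1 : Qf (Nm π n k) 0 n = Qf (Nm π n k) 0 j * (Nm π n k j * Qf (Nm π n k) (j + 1) (n - 1 - j)) := by
      have := Qf_add (Nm π n k) 0 j (n - 1 - j + 1)
      rw [show (j : ℕ) + (n - 1 - j + 1) = n by omega, zero_add] at this
      exact this
    rw [e1, ← Matrix.mulVec_mulVec, ← Matrix.mulVec_mulVec, h1]
    have e2 : ∀ p : Fin n, v ((Nm π n k j *ᵥ fun p : Fin n => z p) p) ≤ v π ^ s j n := by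
      intro p
      rw [Nm, Bi_mulVec n _ _ z (by simp [z])]
      have hpn := p.2
      have hss : s j (p + 1) = s j p + k j p := by rw [hs, hs, Finset.sum_range_succ]
      rcases Nat.lt_or_ge p j with hp | hp
      · simp only [z]
        rw [if_pos hp, if_neg (by omega : ¬ (j : ℕ) ≤ p)]
        simp
      · have hzp : z p = (-1) ^ ((p : ℕ) - j) * π ^ s j p := by
          simp only [z]; rw [if_neg (by omega), if_pos hpn]
        rw [if_pos hp, one_mul, hzp]
        rcases Nat.lt_or_ge (p + 1) n with hp1 | hp1
        · have : z (p + 1) = (-1) ^ ((p : ℕ) + 1 - j) * π ^ s j (p + 1) := by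
            simp only [z]; rw [if_neg (by omega), if_pos hp1]
          rw [this, hss, show (p : ℕ) + 1 - j = (p - j) + 1 by omega]
          have : π ^ k j p * ((-1) ^ ((p : ℕ) - j) * π ^ s j p) +
            (-1) ^ ((p : ℕ) - j + 1) * π ^ (s j p + k j p) = 0 := by ring
          rw [this]; simp
        · have : z (p + 1) = 0 := by
            simp only [z]; rw [if_neg (by omega), if_neg (by omega)]
          have hsn : s j n = s j p + k j p := by
            rw [← hss]; congr 1; omega
          rw [this, add_zero, hsn]
          simp only [map_mul, map_pow, Valuation.map_neg, map_one, one_pow, one_mul]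
          rw [pow_add, mul_comm]
    intro p
    rw [Matrix.mulVec, dotProduct]
    refine v.map_sum_le fun q _ => ?_
    rw [map_mul]
    calc _ ≤ 1 * v π ^ s j n := mul_le_mul' (Qf_int (fun i => Nm_int hπ1 n k i) _ _ _ _) (e2 q)
      _ = _ := one_mul _



lemma exists_left {n r : ℕ} (w : Matrix (Fin n) (Fin r) K) (hw : Function.Injective w.mulVec) :
    ∃ σ : Fin r → Fin n, (w.submatrix σ id).det ≠ 0 := by
  obtain ⟨f, hf⟩ := LinearMap.exists_leftInverse_of_injective w.mulVecLin
    (LinearMap.ker_eq_bot.2 hw)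
  have h1 : LinearMap.toMatrix' f * w = 1 := by
    have : LinearMap.toMatrix' (f ∘ₗ w.mulVecLin) = 1 := by rw [hf, LinearMap.toMatrix'_id]
    rw [LinearMap.toMatrix'_comp] at this
    simpa [← Matrix.toLin'_apply', LinearMap.toMatrix'_toLin'] using this
  have h2 := det_mul_sub (LinearMap.toMatrix' f) w id
  rw [h1, Matrix.submatrix_id_id, Matrix.det_one] at h2
  by_contra! h
  simp [h] at h2

lemma exists_basis_mat {n : ℕ} (W : Submodule K (Fin n → K)) :
    ∃ w : Matrix (Fin n) (Fin (finrank K W)) K, Function.Injective w.mulVec ∧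
      LinearMap.range w.mulVecLin = W := by
  let b := Module.finBasis K W
  refine ⟨Matrix.of fun i j => (b j : Fin n → K) i, ?_, ?_⟩
  · have hli : LinearIndependent K (fun j => (b j : Fin n → K)) :=
      b.linearIndependent.map' W.subtype (Submodule.ker_subtype W)
    exact Matrix.mulVec_injective_iff.2 hli
  · rw [Matrix.range_mulVecLin]
    have : Set.range (Matrix.of fun i j => (b j : Fin n → K) i).col = W.subtype '' Set.range b := by
      rw [← Set.range_comp]; rfl
    rw [this, Submodule.span_image, b.span_eq, Submodule.map_top, Submodule.range_subtype]

lemma chain {π : K} (hπ0 : π ≠ 0) (hπ1 : v π < 1) (n : ℕ) (α β γ : Fin n → ℕ) (S D : ℕ)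
    (hα : ∀ i, α i ≤ S) (hβ : ∀ i, β i ≤ S) (hD : ∀ i, γ i ≤ D) (hDS : D ≤ S)
    (Q U V T : Matrix (Fin n) (Fin n) K) (hU : IntM v U) (hV : IntM v V) (hT : IntM v T)
    (hQ : U * (diagonal (fun i => π ^ β i) * V) = Q)
    (hT1 : T * (diagonal (fun i => π ^ α i) * Q) = diagonal (fun i => π ^ γ i))
    (W : Submodule K (Fin n → K)) :
    ∑ s ∈ range S, finrank K (W ⊓ Fsub Q α s : Submodule K (Fin n → K)) +
    ∑ s ∈ range S, finrank K (W ⊓ Fsub V β s : Submodule K (Fin n → K)) +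
    ∑ s ∈ range S, finrank K (W ⊓ Fsub 1 (fun i => D - γ i) s : Submodule K (Fin n → K)) ≤
      D * finrank K W := by
  obtain ⟨w, hw, hW⟩ := exists_basis_mat W
  obtain ⟨σ0, hσ0⟩ := exists_left w hw
  obtain ⟨σ, -, hσ⟩ := Finset.exists_max_image univ
    (fun σ : Fin (finrank K W) → Fin n => v (w.submatrix σ id).det) ⟨σ0, mem_univ _⟩
  set C := v (w.submatrix σ id).det with hC
  have hC0 : C ≠ 0 := by
    intro h
    have := hσ σ0 (mem_univ _)
    rw [h] at this
    exact hσ0 ((Valuation.zero_iff v).1 (le_zero_iff.1 this))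
  have b0 : Bnd v w C := fun τ => hσ τ (mem_univ _)
  have b1 := (b0.mul hV).diag hπ1 β _ (fun τ hτ => dim_le V β S hβ w hw W hW τ hτ)
  have b2 := b1.mul hU
  have e2 : U * (diagonal (fun i => π ^ β i) * (V * w)) = Q * w := by
    rw [← hQ]; simp only [Matrix.mul_assoc]
  rw [e2] at b2
  have b3 := b2.diag hπ1 α _ (fun τ hτ => dim_le Q α S hα w hw W hW τ hτ)
  have b4 := b3.mul hT
  have e4 : T * (diagonal (fun i => π ^ α i) * (Q * w)) = diagonal (fun i => π ^ γ i) * w := by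
    rw [← hT1]; simp only [Matrix.mul_assoc]
  rw [e4] at b4
  have b5 := b4.diag hπ1 (fun i => D - γ i) _ (fun τ hτ =>
    dim_le 1 (fun i => D - γ i) S (fun i => by omega) w hw W hW τ (by
      rw [det_diag_sub] at hτ
      rw [Matrix.one_mul]
      exact right_ne_zero_of_mul hτ))
  have b6 := b5 σ
  rw [det_diag_sub, det_diag_sub, ← mul_assoc, ← Finset.prod_mul_distrib] at b6
  have e6 : ∏ i, π ^ (D - γ (σ i)) * π ^ γ (σ i) = π ^ (D * finrank K W) := by
    have : ∀ i, π ^ (D - γ (σ i)) * π ^ γ (σ i) = π ^ D := by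
      intro i
      rw [← pow_add, Nat.sub_add_cancel (hD _)]
    simp only [this]
    simp [pow_mul]
  rw [e6, map_mul, map_pow, ← mul_assoc, ← mul_assoc, ← pow_add, ← pow_add] at b6
  have b7 := le_of_mul_le_mul_right b6 (zero_lt_iff.2 hC0)
  have hv0 : v π ≠ 0 := (Valuation.ne_zero_iff v).2 hπ0
  have b8 := (pow_le_pow_iff_right_of_lt_one₀ (zero_lt_iff.2 hv0) hπ1).1 b7
  omega

lemma semist0 {π : K} (hπ0 : π ≠ 0) (hπ1 : v π < 1) (n : ℕ) (α β γ : ℕ → ℕ) (S D : ℕ)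
    (hα : ∀ i, i < n → α i ≤ S) (hβ : ∀ i, i < n →  β i ≤ S) (hD : ∀ i, i < n → γ i ≤ D) (hDS : D ≤ S)
    (k : ℕ → ℕ → ℕ) (lam : ℕ → ℕ → ℕ)
    (hs1 : ∀ i m, i + 1 < n → m < n → ∑ q ∈ range (m + 1), k (i + 1) q ≤ ∑ q ∈ range m, k i q)
    (hkβ : ∀ i, i < n → ∑ q ∈ range n, k i q = β i)
    (hl0 : ∀ q, q < n → lam 0 q = α q) (hln : ∀ q, q < n → lam n q = γ q)
    (hlk : ∀ i q, i < n → q < n → lam (i + 1) q = lam i q + k i q)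
    (hli : ∀ i q, i < n → q + 1 < n → lam (i + 1) (q + 1) ≤ lam i q) :
    ∃ Q V : Matrix (Fin n) (Fin n) K, Q.det ≠ 0 ∧ V.det ≠ 0 ∧ ∀ W : Submodule K (Fin n → K),
    ∑ s ∈ range S, finrank K (W ⊓ Fsub Q (fun i => α i) s : Submodule K (Fin n → K)) +
    ∑ s ∈ range S, finrank K (W ⊓ Fsub V (fun i => β i) s : Submodule K (Fin n → K)) +
    ∑ s ∈ range S, finrank K (W ⊓ Fsub 1 (fun i : Fin n => D - γ i) s : Submodule K (Fin n → K)) ≤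
      D * finrank K W := by
  have hv0 : v π ≠ 0 := (Valuation.ne_zero_iff v).2 hπ0
  have hs0 : ∀ i m, i < n → m ≤ i → ∑ q ∈ range m, k i q = 0 := by
    intro i
    induction i with
    | zero => intro m _ hm; rw [Nat.le_zero.1 hm]; simp
    | succ i ih =>
      intro m hi hm
      rcases m with _ | m
      · simp
      · have h1 := hs1 i m hi (by omega)
        have h2 := ih m (by omega) (by omega)
        omega
  choose y hy1 hy2 hy3 hy4 using exists_col (v := v) hπ0 hπ1 n k
    (fun i m => ∑ q ∈ range m, k i q) (fun _ _ => rfl) hs1 hs0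
  set Q := Qf (Nm π n k) 0 n with hQ
  let Y : Matrix (Fin n) (Fin n) K := Matrix.of fun i j => y j i
  have hYint : IntM v Y := fun i j => hy1 j i
  have hYdet : Y.det = 1 := by
    rw [Matrix.det_of_isLowerTriangular]
    · exact Finset.prod_eq_one fun i _ => hy3 i
    · intro i j hij
      exact hy2 j i (by simpa using hij)
  have hYV : Y * Y.adjugate = 1 := by rw [Matrix.mul_adjugate, hYdet, one_smul]
  let U : Matrix (Fin n) (Fin n) K := Q * Y * diagonal (fun i : Fin n => (π ^ β i)⁻¹)
  have hUint : IntM v U := by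
    intro i j
    rw [show U = Q * Y * diagonal (fun i : Fin n => (π ^ β i)⁻¹) from rfl,
      Matrix.mul_diagonal, map_mul, map_inv₀, map_pow]
    have h1 := hy4 j i
    rw [hkβ j j.2] at h1
    have h2 : (Q * Y) i j = (Q *ᵥ y j) i := rfl
    rw [h2]
    have hp : (0 : Γ) < v π ^ β j := pow_pos (zero_lt_iff.2 hv0) _
    calc _ ≤ v π ^ β j * (v π ^ β j)⁻¹ := mul_le_mul_left h1 _
      _ = 1 := mul_inv_cancel₀ hp.ne'
  have hQU : U * (diagonal (fun i : Fin n => π ^ β i) * Y.adjugate) = Q := by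
    have : diagonal (fun i : Fin n => (π ^ β i)⁻¹) * diagonal (fun i : Fin n => π ^ β i) = 1 := by
      rw [Matrix.diagonal_mul_diagonal, ← Matrix.diagonal_one]
      congr 1
      funext i
      exact inv_mul_cancel₀ (pow_ne_zero _ hπ0)
    simp only [U]
    rw [← Matrix.mul_assoc, Matrix.mul_assoc (Q * Y), this, Matrix.mul_one, Matrix.mul_assoc, hYV,
      Matrix.mul_one]
  let M : ℕ → Matrix (Fin n) (Fin n) K := fun i =>
    Bi n (fun _ => 1) (fun p => if i ≤ p then π ^ (lam i p - lam (i + 1) (p + 1)) else 0)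
  have hMint : ∀ i, IntM v (M i) := by
    intro i p q
    simp only [M, Bi]
    split_ifs
    · simp
    · rw [map_pow]; exact pow_le_one' hπ1.le _
    · simp
    · simp
  have hMdet : ∀ i, (M i).det = 1 := by
    intro i; simp only [M]; rw [Bi_det]; simp
  have hconj := Qf_conj (N := Nm π n k) (M := M)
    (P := fun i => diagonal (fun p : Fin n => π ^ lam i p)) 0 n (by
      intro i hi
      refine diag_Bi n (fun p => π ^ lam i p) (fun p => π ^ lam (i + 1) p) _ _ _ _ ?_ ?_
      · intro p hp
        rw [← pow_add, hlk i p (by omega) hp, one_mul]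
      · intro p hp
        split_ifs with h
        · rw [← pow_add, Nat.sub_add_cancel (hli i p (by omega) hp), mul_one]
        · simp)
  simp only [zero_add] at hconj
  rw [← hQ] at hconj
  set U3 := Qf M 0 n with hU3
  have hT1 : U3.adjugate * (diagonal (fun i : Fin n => π ^ α i) * Q) =
      diagonal (fun i : Fin n => π ^ γ i) := by
    have e0 : (fun i : Fin n => π ^ α i) = fun i : Fin n => π ^ lam 0 i := by
      funext i; rw [hl0 i i.2]
    have e1 : (fun i : Fin n => π ^ γ i) = fun i : Fin n => π ^ lam n i := by
      funext i; rw [hln i i.2]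
    rw [e0, e1, hconj, ← Matrix.mul_assoc, Matrix.adjugate_mul, hU3, Qf_det hMdet, one_smul,
      Matrix.one_mul]
  refine ⟨Q, Y.adjugate, ?_, ?_, fun W => ?_⟩
  · exact Qf_det_ne (fun i => Nm_det hπ0 n k i) _ _
  · intro h
    have := congrArg Matrix.det hYV
    rw [Matrix.det_mul, h, mul_zero, Matrix.det_one] at this
    exact zero_ne_one this
  · exact chain (v := v) hπ0 hπ1 n (fun i => α i) (fun i => β i) (fun i => γ i) S D
      (fun i => hα i i.2) (fun i => hβ i i.2) (fun i => hD i i.2) hDS Q U Y.adjugate U3.adjugate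
      hUint hYint.adjugate (Qf_int hMint _ _).adjugate hQU hT1 W

end main

lemma exists_val : ∃ B : ValuationSubring ℂ, B.valuation (2 : ℂ) < 1 := by
  let A : Subring ℂ := (Int.castRingHom ℂ).range
  let t : A := ⟨2, 2, by simp⟩
  have hI : Ideal.span {t} ≠ ⊤ := by
    rw [Ne, Ideal.span_singleton_eq_top]
    intro h
    obtain ⟨u, hu⟩ := h.exists_right_inv
    obtain ⟨z, hz⟩ := u.2
    have h1 : (2 : ℂ) * z = 1 := by
      have := congrArg Subtype.val hu
      simp only [Subring.coe_mul, Subring.coe_one] at this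
      rw [← hz] at this
      simpa [t] using this
    have h2 : (2 : ℤ) * z = 1 := by exact_mod_cast h1
    omega
  obtain ⟨B, h1, h2⟩ := Ideal.image_subset_nonunits_valuationSubring _ hI
  refine ⟨B, ?_⟩
  have : (2 : ℂ) ∈ B.nonunits := h2 ⟨t, Ideal.mem_span_singleton_self t, rfl⟩
  exact (ValuationSubring.mem_nonunits_iff B).1 this

/-- Semistability from an LR array. -/
theorem semist (n : ℕ) (α β γ : ℕ → ℕ) (S D : ℕ)
    (hα : ∀ i, i < n → α i ≤ S) (hβ : ∀ i, i < n →  β i ≤ S) (hD : ∀ i, i < n → γ i ≤ D) (hDS : D ≤ S)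
    (k : ℕ → ℕ → ℕ) (lam : ℕ → ℕ → ℕ)
    (hs1 : ∀ i m, i + 1 < n → m < n → ∑ q ∈ range (m + 1), k (i + 1) q ≤ ∑ q ∈ range m, k i q)
    (hkβ : ∀ i, i < n → ∑ q ∈ range n, k i q = β i)
    (hl0 : ∀ q, q < n → lam 0 q = α q) (hln : ∀ q, q < n → lam n q = γ q)
    (hlk : ∀ i q, i < n → q < n → lam (i + 1) q = lam i q + k i q)
    (hli : ∀ i q, i < n → q + 1 < n → lam (i + 1) (q + 1) ≤ lam i q) :
    ∃ Q V : Matrix (Fin n) (Fin n) ℂ, Q.det ≠ 0 ∧ V.det ≠ 0 ∧ ∀ W : Submodule ℂ (Fin n → ℂ),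
    ∑ s ∈ range S, finrank ℂ (W ⊓ Fsub Q (fun i => α i) s : Submodule ℂ (Fin n → ℂ)) +
    ∑ s ∈ range S, finrank ℂ (W ⊓ Fsub V (fun i => β i) s : Submodule ℂ (Fin n → ℂ)) +
    ∑ s ∈ range S, finrank ℂ (W ⊓ Fsub 1 (fun i : Fin n => D - γ i) s : Submodule ℂ (Fin n → ℂ)) ≤
      D * finrank ℂ W := by
  obtain ⟨B, hB⟩ := exists_val
  exact semist0 (v := B.valuation) two_ne_zero hB n α β γ S D hα hβ hD hDS k lam hs1 hkβ hl0 hln hlk hli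

end HornB


set_option linter.all false
namespace HornC
open Finset Matrix Module HornB

lemma det_deriv {m : Type*} [Fintype m] [DecidableEq m] (M : ℝ → Matrix m m ℂ) (M' : Matrix m m ℂ)
    (h0 : M 0 = 1) (h : ∀ i j, HasDerivAt (fun t => M t i j) (M' i j) 0) :
    HasDerivAt (fun t => (M t).det) M'.trace 0 := by
  simp only [Matrix.det_apply']
  have h1 : ∀ σ : Equiv.Perm m, HasDerivAt (fun t => ((Equiv.Perm.sign σ : ℤ) : ℂ) * ∏ i, M t (σ i) i)
      (((Equiv.Perm.sign σ : ℤ) : ℂ) * ∑ i, (∏ j ∈ univ.erase i, M 0 (σ j) j) • M' (σ i) i) 0 :=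
    fun σ => (HasDerivAt.fun_finset_prod (fun i _ => h (σ i) i)).const_mul _
  have h2 := HasDerivAt.fun_sum (u := univ) (fun σ _ => h1 σ)
  refine h2.congr_deriv ?_
  rw [Finset.sum_eq_single (1 : Equiv.Perm m)]
  · simp [h0, Matrix.trace]
  · intro σ _ hσ
    have : ∀ i, ∏ j ∈ univ.erase i, M 0 (σ j) j = 0 := by
      intro i
      by_contra hne
      apply hσ
      have hfix : ∀ j, j ≠ i → σ j = j := by
        intro j hj
        by_contra hc
        refine hne (Finset.prod_eq_zero (Finset.mem_erase.2 ⟨hj, mem_univ j⟩) ?_)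
        rw [h0, Matrix.one_apply_ne hc]
      ext j
      by_cases hj : j = i
      · by_contra hc
        have hc' : σ j ≠ j := hc
        have h3 : σ (σ j) = σ j := hfix _ (by rw [← hj]; exact hc')
        exact hc' (σ.injective h3)
      · exact hfix j hj
    simp [this]
  · simp

/-- QR decomposition -/
lemma exists_QR {n : ℕ} (f : Matrix (Fin n) (Fin n) ℂ) : ∃ Q R : Matrix (Fin n) (Fin n) ℂ,
    Qᴴ * Q = 1 ∧ f = Q * R ∧ ∀ i j, j < i → R i j = 0 := by
  let F : Fin n → EuclideanSpace ℂ (Fin n) := fun j => WithLp.toLp 2 (fun i => f i j)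
  let b := InnerProductSpace.gramSchmidtOrthonormalBasis (𝕜 := ℂ)
    (finrank_euclideanSpace_fin (𝕜 := ℂ) (n := n) |>.trans (Fintype.card_fin n).symm) F
  let Q : Matrix (Fin n) (Fin n) ℂ := Matrix.of fun i j => b j i
  have hQ : Qᴴ * Q = 1 := by
    ext i j
    have h1 : (Qᴴ * Q) i j = inner ℂ (b i) (b j) := by
      simp [Matrix.mul_apply, Q, PiLp.inner_apply, mul_comm]
    rw [h1, Matrix.one_apply]
    exact orthonormal_iff_ite.1 b.orthonormal i j
  have hQ' : Q * Qᴴ = 1 := mul_eq_one_comm.1 hQ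
  refine ⟨Q, Qᴴ * f, hQ, ?_, ?_⟩
  · rw [← Matrix.mul_assoc, hQ', Matrix.one_mul]
  · intro i j hij
    have h1 : (Qᴴ * f) i j = inner ℂ (b i) (F j) := by
      simp [Matrix.mul_apply, Q, F, PiLp.inner_apply, mul_comm]
    rw [h1]
    exact InnerProductSpace.gramSchmidtOrthonormalBasis_inv_triangular _ _ hij

/-- selected columns -/
def sel {n : ℕ} (a : Fin n → ℕ) (s : ℕ) (M : Matrix (Fin n) (Fin n) ℂ) :
    Matrix (Fin n) {i // s < a i} ℂ := M.submatrix id Subtype.val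

/-- selected principal submatrix -/
def psel {n : ℕ} (a : Fin n → ℕ) (s : ℕ) (M : Matrix (Fin n) (Fin n) ℂ) :
    Matrix {i // s < a i} {i // s < a i} ℂ := M.submatrix Subtype.val Subtype.val

/-- Gram determinant of selected columns -/
noncomputable def gram {n : ℕ} (a : Fin n → ℕ) (s : ℕ) (M : Matrix (Fin n) (Fin n) ℂ) : ℝ :=
  ((sel a s M)ᴴ * sel a s M).det.re

lemma sel_mul {n : ℕ} (a : Fin n → ℕ) (s : ℕ) (A M : Matrix (Fin n) (Fin n) ℂ) :
    sel a s (A * M) = A * sel a s M := by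
  ext i j; simp [sel, Matrix.mul_apply]

lemma sel_QR {n : ℕ} {a : Fin n → ℕ} (ha : Antitone a) (s : ℕ) (Q R : Matrix (Fin n) (Fin n) ℂ)
    (hR : ∀ i j, j < i → R i j = 0) :
    sel a s (Q * R) = sel a s Q * psel a s R := by
  ext i j
  have h1 : sel a s (Q * R) i j = ∑ q, Q i q * R q j := by
    simp [sel, Matrix.mul_apply]
  have h2 : (sel a s Q * psel a s R) i j =
      ∑ q : {i // s < a i}, Q i q * R q j := by
    simp [sel, psel, Matrix.mul_apply]
  rw [h1, h2, ← Finset.sum_subtype (univ.filter fun i => s < a i) (by simp) (fun q => Q i q * R q j)]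
  symm
  refine Finset.sum_subset (Finset.filter_subset _ _) ?_
  intro q _ hq
  have hq' : ¬ s < a q := by simpa using hq
  rw [hR q j, mul_zero]
  by_contra hc
  have := ha (not_lt.1 hc)
  have := j.2
  omega

lemma det_ne_of {n : ℕ} {R : Matrix (Fin n) (Fin n) ℂ} (hR : ∀ i j, j < i → R i j = 0)
    (hd : R.det ≠ 0) (i : Fin n) : R i i ≠ 0 := by
  rw [Matrix.det_of_isUpperTriangular (fun i j h => hR i j h)] at hd
  exact Finset.prod_ne_zero_iff.1 hd i (mem_univ i)

lemma det_sub {n : ℕ} {a : Fin n → ℕ} (s : ℕ) {R : Matrix (Fin n) (Fin n) ℂ}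
    (hR : ∀ i j, j < i → R i j = 0) :
    (psel a s R).det =
      ∏ i ∈ univ.filter (fun i => s < a i), R i i := by
  rw [Matrix.det_of_isUpperTriangular (M := psel a s R) (fun i j h => hR i j h),
    Finset.prod_subtype (p := fun i => s < a i) (univ.filter fun i => s < a i) (by simp) (fun i => R i i)]
  rfl

lemma gram_QR {n : ℕ} {a : Fin n → ℕ} (ha : Antitone a) (s : ℕ) (T Q R : Matrix (Fin n) (Fin n) ℂ)
    (hR : ∀ i j, j < i → R i j = 0) :
    gram a s (T * (Q * R)) = (∏ i ∈ univ.filter (fun i => s < a i), Complex.normSq (R i i)) *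
      gram a s (T * Q) := by
  rw [gram, gram, ← Matrix.mul_assoc, sel_QR ha s (T * Q) R hR]
  set B := psel a s R
  rw [Matrix.conjTranspose_mul, Matrix.mul_assoc, ← Matrix.mul_assoc _ _ B, Matrix.det_mul,
    Matrix.det_mul, Matrix.det_conjTranspose]
  have : ∀ z : ℂ, star B.det * (z * B.det) = (Complex.normSq B.det : ℂ) * z := by
    intro z
    rw [Complex.normSq_eq_conj_mul_self]
    simp only [Complex.star_def]; ring
  rw [this, Complex.re_ofReal_mul, det_sub s hR, map_prod]

lemma gram_Q {n : ℕ} (a : Fin n → ℕ) (s : ℕ) {Q : Matrix (Fin n) (Fin n) ℂ} (hQ : Qᴴ * Q = 1) :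
    gram a s Q = 1 := by
  have : (sel a s Q)ᴴ * sel a s Q = 1 := by
    have : (sel a s Q)ᴴ * sel a s Q = (Qᴴ * Q).submatrix Subtype.val Subtype.val := by
      ext i j; simp [sel, Matrix.mul_apply]
    rw [this, hQ, Matrix.submatrix_one _ Subtype.val_injective]
  rw [gram, this]; simp

lemma gram_pos {n : ℕ} {a : Fin n → ℕ} (ha : Antitone a) (s : ℕ) {M : Matrix (Fin n) (Fin n) ℂ}
    (hM : M.det ≠ 0) : 0 < gram a s M := by
  obtain ⟨Q, R, hQ, hM', hR⟩ := exists_QR M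
  have h1 := gram_QR ha s 1 Q R hR
  rw [Matrix.one_mul, Matrix.one_mul, ← hM', gram_Q a s hQ, mul_one] at h1
  rw [h1]
  refine Finset.prod_pos fun i _ => Complex.normSq_pos.2 (det_ne_of hR ?_ i)
  rw [hM', Matrix.det_mul] at hM
  exact right_ne_zero_of_mul hM

lemma quad_deriv (p q : ℂ) : HasDerivAt (fun t : ℝ => (t : ℂ) * p + (t : ℂ) * ((t : ℂ) * q)) p 0 := by
  have h1 : HasDerivAt (fun t : ℝ => (t : ℂ)) 1 0 := Complex.ofRealCLM.hasDerivAt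
  have h2 := (h1.mul_const p).add (h1.mul (h1.mul_const q))
  refine h2.congr_deriv ?_
  simp

/-- derivative of the log Gram determinant -/
lemma gram_deriv {n : ℕ} {a : Fin n → ℕ} (ha : Antitone a) (s : ℕ) {Q R Y : Matrix (Fin n) (Fin n) ℂ}
    (hQ : Qᴴ * Q = 1) (hR : ∀ i j, j < i → R i j = 0) (hd : R.det ≠ 0) (hY : Yᴴ = Y) :
    HasDerivAt (fun t : ℝ => Real.log (gram a s ((1 + (t : ℂ) • Y) * (Q * R))))
      (2 * ∑ i ∈ univ.filter (fun i => s < a i), ((Qᴴ * Y * Q) i i).re) 0 := by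
  set c := ∏ i ∈ univ.filter (fun i => s < a i), Complex.normSq (R i i) with hc
  have hc0 : c ≠ 0 := Finset.prod_ne_zero_iff.2 fun i _ =>
    (Complex.normSq_pos.2 (det_ne_of hR hd i)).ne'
  have h1 : ∀ t : ℝ, gram a s ((1 + (t : ℂ) • Y) * (Q * R)) =
      c * gram a s ((1 + (t : ℂ) • Y) * Q) := fun t => gram_QR ha s _ Q R hR
  have h2 : HasDerivAt (fun t : ℝ => gram a s ((1 + (t : ℂ) • Y) * Q))
      (2 * ∑ i ∈ univ.filter (fun i => s < a i), ((Qᴴ * Y * Q) i i).re) 0 := by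
    let M : ℝ → Matrix {i // s < a i} {i // s < a i} ℂ := fun t =>
      (sel a s ((1 + (t : ℂ) • Y) * Q))ᴴ * sel a s ((1 + (t : ℂ) • Y) * Q)
    let M' : Matrix {i // s < a i} {i // s < a i} ℂ := fun i j => 2 * (Qᴴ * Y * Q) i j
    have hM : ∀ t : ℝ, M t = (1 + (t : ℂ) • ((2 : ℂ) • (Qᴴ * Y * Q)) +
        (t : ℂ) • (t : ℂ) • (Qᴴ * Y * Y * Q)).submatrix Subtype.val Subtype.val := by
      intro t
      have e1 : M t = (((1 + (t : ℂ) • Y) * Q)ᴴ * ((1 + (t : ℂ) • Y) * Q)).submatrix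
          Subtype.val Subtype.val := by
        ext i j; simp [M, sel, Matrix.mul_apply]
      rw [e1]
      congr 1
      rw [Matrix.conjTranspose_mul, Matrix.conjTranspose_add, Matrix.conjTranspose_one,
        Matrix.conjTranspose_smul, hY]
      have : star (t : ℂ) = t := Complex.conj_ofReal t
      rw [this]
      simp only [Matrix.mul_add, Matrix.add_mul, Matrix.one_mul, Matrix.mul_one, Matrix.smul_mul,
        Matrix.mul_smul, hQ, Matrix.mul_assoc]
      module
    have h3 := det_deriv M M' (by
      rw [hM]; simp [Matrix.submatrix_one _ Subtype.val_injective]) (by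
      intro i j
      have e : (fun t => M t i j) = fun t : ℝ => (1 : Matrix (Fin n) (Fin n) ℂ) i j +
          ((t : ℂ) * (2 * (Qᴴ * Y * Q) i j) + (t : ℂ) * ((t : ℂ) * (Qᴴ * Y * Y * Q) i j)) := by
        funext t
        rw [hM]
        simp [add_assoc]
      rw [e]
      exact (quad_deriv _ _).const_add _)
    have h4 := Complex.reCLM.hasFDerivAt.comp_hasDerivAt (0 : ℝ) h3
    refine h4.congr_deriv ?_
    simp only [Matrix.trace, Complex.reCLM_apply, Matrix.diag, M']
    rw [Complex.re_sum, Finset.mul_sum,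
      Finset.sum_subtype (p := fun i => s < a i) (univ.filter fun i => s < a i) (by simp) (fun i => 2 * ((Qᴴ * Y * Q) i i).re)]
    refine Finset.sum_congr rfl fun i _ => ?_
    simp
  have h0 : gram a s ((1 + ((0 : ℝ) : ℂ) • Y) * Q) = 1 := by
    simp [gram_Q a s hQ]
  have h5 := (h2.const_mul c).log (by rw [h0, mul_one]; exact hc0)
  simp only [h1]
  refine h5.congr_deriv ?_
  rw [h0]
  field_simp

end HornC


set_option linter.all false
namespace HornC
open Finset Matrix Module HornB

/-- squared Frobenius norm -/
noncomputable def nrm {n : ℕ} (h : Matrix (Fin n) (Fin n) ℂ) : ℝ := (hᴴ * h).trace.re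

lemma nrm_eq {n : ℕ} (h : Matrix (Fin n) (Fin n) ℂ) : nrm h = ∑ i, ∑ j, Complex.normSq (h j i) := by
  simp only [nrm, Matrix.trace, Matrix.diag, Matrix.mul_apply, Matrix.conjTranspose_apply,
    Complex.re_sum]
  refine Finset.sum_congr rfl fun i _ => Finset.sum_congr rfl fun j _ => ?_
  rw [Complex.star_def, ← Complex.normSq_eq_conj_mul_self, Complex.ofReal_re]

lemma normSq_le_nrm {n : ℕ} (h : Matrix (Fin n) (Fin n) ℂ) (i j : Fin n) :
    Complex.normSq (h i j) ≤ nrm h := by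
  rw [nrm_eq]
  calc _ ≤ ∑ j', Complex.normSq (h j' j) :=
        Finset.single_le_sum (f := fun j' => Complex.normSq (h j' j))
          (fun _ _ => Complex.normSq_nonneg _) (mem_univ i)
    _ ≤ _ := Finset.single_le_sum (f := fun i' => ∑ j', Complex.normSq (h j' i'))
          (fun _ _ => Finset.sum_nonneg fun _ _ => Complex.normSq_nonneg _) (mem_univ j)

lemma nrm_nonneg {n : ℕ} (h : Matrix (Fin n) (Fin n) ℂ) : 0 ≤ nrm h := by
  rw [nrm_eq]
  exact Finset.sum_nonneg fun _ _ => Finset.sum_nonneg fun _ _ => Complex.normSq_nonneg _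

lemma nrm_eq_zero {n : ℕ} {h : Matrix (Fin n) (Fin n) ℂ} (h0 : nrm h = 0) : h = 0 := by
  ext i j
  have := normSq_le_nrm h i j
  rw [h0] at this
  exact Complex.normSq_eq_zero.1 (le_antisymm this (Complex.normSq_nonneg _))

lemma continuous_nrm {n : ℕ} : Continuous (nrm : Matrix (Fin n) (Fin n) ℂ → ℝ) := by
  unfold nrm; fun_prop

lemma isCompact_sphere {n : ℕ} (r : ℝ) : IsCompact {h : Matrix (Fin n) (Fin n) ℂ | nrm h = r} := by
  have h1 : IsCompact (Set.pi Set.univ fun _ : Fin n => Set.pi Set.univ fun _ : Fin n =>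
      Metric.closedBall (0 : ℂ) (Real.sqrt r)) :=
    isCompact_univ_pi fun _ => isCompact_univ_pi fun _ => isCompact_closedBall _ _
  have h2 : IsClosed {h : Matrix (Fin n) (Fin n) ℂ | nrm h = r} :=
    isClosed_eq continuous_nrm continuous_const
  refine IsCompact.of_isClosed_subset h1 h2 ?_
  intro h hh i _ j _
  rw [mem_closedBall_zero_iff]
  refine Real.le_sqrt_of_sq_le ?_
  rw [← Complex.normSq_eq_norm_sq]
  exact (normSq_le_nrm h i j).trans_eq hh

lemma isCompact_unitary {n : ℕ} : IsCompact {Q : Matrix (Fin n) (Fin n) ℂ | Qᴴ * Q = 1} := by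
  refine IsCompact.of_isClosed_subset (isCompact_sphere (n := n) n) ?_ ?_
  · exact isClosed_eq (by fun_prop) continuous_const
  · intro Q hQ
    simp only [Set.mem_ofPred_eq] at hQ ⊢
    rw [nrm, hQ]; simp

lemma continuous_gram {n : ℕ} (a : Fin n → ℕ) (s : ℕ) : Continuous (gram a s) := by
  unfold gram sel
  have : Continuous fun M : Matrix (Fin n) (Fin n) ℂ =>
      M.submatrix id (Subtype.val : {i // s < a i} → Fin n) := Continuous.matrix_submatrix continuous_id _ _
  exact Complex.continuous_re.comp ((this.matrix_conjTranspose.matrix_mul this).matrix_det)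

/-- The functional -/
noncomputable def G {n : ℕ} (f : Fin 3 → Matrix (Fin n) (Fin n) ℂ) (a : Fin 3 → Fin n → ℕ) (S D : ℕ)
    (ε : ℝ) (h : Matrix (Fin n) (Fin n) ℂ) : ℝ :=
  ∑ c, ∑ s ∈ range S, Real.log (gram (a c) s (h * f c)) - D * Real.log (Complex.normSq h.det) +
    ε * (nrm h ^ n / Complex.normSq h.det)

lemma nrm_smul {n : ℕ} (t : ℝ) (h : Matrix (Fin n) (Fin n) ℂ) : nrm ((t : ℂ) • h) = t ^ 2 * nrm h := by
  rw [nrm_eq, nrm_eq, Finset.mul_sum]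
  refine Finset.sum_congr rfl fun i _ => ?_
  rw [Finset.mul_sum]
  refine Finset.sum_congr rfl fun j _ => ?_
  simp [Complex.normSq_mul, sq]

lemma normSq_det_smul {n : ℕ} (t : ℝ) (h : Matrix (Fin n) (Fin n) ℂ) :
    Complex.normSq ((t : ℂ) • h).det = (t ^ 2) ^ n * Complex.normSq h.det := by
  rw [Matrix.det_smul, Complex.normSq_mul, map_pow, Complex.normSq_ofReal, Fintype.card_fin, sq]

lemma gram_smul {n : ℕ} (a : Fin n → ℕ) (s : ℕ) (t : ℝ) (h : Matrix (Fin n) (Fin n) ℂ) :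
    gram a s ((t : ℂ) • h) = (t ^ 2) ^ (univ.filter (fun i => s < a i)).card * gram a s h := by
  have h1 : sel a s ((t : ℂ) • h) = (t : ℂ) • sel a s h := by ext i j; simp [sel]
  have h2 : (sel a s ((t : ℂ) • h))ᴴ * sel a s ((t : ℂ) • h) =
      ((t ^ 2 : ℝ) : ℂ) • ((sel a s h)ᴴ * sel a s h) := by
    rw [h1, Matrix.conjTranspose_smul, Matrix.smul_mul, Matrix.mul_smul, smul_smul]
    congr 1
    rw [Complex.star_def, Complex.conj_ofReal]; push_cast; ring
  rw [gram, h2, Matrix.det_smul, Fintype.card_subtype, ← Complex.ofReal_pow, Complex.re_ofReal_mul, gram]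

lemma count {n : ℕ} (a : Fin n → ℕ) (S : ℕ) (ha : ∀ i, a i ≤ S) (w : Fin n → ℝ) :
    ∑ s ∈ range S, ∑ i ∈ univ.filter (fun i => s < a i), w i = ∑ i, a i * w i := by
  simp only [Finset.sum_filter]
  rw [Finset.sum_comm]
  refine Finset.sum_congr rfl fun i _ => ?_
  rw [← Finset.sum_filter]
  have : (range S).filter (fun s => s < a i) = range (a i) := by
    ext s; simp only [mem_filter, mem_range]; have := ha i; omega
  rw [this]; simp

section
variable {n : ℕ} {f : Fin 3 → Matrix (Fin n) (Fin n) ℂ} {a : Fin 3 → Fin n → ℕ} {S D : ℕ} {ε : ℝ}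

lemma G_smul (hf : ∀ c, (f c).det ≠ 0) (ha : ∀ c, Antitone (a c)) (haS : ∀ c i, a c i ≤ S) (hsum : ∑ c, ∑ i, a c i = n * D) {t : ℝ} (ht : 0 < t) {h : Matrix (Fin n) (Fin n) ℂ} (hh : h.det ≠ 0) :
    G f a S D ε ((t : ℂ) • h) = G f a S D ε h := by
  have hq : 0 < Complex.normSq h.det := Complex.normSq_pos.2 hh
  have e1 : ∀ c s, Real.log (gram (a c) s (((t : ℂ) • h) * f c)) =
      ∑ i ∈ univ.filter (fun i => s < a c i), Real.log (t ^ 2) + Real.log (gram (a c) s (h * f c)) := by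
    intro c s
    have hp : 0 < gram (a c) s (h * f c) :=
      gram_pos (ha c) s (by rw [Matrix.det_mul]; exact mul_ne_zero hh (hf c))
    rw [Matrix.smul_mul, gram_smul, Real.log_mul (by positivity) hp.ne', Real.log_pow]
    simp
  have e2 : ∑ c, ∑ s ∈ range S, ∑ i ∈ univ.filter (fun i => s < a c i), Real.log (t ^ 2) =
      n * D * Real.log (t ^ 2) := by
    simp only [count _ S (haS _), ← Finset.sum_mul]
    congr 1
    exact_mod_cast hsum
  have e3 : (t ^ 2 * nrm h) ^ n / ((t ^ 2) ^ n * Complex.normSq h.det) =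
      nrm h ^ n / Complex.normSq h.det := by
    rw [mul_pow]
    field_simp
  simp only [G, e1, nrm_smul, normSq_det_smul, e3, Finset.sum_add_distrib, e2]
  rw [Real.log_mul (by positivity) hq.ne', Real.log_pow (n := n)]
  ring

lemma nrm_unitary_mul {Q R : Matrix (Fin n) (Fin n) ℂ} (hQ : Qᴴ * Q = 1) : nrm (Q * R) = nrm R := by
  rw [nrm, nrm, Matrix.conjTranspose_mul, Matrix.mul_assoc, ← Matrix.mul_assoc Qᴴ, hQ, Matrix.one_mul]

lemma normSq_det_unitary {Q : Matrix (Fin n) (Fin n) ℂ} (hQ : Qᴴ * Q = 1) :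
    Complex.normSq Q.det = 1 := by
  have := congrArg Matrix.det hQ
  rw [Matrix.det_mul, Matrix.det_conjTranspose, Matrix.det_one, Complex.star_def,
    ← Complex.normSq_eq_conj_mul_self] at this
  exact_mod_cast this

lemma gram_lower {b : Fin n → ℕ} (hb : Antitone b) {g : Matrix (Fin n) (Fin n) ℂ} (hg : g.det ≠ 0)
    (s : ℕ) : ∃ C : ℝ, ∀ h : Matrix (Fin n) (Fin n) ℂ, nrm h = 1 → h.det ≠ 0 →
      Real.log (Complex.normSq h.det) - C ≤ Real.log (gram b s (h * g)) := by
  obtain ⟨K0, hK0⟩ := (isCompact_sphere (n := n) 1).exists_bound_of_continuousOn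
    (f := fun h => nrm (h * g)) (continuous_nrm.comp (by fun_prop)).continuousOn
  set K := max K0 1
  have hK1 : 1 ≤ K := le_max_right _ _
  refine ⟨n * Real.log K - Real.log (Complex.normSq g.det), fun h hh hd => ?_⟩
  obtain ⟨Q, R, hQ, hM', hR⟩ := exists_QR (h * g)
  have hdR : R.det ≠ 0 := by
    intro h0
    have := congrArg Matrix.det hM'
    rw [Matrix.det_mul, Matrix.det_mul, h0, mul_zero] at this
    exact mul_ne_zero hd hg this
  have hpos : ∀ i, 0 < Complex.normSq (R i i) := fun i => Complex.normSq_pos.2 (det_ne_of hR hdR i)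
  have h1 := gram_QR hb s 1 Q R hR
  rw [Matrix.one_mul, Matrix.one_mul, ← hM', gram_Q b s hQ, mul_one] at h1
  have h2 : ∀ i, Complex.normSq (R i i) ≤ K := by
    intro i
    refine (normSq_le_nrm R i i).trans ?_
    rw [← nrm_unitary_mul hQ, ← hM']
    exact ((le_abs_self _).trans (hK0 h hh)).trans (le_max_left _ _)
  have h3 : ∏ i, Complex.normSq (R i i) = Complex.normSq h.det * Complex.normSq g.det := by
    rw [← map_prod, ← Matrix.det_of_isUpperTriangular (fun i j h => hR i j h), ← Complex.normSq_mul,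
      ← Matrix.det_mul, hM', Matrix.det_mul, Complex.normSq_mul, normSq_det_unitary hQ, one_mul]
  have h4 : ∏ i, Complex.normSq (R i i) ≤ gram b s (h * g) * K ^ n := by
    rw [h1, ← Finset.prod_filter_mul_prod_filter_not univ (fun i => s < b i)]
    refine mul_le_mul_of_nonneg_left ?_ (Finset.prod_nonneg fun i _ => (hpos i).le)
    calc _ ≤ ∏ i ∈ univ.filter (fun i => ¬ s < b i), K :=
          Finset.prod_le_prod (fun i _ => (hpos i).le) fun i _ => h2 i
      _ = K ^ (univ.filter (fun i => ¬ s < b i)).card := by simp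
      _ ≤ K ^ n := pow_le_pow_right₀ hK1 ((Finset.card_le_univ _).trans (by simp))
  rw [h3] at h4
  have hg0 := Complex.normSq_pos.2 hg
  have hd0 := Complex.normSq_pos.2 hd
  have hgr : 0 < gram b s (h * g) := gram_pos hb s (by rw [Matrix.det_mul]; exact mul_ne_zero hd hg)
  have h5 := Real.log_le_log (by positivity) h4
  rw [Real.log_mul hd0.ne' hg0.ne', Real.log_mul hgr.ne' (by positivity), Real.log_pow] at h5
  linarith

lemma G_lower (hf : ∀ c, (f c).det ≠ 0) (ha : ∀ c, Antitone (a c)) (hε : 0 < ε) : ∃ C : ℝ, ∀ h : Matrix (Fin n) (Fin n) ℂ, nrm h = 1 → h.det ≠ 0 →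
    ε / 2 * (Complex.normSq h.det)⁻¹ - C ≤ G f a S D ε h := by
  choose C hC using fun c s => gram_lower (ha c) (hf c) s
  obtain ⟨K, hK⟩ := (isCompact_sphere (n := n) 1).exists_bound_of_continuousOn
    (f := fun h => Complex.normSq h.det)
    (Complex.continuous_normSq.comp (Continuous.matrix_det continuous_id)).continuousOn
  set N : ℝ := 3 * S with hN
  have hN0 : 0 ≤ N := by positivity
  set η := ε / (2 * (N + 1)) with hη
  have hη0 : 0 < η := by positivity
  have hηN : N * η ≤ ε / 2 := by
    rw [hη, mul_div_assoc', div_le_div_iff₀ (by positivity) (by norm_num)]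
    nlinarith
  refine ⟨∑ c, ∑ s ∈ range S, C c s + N * (-Real.log η - 1) + D * K, fun h hh hd => ?_⟩
  have hq := Complex.normSq_pos.2 hd
  set q := Complex.normSq h.det
  have hqK : q ≤ K := (le_abs_self q).trans (hK h hh)
  have h1 : ∑ c : Fin 3, ∑ s ∈ range S, (Real.log q - C c s) ≤
      ∑ c, ∑ s ∈ range S, Real.log (gram (a c) s (h * f c)) :=
    Finset.sum_le_sum fun c _ => Finset.sum_le_sum fun s _ => hC c s h hh hd
  have h2 : ∑ c : Fin 3, ∑ s ∈ range S, (Real.log q - C c s) =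
      N * Real.log q - ∑ c, ∑ s ∈ range S, C c s := by
    simp only [Finset.sum_sub_distrib]
    simp [hN, mul_assoc]
  have h3 : Real.log q ≤ K := (Real.log_le_sub_one_of_pos hq).trans (by linarith)
  have h4 : -Real.log q ≤ η * q⁻¹ - 1 - Real.log η := by
    have := Real.log_le_sub_one_of_pos (show 0 < η * q⁻¹ by positivity)
    rw [Real.log_mul hη0.ne' (by positivity), Real.log_inv] at this
    linarith
  have h5 : N * (-Real.log q) ≤ N * (η * q⁻¹ - 1 - Real.log η) := mul_le_mul_of_nonneg_left h4 hN0
  have h6 : N * η * q⁻¹ ≤ ε / 2 * q⁻¹ := mul_le_mul_of_nonneg_right hηN (by positivity)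
  have h7 : (D : ℝ) * Real.log q ≤ D * K := mul_le_mul_of_nonneg_left h3 (by positivity)
  rw [G, hh, one_pow, one_div]
  rw [h2] at h1
  have h8 : ε * q⁻¹ = ε / 2 * q⁻¹ + ε / 2 * q⁻¹ := by ring
  change _ ≤ _ - D * Real.log q + ε * q⁻¹
  nlinarith

lemma exists_min (hn : 0 < n) (hf : ∀ c, (f c).det ≠ 0) (ha : ∀ c, Antitone (a c)) (haS : ∀ c i, a c i ≤ S) (hsum : ∑ c, ∑ i, a c i = n * D) (hε : 0 < ε) : ∃ h : Matrix (Fin n) (Fin n) ℂ, h.det ≠ 0 ∧ nrm h = 1 ∧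
    ∀ h' : Matrix (Fin n) (Fin n) ℂ, h'.det ≠ 0 → G f a S D ε h ≤ G f a S D ε h' := by
  obtain ⟨C, hC⟩ := G_lower (S := S) (D := D) hf ha hε
  have norm1 : ∀ h' : Matrix (Fin n) (Fin n) ℂ, h'.det ≠ 0 → ∃ h'' : Matrix (Fin n) (Fin n) ℂ,
      h''.det ≠ 0 ∧ nrm h'' = 1 ∧ G f a S D ε h'' = G f a S D ε h' := by
    intro h' hd
    have hnz : nrm h' ≠ 0 := by
      intro h0
      apply hd
      rw [nrm_eq_zero h0]
      have : Nonempty (Fin n) := ⟨⟨0, hn⟩⟩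
      exact Matrix.det_zero
    have hp : 0 < nrm h' := lt_of_le_of_ne (nrm_nonneg h') hnz.symm
    have ht : 0 < (Real.sqrt (nrm h'))⁻¹ := inv_pos.2 (Real.sqrt_pos.2 hp)
    refine ⟨(((Real.sqrt (nrm h'))⁻¹ : ℝ) : ℂ) • h', ?_, ?_, G_smul hf ha haS hsum ht hd⟩
    · rw [Matrix.det_smul]
      exact mul_ne_zero (pow_ne_zero _ (by exact_mod_cast ht.ne')) hd
    · rw [nrm_smul, inv_pow, Real.sq_sqrt hp.le, inv_mul_cancel₀ hnz]
  obtain ⟨h0, hd0, hh0, -⟩ := norm1 1 (by simp)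
  set δ := min (Complex.normSq h0.det) (ε / 2 / (|G f a S D ε h0 + C| + 1)) with hδ
  have hδ0 : 0 < δ := lt_min (Complex.normSq_pos.2 hd0) (by positivity)
  have hcomp : IsCompact ({h : Matrix (Fin n) (Fin n) ℂ | nrm h = 1} ∩
      {h | δ ≤ Complex.normSq h.det}) := by
    refine (isCompact_sphere 1).inter_right ?_
    exact isClosed_le continuous_const (Complex.continuous_normSq.comp (Continuous.matrix_det continuous_id))
  have hne : ∀ h : Matrix (Fin n) (Fin n) ℂ, δ ≤ Complex.normSq h.det → h.det ≠ 0 := by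
    intro h hh h0
    rw [h0, map_zero] at hh
    linarith
  have hcont : ContinuousOn (G f a S D ε) ({h : Matrix (Fin n) (Fin n) ℂ | nrm h = 1} ∩
      {h | δ ≤ Complex.normSq h.det}) := by
    have hdc : Continuous fun h : Matrix (Fin n) (Fin n) ℂ => Complex.normSq h.det :=
      Complex.continuous_normSq.comp (Continuous.matrix_det continuous_id)
    have hdn : ∀ h ∈ ({h : Matrix (Fin n) (Fin n) ℂ | nrm h = 1} ∩
      {h | δ ≤ Complex.normSq h.det}), Complex.normSq h.det ≠ 0 := fun h hh =>
        (Complex.normSq_pos.2 (hne h hh.2)).ne'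
    refine ContinuousOn.add (ContinuousOn.sub ?_ ?_) ?_
    · refine continuousOn_finsetSum _ fun c _ => continuousOn_finsetSum _ fun s _ => ?_
      refine ContinuousOn.log ((continuous_gram (a c) s).comp (by fun_prop)).continuousOn ?_
      intro h hh
      exact (gram_pos (ha c) s (by rw [Matrix.det_mul]; exact mul_ne_zero (hne h hh.2) (hf c))).ne'
    · exact continuousOn_const.mul (hdc.continuousOn.log hdn)
    · exact continuousOn_const.mul ((continuous_nrm.continuousOn.pow n).div hdc.continuousOn hdn)
  have hmem : h0 ∈ ({h : Matrix (Fin n) (Fin n) ℂ | nrm h = 1} ∩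
      {h | δ ≤ Complex.normSq h.det}) := by
    refine ⟨hh0, ?_⟩
    show δ ≤ Complex.normSq h0.det
    exact min_le_left _ _
  obtain ⟨h, hh, hmin⟩ := hcomp.exists_isMinOn ⟨h0, hmem⟩ hcont
  refine ⟨h, hne h hh.2, hh.1, fun h' hd' => ?_⟩
  obtain ⟨h'', hd'', hh'', hG⟩ := norm1 h' hd'
  rw [← hG]
  by_cases hq : δ ≤ Complex.normSq h''.det
  · exact hmin ⟨hh'', hq⟩
  · refine (hmin hmem).trans ?_
    refine le_trans ?_ (hC h'' hh'' hd'')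
    have hq0 := Complex.normSq_pos.2 hd''
    have h1 : Complex.normSq h''.det ≤ ε / 2 / (|G f a S D ε h0 + C| + 1) :=
      (not_le.1 hq).le.trans (min_le_right _ _)
    have h3 := le_abs_self (G f a S D ε h0 + C)
    generalize G f a S D ε h0 = g0 at h1 h3 ⊢
    generalize Complex.normSq h''.det = q at h1 hq0 ⊢
    have hpos : 0 < |g0 + C| + 1 := by positivity
    have h1' := (le_div_iff₀ hpos).1 h1
    have h2 : |g0 + C| + 1 ≤ ε / 2 * q⁻¹ := by
      rw [← div_eq_mul_inv]
      exact (le_div_iff₀ hq0).2 (by linarith)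
    linarith

end
end HornC


set_option linter.all false
namespace HornC
open Finset Matrix Module HornB

/-- conjugated diagonal matrices -/
noncomputable def cd {n : ℕ} (Q : Matrix (Fin n) (Fin n) ℂ) (b : Fin n → ℂ) : Matrix (Fin n) (Fin n) ℂ :=
  Q * diagonal b * Qᴴ

lemma cd_herm {n : ℕ} (Q : Matrix (Fin n) (Fin n) ℂ) (b : Fin n → ℕ) :
    (cd Q (fun i => (b i : ℂ)))ᴴ = cd Q (fun i => (b i : ℂ)) := by
  rw [cd, Matrix.conjTranspose_mul, Matrix.conjTranspose_mul, Matrix.conjTranspose_conjTranspose,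
    Matrix.diagonal_conjTranspose, Matrix.mul_assoc]
  congr 3
  funext i
  simp

lemma cd_trace {n : ℕ} (Q Y : Matrix (Fin n) (Fin n) ℂ) (b : Fin n → ℕ) :
    (cd Q (fun i => (b i : ℂ)) * Y).trace.re = ∑ i, (b i : ℝ) * ((Qᴴ * Y * Q) i i).re := by
  have : (cd Q (fun i => (b i : ℂ)) * Y).trace = (diagonal (fun i => (b i : ℂ)) * (Qᴴ * Y * Q)).trace := by
    rw [cd, Matrix.mul_assoc, Matrix.mul_assoc, Matrix.trace_mul_comm]
    simp only [Matrix.mul_assoc]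
  rw [this]
  simp only [Matrix.trace, Matrix.diag, Matrix.diagonal_mul, Complex.re_sum]
  refine Finset.sum_congr rfl fun i _ => ?_
  rw [← Complex.ofReal_natCast, Complex.re_ofReal_mul]

section
variable {n : ℕ} {f : Fin 3 → Matrix (Fin n) (Fin n) ℂ} {a : Fin 3 → Fin n → ℕ} {S D : ℕ} {ε : ℝ}

lemma normSq_deriv (Y : Matrix (Fin n) (Fin n) ℂ) :
    HasDerivAt (fun t : ℝ => Complex.normSq (1 + (t : ℂ) • Y).det) (2 * Y.trace.re) 0 := by
  have h1 := det_deriv (fun t : ℝ => 1 + (t : ℂ) • Y) Y (by simp) (by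
    intro i j
    have e : (fun t : ℝ => (1 + (t : ℂ) • Y) i j) = fun t : ℝ => (1 : Matrix (Fin n) (Fin n) ℂ) i j +
          ((t : ℂ) * (Y i j) + (t : ℂ) * ((t : ℂ) * 0)) := by
      funext t; simp
    rw [e]
    exact (quad_deriv _ _).const_add _)
  have h2 := Complex.reCLM.hasFDerivAt.comp_hasDerivAt (0 : ℝ) h1
  have h3 := Complex.imCLM.hasFDerivAt.comp_hasDerivAt (0 : ℝ) h1
  have h4 := (h2.mul h2).add (h3.mul h3)
  refine (h4.congr_deriv ?_).congr_of_eventuallyEq ?_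
  · simp; ring
  · refine Filter.Eventually.of_forall fun t => ?_
    simp [Complex.normSq_apply]

lemma nrm_deriv (Y h : Matrix (Fin n) (Fin n) ℂ) (hY : Yᴴ = Y) :
    HasDerivAt (fun t : ℝ => nrm ((1 + (t : ℂ) • Y) * h)) (2 * (h * hᴴ * Y).trace.re) 0 := by
  have h1 := (quad_deriv (2 * (h * hᴴ * Y).trace) ((h * hᴴ * Y * Y).trace)).const_add (hᴴ * h).trace
  have h2 := Complex.reCLM.hasFDerivAt.comp_hasDerivAt (0 : ℝ) h1
  refine (h2.congr_deriv ?_).congr_of_eventuallyEq ?_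
  · simp
  · refine Filter.Eventually.of_forall fun t => ?_
    simp only [nrm, Function.comp, Complex.reCLM_apply]
    congr 1
    have e1 : (h * hᴴ * Y).trace = (hᴴ * Y * h).trace := by
      rw [Matrix.mul_assoc, Matrix.trace_mul_comm]
    have e2 : (h * hᴴ * Y * Y).trace = (hᴴ * Y * Y * h).trace := by
      rw [Matrix.mul_assoc, Matrix.mul_assoc, Matrix.trace_mul_comm]; simp only [Matrix.mul_assoc]
    rw [e1, e2]
    have : star (t : ℂ) = t := Complex.conj_ofReal t
    rw [Matrix.conjTranspose_mul, Matrix.conjTranspose_add, Matrix.conjTranspose_one,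
        Matrix.conjTranspose_smul, hY, this]
    simp only [Matrix.mul_add, Matrix.add_mul, Matrix.one_mul, Matrix.mul_one, Matrix.smul_mul,
        Matrix.mul_smul, Matrix.mul_assoc, Matrix.trace_add, Matrix.trace_smul, smul_eq_mul]
    ring

lemma herm_zero {Z : Matrix (Fin n) (Fin n) ℂ} (hZ : Zᴴ = Z) (h : (Z * Z).trace.re = 0) : Z = 0 := by
  apply nrm_eq_zero
  rw [nrm, hZ, h]

lemma stationary (hf : ∀ c, (f c).det ≠ 0) (ha : ∀ c, Antitone (a c)) (haS : ∀ c i, a c i ≤ S)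
    {h : Matrix (Fin n) (Fin n) ℂ} (hd : h.det ≠ 0) (hh : nrm h = 1)
    (hmin : ∀ h' : Matrix (Fin n) (Fin n) ℂ, h'.det ≠ 0 → G f a S D ε h ≤ G f a S D ε h')
    (Q R : Fin 3 → Matrix (Fin n) (Fin n) ℂ) (hQ : ∀ c, (Q c)ᴴ * Q c = 1)
    (hQR : ∀ c, h * f c = Q c * R c) (hR : ∀ c i j, j < i → R c i j = 0) :
    ∑ c, cd (Q c) (fun i => (a c i : ℂ)) - (D : ℂ) • 1 +
      ((ε * (Complex.normSq h.det)⁻¹ : ℝ) : ℂ) • ((n : ℂ) • (h * hᴴ) - 1) = 0 := by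
  set q := Complex.normSq h.det with hq
  have hq0 : 0 < q := Complex.normSq_pos.2 hd
  have hRd : ∀ c, (R c).det ≠ 0 := by
    intro c h0
    have := congrArg Matrix.det (hQR c)
    rw [Matrix.det_mul, Matrix.det_mul, h0, mul_zero] at this
    exact mul_ne_zero hd (hf c) this
  set Z := ∑ c, cd (Q c) (fun i => (a c i : ℂ)) - (D : ℂ) • 1 +
      ((ε * q⁻¹ : ℝ) : ℂ) • ((n : ℂ) • (h * hᴴ) - 1) with hZdef
  have hZ : Zᴴ = Z := by
    rw [hZdef, Matrix.conjTranspose_add, Matrix.conjTranspose_sub, Matrix.conjTranspose_smul,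
      Matrix.conjTranspose_smul, Matrix.conjTranspose_sub, Matrix.conjTranspose_smul,
      Matrix.conjTranspose_mul, Matrix.conjTranspose_conjTranspose, Matrix.conjTranspose_one,
      Matrix.conjTranspose_sum, Complex.star_def, Complex.conj_ofReal]
    simp only [cd_herm]
    simp
  have key : ∀ Y : Matrix (Fin n) (Fin n) ℂ, Yᴴ = Y → (Z * Y).trace.re = 0 := by
    intro Y hY
    have hn1 := normSq_deriv Y
    have hn2 := nrm_deriv Y h hY
    have hg := HasDerivAt.fun_sum (u := (univ : Finset (Fin 3))) fun c _ =>
      HasDerivAt.fun_sum (u := range S) fun s _ => gram_deriv (ha c) s (hQ c) (hR c) (hRd c) hY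
    have e0 : Complex.normSq (1 + ((0 : ℝ) : ℂ) • Y).det = 1 := by simp
    have e1 : nrm ((1 + ((0 : ℝ) : ℂ) • Y) * h) = 1 := by simp [hh]
    have hl := (hn1.mul_const q).log (by rw [e0, one_mul]; exact hq0.ne')
    have hb := (hn2.fun_pow n).div (hn1.mul_const q) (by rw [e0, one_mul]; exact hq0.ne')
    have hG := (hg.sub (hl.const_mul (D : ℝ))).add (hb.const_mul ε)
    have hloc : IsLocalMin (fun t : ℝ => G f a S D ε ((1 + (t : ℂ) • Y) * h)) 0 := by
      have hev : ∀ᶠ t : ℝ in nhds 0, Complex.normSq (1 + (t : ℂ) • Y).det ≠ 0 := by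
        apply hn1.continuousAt.eventually_ne
        rw [e0]; exact one_ne_zero
      filter_upwards [hev] with t ht
      have e2 : (1 + ((0 : ℝ) : ℂ) • Y) * h = h := by simp
      rw [e2]
      apply hmin
      rw [Matrix.det_mul]
      exact mul_ne_zero (fun h0 => ht (by rw [h0, map_zero])) hd
    have hG' := hG.congr_of_eventuallyEq (f₁ := fun t : ℝ => G f a S D ε ((1 + (t : ℂ) • Y) * h))
      (Filter.Eventually.of_forall fun t => by
        simp only [G, Matrix.mul_assoc, hQR, Matrix.det_mul, Complex.normSq_mul]
        rfl)
    have h0 := hloc.hasDerivAt_eq_zero hG'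
    rw [e0, e1] at h0
    simp only [← Finset.mul_sum, count _ S (haS _), ← cd_trace] at h0
    have e3 : (Z * Y).trace.re = ∑ c, (cd (Q c) (fun i => (a c i : ℂ)) * Y).trace.re - D * Y.trace.re +
        ε * q⁻¹ * (n * (h * hᴴ * Y).trace.re - Y.trace.re) := by
      rw [hZdef, Matrix.add_mul, Matrix.sub_mul, Matrix.sum_mul, Matrix.smul_mul, Matrix.smul_mul,
        Matrix.one_mul, Matrix.sub_mul, Matrix.smul_mul, Matrix.one_mul, Matrix.trace_add,
        Matrix.trace_sub, Matrix.trace_smul, Matrix.trace_smul, Matrix.trace_sum, Matrix.trace_sub,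
        Matrix.trace_smul]
      simp only [smul_eq_mul, Complex.add_re, Complex.sub_re, Complex.re_sum, Complex.re_ofReal_mul]
      rw [← Complex.ofReal_natCast, ← Complex.ofReal_natCast, Complex.re_ofReal_mul, Complex.re_ofReal_mul]
    rw [e3]
    simp only [one_pow, mul_one, one_mul] at h0
    have hqne := hq0.ne'
    field_simp at h0 ⊢
    linarith
  exact herm_zero hZ (key Z hZ)

end
end HornC


set_option linter.all false
namespace HornC
open Finset Matrix Module HornB
open scoped ComplexOrder

/-- orthogonal projection matrices -/
def IsProj {n : ℕ} (P : Matrix (Fin n) (Fin n) ℂ) : Prop := Pᴴ = P ∧ P * P = P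

lemma exists_proj {n : ℕ} (W : Submodule ℂ (Fin n → ℂ)) : ∃ P : Matrix (Fin n) (Fin n) ℂ, IsProj P ∧
    P.trace = finrank ℂ W ∧ (∀ x ∈ W, P *ᵥ x = x) ∧ ∀ x, P *ᵥ x ∈ W := by
  obtain ⟨w, hw, hW⟩ := exists_basis_mat W
  have hdet : (wᴴ * w).det ≠ 0 := by
    intro h0
    obtain ⟨x, hx0, hx⟩ := Matrix.exists_mulVec_eq_zero_iff.2 h0
    have : w *ᵥ x = 0 := (Matrix.conjTranspose_mul_self_mulVec_eq_zero w x).1 hx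
    exact hx0 (hw (by rw [this, Matrix.mulVec_zero]))
  have hu := isUnit_iff_ne_zero.2 hdet
  have h1 : (wᴴ * w)⁻¹ * (wᴴ * w) = 1 := Matrix.nonsing_inv_mul _ hu
  have hH : ((wᴴ * w)⁻¹)ᴴ = (wᴴ * w)⁻¹ := by
    rw [Matrix.conjTranspose_nonsing_inv, Matrix.conjTranspose_mul, Matrix.conjTranspose_conjTranspose]
  refine ⟨w * (wᴴ * w)⁻¹ * wᴴ, ⟨?_, ?_⟩, ?_, ?_, ?_⟩
  · rw [Matrix.conjTranspose_mul, Matrix.conjTranspose_mul, Matrix.conjTranspose_conjTranspose, hH,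
      Matrix.mul_assoc]
  · calc w * (wᴴ * w)⁻¹ * wᴴ * (w * (wᴴ * w)⁻¹ * wᴴ) =
        w * ((wᴴ * w)⁻¹ * (wᴴ * w)) * (wᴴ * w)⁻¹ * wᴴ := by simp only [Matrix.mul_assoc]
      _ = _ := by rw [h1, Matrix.mul_one]
  · rw [Matrix.mul_assoc, Matrix.trace_mul_comm, Matrix.mul_assoc, h1, Matrix.trace_one, Fintype.card_fin]
  · intro x hx
    rw [← hW] at hx
    obtain ⟨z, rfl⟩ := hx
    rw [Matrix.mulVecLin_apply, Matrix.mulVec_mulVec]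
    congr 1
    calc w * (wᴴ * w)⁻¹ * wᴴ * w = w * ((wᴴ * w)⁻¹ * (wᴴ * w)) := by simp only [Matrix.mul_assoc]
      _ = w := by rw [h1, Matrix.mul_one]
  · intro x
    rw [Matrix.mul_assoc, ← Matrix.mulVec_mulVec]
    exact hW.le ⟨_, rfl⟩

lemma mul_eq_of {n : ℕ} {P M : Matrix (Fin n) (Fin n) ℂ} (h : ∀ x, P *ᵥ (M *ᵥ x) = M *ᵥ x) : P * M = M := by
  apply Matrix.ext_of_mulVec_single
  intro i
  rw [← Matrix.mulVec_mulVec, h]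

/-- Trace lemma -/
lemma trace_ge {n : ℕ} {P T : Matrix (Fin n) (Fin n) ℂ} (hP : IsProj P) (hT : IsProj T)
    (U : Submodule ℂ (Fin n → ℂ)) (h1 : ∀ x ∈ U, P *ᵥ x = x) (h2 : ∀ x ∈ U, T *ᵥ x = x) :
    (finrank ℂ U : ℝ) ≤ (P * T).trace.re := by
  obtain ⟨E, hE, htr, hE1, hE2⟩ := exists_proj U
  have p1 : P * E = E := mul_eq_of fun x => h1 _ (hE2 x)
  have t1 : T * E = E := mul_eq_of fun x => h2 _ (hE2 x)
  have p2 : E * P = E := by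
    have := congrArg Matrix.conjTranspose p1
    rwa [Matrix.conjTranspose_mul, hP.1, hE.1] at this
  have t2 : E * T = E := by
    have := congrArg Matrix.conjTranspose t1
    rwa [Matrix.conjTranspose_mul, hT.1, hE.1] at this
  have a1 : (P - E) * (P - E) = P - E := by
    rw [Matrix.sub_mul, Matrix.mul_sub, Matrix.mul_sub, hP.2, p1, p2, hE.2]; abel
  have a2 : (T - E) * (T - E) = T - E := by
    rw [Matrix.sub_mul, Matrix.mul_sub, Matrix.mul_sub, hT.2, t1, t2, hE.2]; abel
  have a3 : ((P - E) * (T - E)).trace = (P * T).trace - finrank ℂ U := by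
    rw [Matrix.sub_mul, Matrix.mul_sub, Matrix.mul_sub, p1, t2, hE.2, sub_self, sub_zero,
      Matrix.trace_sub, htr]
  have a4 : nrm ((P - E) * (T - E)) = ((P - E) * (T - E)).trace.re := by
    rw [nrm, Matrix.conjTranspose_mul, Matrix.conjTranspose_sub, Matrix.conjTranspose_sub, hP.1, hT.1,
      hE.1]
    congr 1
    calc ((T - E) * (P - E) * ((P - E) * (T - E))).trace =
        ((T - E) * ((P - E) * (P - E) * (T - E))).trace := by simp only [Matrix.mul_assoc]
      _ = ((P - E) * (T - E)).trace := by
        rw [a1, Matrix.trace_mul_comm, Matrix.mul_assoc, a2]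
  have a5 := nrm_nonneg ((P - E) * (T - E))
  rw [a4, a3, Complex.sub_re, Complex.natCast_re] at a5
  linarith

/-- indicator of flag step -/
noncomputable def ind {n : ℕ} (b : Fin n → ℕ) (s : ℕ) : Fin n → ℂ := fun i => if s < b i then 1 else 0

lemma cd_ind_proj {n : ℕ} {Q : Matrix (Fin n) (Fin n) ℂ} (hQ : Qᴴ * Q = 1) (b : Fin n → ℕ) (s : ℕ) :
    IsProj (cd Q (ind b s)) := by
  constructor
  · rw [cd, Matrix.conjTranspose_mul, Matrix.conjTranspose_mul, Matrix.conjTranspose_conjTranspose,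
      Matrix.diagonal_conjTranspose, Matrix.mul_assoc]
    congr 3
    funext i
    simp only [ind, Pi.star_apply]
    split_ifs <;> simp
  · rw [cd]
    calc Q * diagonal (ind b s) * Qᴴ * (Q * diagonal (ind b s) * Qᴴ) =
        Q * (diagonal (ind b s) * (Qᴴ * Q) * diagonal (ind b s)) * Qᴴ := by simp only [Matrix.mul_assoc]
      _ = _ := by
        rw [hQ, Matrix.mul_one, Matrix.diagonal_mul_diagonal]
        congr 3
        funext i
        simp only [ind]
        split_ifs <;> simp

lemma cd_sum {n : ℕ} (Q : Matrix (Fin n) (Fin n) ℂ) (b : Fin n → ℕ) (S : ℕ) (hb : ∀ i, b i ≤ S) :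
    ∑ s ∈ range S, cd Q (ind b s) = cd Q (fun i => (b i : ℂ)) := by
  simp only [cd]
  rw [← Matrix.sum_mul, ← Matrix.mul_sum]
  congr 2
  ext i j
  rw [Matrix.sum_apply]
  by_cases hij : i = j
  · subst hij
    simp only [Matrix.diagonal_apply_eq, ind]
    rw [← Finset.sum_filter]
    have : (range S).filter (fun s => s < b i) = range (b i) := by
      ext s; simp only [mem_filter, mem_range]; have := hb i; omega
    rw [this]; simp
  · simp [Matrix.diagonal_apply_ne _ hij]

/-- image of a flag step under a triangular factorisation -/
lemma flag_fix {n : ℕ} {b : Fin n → ℕ} (hb : Antitone b) {Q R g h : Matrix (Fin n) (Fin n) ℂ}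
    (hg : g.det ≠ 0) (hQ : Qᴴ * Q = 1) (hQR : h * g⁻¹ = Q * R) (hR : ∀ i j, j < i → R i j = 0) (s : ℕ)
    {x : Fin n → ℂ} (hx : x ∈ Fsub g b s) : cd Q (ind b s) *ᵥ (h *ᵥ x) = h *ᵥ x := by
  have hu := isUnit_iff_ne_zero.2 hg
  have e1 : h *ᵥ x = (Q * R) *ᵥ (g *ᵥ x) := by
    rw [← hQR, Matrix.mulVec_mulVec, Matrix.mul_assoc, Matrix.nonsing_inv_mul _ hu, Matrix.mul_one]
  set z := g *ᵥ x with hz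
  have hz0 : ∀ i, b i ≤ s → z i = 0 := hx
  have e2 : diagonal (ind b s) *ᵥ (R *ᵥ z) = R *ᵥ z := by
    funext i
    rw [Matrix.mulVec_diagonal]
    simp only [ind]
    split_ifs with h1
    · simp
    · have : (R *ᵥ z) i = 0 := by
        rw [Matrix.mulVec, dotProduct]
        refine Finset.sum_eq_zero fun j _ => ?_
        by_cases hj : b j ≤ s
        · rw [hz0 j hj, mul_zero]
        · rw [hR i j, zero_mul]
          by_contra hc
          have := hb (not_lt.1 hc)
          omega
      rw [this, mul_zero]
  rw [e1, cd, ← Matrix.mulVec_mulVec, ← Matrix.mulVec_mulVec, ← Matrix.mulVec_mulVec]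
  rw [Matrix.mulVec_mulVec (R *ᵥ z) Qᴴ Q, hQ, Matrix.one_mulVec, e2]

end HornC


namespace HornC
open Finset Matrix Module HornB Filter Topology

lemma finrank_Fsub {n : ℕ} {g : Matrix (Fin n) (Fin n) ℂ} (hg : g.det ≠ 0) (b : Fin n → ℕ) (s : ℕ) :
    finrank ℂ (Fsub g b s) = (univ.filter fun i => s < b i).card := by
  have hu := isUnit_iff_ne_zero.2 hg
  let L : (Fin n → ℂ) →ₗ[ℂ] ({i : Fin n // b i ≤ s} → ℂ) :=
    (LinearMap.funLeft ℂ ℂ (fun i : {i : Fin n // b i ≤ s} => i.1)).comp g.mulVecLin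
  have hk : LinearMap.ker L = Fsub g b s := by
    ext x
    rw [LinearMap.mem_ker, mem_Fsub]
    constructor
    · intro h i hi
      exact congrFun h ⟨i, hi⟩
    · intro h
      funext i
      exact h i.1 i.2
  have hs : Function.Surjective L := by
    intro y
    refine ⟨g⁻¹ *ᵥ (fun i => if h : b i ≤ s then y ⟨i, h⟩ else 0), ?_⟩
    funext i
    show (g *ᵥ _) i.1 = _
    rw [Matrix.mulVec_mulVec, Matrix.mul_nonsing_inv _ hu, Matrix.one_mulVec, dif_pos i.2]
  have h1 := LinearMap.finrank_range_add_finrank_ker L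
  rw [LinearMap.range_eq_top.2 hs, finrank_top, hk, Module.finrank_fintype_fun_eq_card,
    Module.finrank_fintype_fun_eq_card, Fintype.card_fin, Fintype.card_subtype] at h1
  have h2 := Finset.card_filter_add_card_filter_not (s := (univ : Finset (Fin n))) (fun i => b i ≤ s)
  rw [Finset.card_univ, Fintype.card_fin] at h2
  simp only [not_le] at h2
  omega

lemma sum_finrank_Fsub {n : ℕ} {g : Matrix (Fin n) (Fin n) ℂ} (hg : g.det ≠ 0) (b : Fin n → ℕ) (S : ℕ)
    (hb : ∀ i, b i ≤ S) : ∑ s ∈ range S, finrank ℂ (Fsub g b s) = ∑ i, b i := by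
  simp only [finrank_Fsub hg, Finset.card_filter]
  rw [Finset.sum_comm]
  refine Finset.sum_congr rfl fun i _ => ?_
  rw [← Finset.sum_filter]
  have : (range S).filter (fun s => s < b i) = range (b i) := by
    ext s; simp only [mem_filter, mem_range]; have := hb i; omega
  rw [this]; simp

lemma finrank_map_ker {n : ℕ} (L : (Fin n → ℂ) →ₗ[ℂ] (Fin n → ℂ)) (F : Submodule ℂ (Fin n → ℂ)) :
    finrank ℂ (F.map L) + finrank ℂ (LinearMap.ker L ⊓ F : Submodule ℂ (Fin n → ℂ)) = finrank ℂ F := by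
  have h1 := LinearMap.finrank_range_add_finrank_ker (L.domRestrict F)
  rw [LinearMap.range_domRestrict, LinearMap.ker_domRestrict] at h1
  have e : ((LinearMap.ker L).submoduleOf F).map F.subtype = LinearMap.ker L ⊓ F := by
    rw [Submodule.submoduleOf, Submodule.map_comap_subtype, inf_comm]
  rw [← e, (Submodule.equivMapOfInjective F.subtype F.injective_subtype _).symm.finrank_eq]
  exact h1

/-- limit of triangular factorisations and semistability gives nonnegative trace -/
lemma trace_nonneg {n : ℕ} {g : Fin 3 → Matrix (Fin n) (Fin n) ℂ} {a : Fin 3 → Fin n → ℕ} {S D : ℕ}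
    (hg : ∀ c, (g c).det ≠ 0) (ha : ∀ c, Antitone (a c)) (haS : ∀ c i, a c i ≤ S)
    (hsum : ∑ c, ∑ i, a c i = n * D)
    (hsemi : ∀ W : Submodule ℂ (Fin n → ℂ), ∑ c, ∑ s ∈ range S,
      finrank ℂ (W ⊓ Fsub (g c) (a c) s : Submodule ℂ (Fin n → ℂ)) ≤ D * finrank ℂ W)
    {h : Matrix (Fin n) (Fin n) ℂ} {Q R : Fin 3 → Matrix (Fin n) (Fin n) ℂ}
    (hQ : ∀ c, (Q c)ᴴ * Q c = 1) (hQR : ∀ c, h * (g c)⁻¹ = Q c * R c)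
    (hR : ∀ c i j, j < i → R c i j = 0) {P : Matrix (Fin n) (Fin n) ℂ} (hP : IsProj P)
    (htr : P.trace = finrank ℂ (LinearMap.range h.mulVecLin))
    (hPf : ∀ x ∈ LinearMap.range h.mulVecLin, P *ᵥ x = x) :
    0 ≤ (P * (∑ c, cd (Q c) (fun i => (a c i : ℂ)) - (D : ℂ) • 1)).trace.re := by
  have k1 : ∀ c, ∀ s, (finrank ℂ ((Fsub (g c) (a c) s).map h.mulVecLin) : ℝ) ≤
      (P * cd (Q c) (ind (a c) s)).trace.re := by
    intro c s
    refine trace_ge hP (cd_ind_proj (hQ c) _ _) _ ?_ ?_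
    · rintro x ⟨y, -, rfl⟩
      exact hPf _ ⟨y, rfl⟩
    · rintro x ⟨y, hy, rfl⟩
      exact flag_fix (ha c) (hg c) (hQ c) (hQR c) (hR c) s hy
  have k2 : (P * (∑ c, cd (Q c) (fun i => (a c i : ℂ)) - (D : ℂ) • 1)).trace.re =
      ∑ c, ∑ s ∈ range S, (P * cd (Q c) (ind (a c) s)).trace.re -
        D * finrank ℂ (LinearMap.range h.mulVecLin) := by
    rw [Matrix.mul_sub, Matrix.trace_sub, Matrix.mul_smul, Matrix.trace_smul, Matrix.mul_one, htr,
      Matrix.mul_sum, Matrix.trace_sum, Complex.sub_re, Complex.re_sum]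
    congr 1
    · refine Finset.sum_congr rfl fun c _ => ?_
      rw [← cd_sum (Q c) (a c) S (haS c), Matrix.mul_sum, Matrix.trace_sum, Complex.re_sum]
    · rw [smul_eq_mul, ← Nat.cast_mul, Complex.natCast_re, Nat.cast_mul]
  have k3 : D * finrank ℂ (LinearMap.range h.mulVecLin) ≤
      ∑ c, ∑ s ∈ range S, finrank ℂ ((Fsub (g c) (a c) s).map h.mulVecLin) := by
    have e1 := hsemi (LinearMap.ker h.mulVecLin)
    have e2 : ∑ c, ∑ s ∈ range S, finrank ℂ (Fsub (g c) (a c) s) = n * D := by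
      rw [← hsum]
      exact Finset.sum_congr rfl fun c _ => sum_finrank_Fsub (hg c) _ _ (haS c)
    have e3 := LinearMap.finrank_range_add_finrank_ker h.mulVecLin
    rw [Module.finrank_fintype_fun_eq_card, Fintype.card_fin] at e3
    have e4 : ∑ c, ∑ s ∈ range S, finrank ℂ ((Fsub (g c) (a c) s).map h.mulVecLin) +
        ∑ c, ∑ s ∈ range S, finrank ℂ (LinearMap.ker h.mulVecLin ⊓ Fsub (g c) (a c) s :
          Submodule ℂ (Fin n → ℂ)) = n * D := by
      rw [← e2, ← Finset.sum_add_distrib]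
      refine Finset.sum_congr rfl fun c _ => ?_
      rw [← Finset.sum_add_distrib]
      exact Finset.sum_congr rfl fun s _ => finrank_map_ker _ _
    have e5 : D * finrank ℂ (LinearMap.range h.mulVecLin) + D * finrank ℂ (LinearMap.ker h.mulVecLin) =
        n * D := by rw [← mul_add, e3, mul_comm]
    omega
  have k4 : ((D * finrank ℂ (LinearMap.range h.mulVecLin) : ℕ) : ℝ) ≤
      ∑ c, ∑ s ∈ range S, (P * cd (Q c) (ind (a c) s)).trace.re := by
    refine (Nat.cast_le.2 k3).trans ?_
    push_cast
    exact Finset.sum_le_sum fun c _ => Finset.sum_le_sum fun s _ => k1 c s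
  rw [k2]
  push_cast at k4
  linarith

lemma tendsto_aux {n : ℕ} {U : Filter ℕ} (f : Matrix (Fin n) (Fin n) ℂ)
    {A B : ℕ → Matrix (Fin n) (Fin n) ℂ} {a b : Matrix (Fin n) (Fin n) ℂ} (hA : Tendsto A U (𝓝 a))
    (hB : Tendsto B U (𝓝 b)) : Tendsto (fun m => (A m)ᴴ * (B m * f)) U (𝓝 (aᴴ * (b * f))) := by
  have h1 : Tendsto (fun m => (A m)ᴴ) U (𝓝 aᴴ) := by
    have c1 : Continuous fun p : Matrix (Fin n) (Fin n) ℂ => pᴴ := by fun_prop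
    exact (c1.tendsto a).comp hA
  exact h1.mul (hB.mul tendsto_const_nhds)

set_option maxHeartbeats 1000000 in
theorem unitary_of_semist {n : ℕ} (hn : 0 < n) {g : Fin 3 → Matrix (Fin n) (Fin n) ℂ}
    {a : Fin 3 → Fin n → ℕ} {S D : ℕ}
    (hg : ∀ c, (g c).det ≠ 0) (ha : ∀ c, Antitone (a c)) (haS : ∀ c i, a c i ≤ S)
    (hsum : ∑ c, ∑ i, a c i = n * D)
    (hsemi : ∀ W : Submodule ℂ (Fin n → ℂ), ∑ c, ∑ s ∈ range S,
      finrank ℂ (W ⊓ Fsub (g c) (a c) s : Submodule ℂ (Fin n → ℂ)) ≤ D * finrank ℂ W) :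
    ∃ Q : Fin 3 → Matrix (Fin n) (Fin n) ℂ, (∀ c, (Q c)ᴴ * Q c = 1) ∧
      ∑ c, cd (Q c) (fun i => (a c i : ℂ)) = (D : ℂ) • 1 := by
  set f : Fin 3 → Matrix (Fin n) (Fin n) ℂ := fun c => (g c)⁻¹ with hfdef
  have hf : ∀ c, (f c).det ≠ 0 := fun c => by
    rw [hfdef]
    exact (Matrix.isUnit_nonsing_inv_det _ (isUnit_iff_ne_zero.2 (hg c))).ne_zero
  have hex : ∀ m : ℕ, ∃ (h : Matrix (Fin n) (Fin n) ℂ) (Q R : Fin 3 → Matrix (Fin n) (Fin n) ℂ),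
      nrm h = 1 ∧ (∀ c, (Q c)ᴴ * Q c = 1) ∧ (∀ c, h * f c = Q c * R c) ∧
      (∀ c i j, j < i → R c i j = 0) ∧
      ∑ c, cd (Q c) (fun i => (a c i : ℂ)) - (D : ℂ) • 1 +
      (((1 / ((m : ℝ) + 1)) * (Complex.normSq h.det)⁻¹ : ℝ) : ℂ) • ((n : ℂ) • (h * hᴴ) - 1) = 0 := by
    intro m
    have hε : (0 : ℝ) < 1 / ((m : ℝ) + 1) := by positivity
    obtain ⟨h, hd, hh, hmin⟩ := exists_min hn hf ha haS hsum hε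
    choose Q R hQ hQR hR using fun c => exists_QR (h * f c)
    exact ⟨h, Q, R, hh, hQ, hQR, hR, stationary hf ha haS hd hh hmin Q R hQ hQR hR⟩
  choose h Q R hh hQ hQR hR hst using hex
  set U : Ultrafilter ℕ := hyperfilter ℕ with hU
  obtain ⟨h0, hh0, hlim⟩ := (isCompact_sphere (n := n) 1).ultrafilter_le_nhds' (U.map h)
    (Filter.Eventually.of_forall (f := (U : Filter ℕ)) hh)
  have hlim : Tendsto h U (𝓝 h0) := hlim
  have hQl : ∀ c, ∃ q, qᴴ * q = 1 ∧ Tendsto (fun m => Q m c) U (𝓝 q) := by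
    intro c
    obtain ⟨q, hq, hl⟩ := (isCompact_unitary (n := n)).ultrafilter_le_nhds' (U.map fun m => Q m c)
      (Filter.Eventually.of_forall (f := (U : Filter ℕ)) fun m => hQ m c)
    exact ⟨q, hq, hl⟩
  choose q hq hql using hQl
  have hRl : ∀ c, Tendsto (fun m => R m c) U (𝓝 ((q c)ᴴ * (h0 * f c))) := by
    intro c
    have e : ∀ m, R m c = (Q m c)ᴴ * (h m * f c) := fun m => by
      rw [hQR, ← Matrix.mul_assoc, hQ, Matrix.one_mul]
    simp only [e]
    exact tendsto_aux (f c) (hql c) hlim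
  set r : Fin 3 → Matrix (Fin n) (Fin n) ℂ := fun c => (q c)ᴴ * (h0 * f c) with hr
  have hr0 : ∀ c i j, j < i → r c i j = 0 := by
    intro c i j hij
    have c1 : Continuous fun M : Matrix (Fin n) (Fin n) ℂ => M i j := by fun_prop
    have := (c1.tendsto _).comp (hRl c)
    refine tendsto_nhds_unique this ?_
    have e : ((fun M : Matrix (Fin n) (Fin n) ℂ => M i j) ∘ fun m => R m c) = fun _ => 0 := by
      funext m; exact hR m c i j hij
    rw [e]; exact tendsto_const_nhds
  have hqr : ∀ c, h0 * f c = q c * r c := by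
    intro c
    have : q c * (q c)ᴴ = 1 := mul_eq_one_comm.1 (hq c)
    rw [hr]; simp only
    rw [← Matrix.mul_assoc, this, Matrix.one_mul]
  set E : (Fin 3 → Matrix (Fin n) (Fin n) ℂ) → Matrix (Fin n) (Fin n) ℂ := fun Q =>
    ∑ c, cd (Q c) (fun i => (a c i : ℂ)) - (D : ℂ) • 1 with hE
  have hEl : Tendsto (fun m => E (Q m)) U (𝓝 (E q)) := by
    have c1 : Continuous E := by
      rw [hE]; unfold cd; fun_prop
    exact (c1.tendsto q).comp (tendsto_pi_nhds.2 hql)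
  set η : ℕ → ℝ := fun m => (1 / ((m : ℝ) + 1)) * (Complex.normSq (h m).det)⁻¹ with hη
  have hηn : ∀ m, 0 ≤ η m := fun m => mul_nonneg (by positivity) (inv_nonneg.2 (Complex.normSq_nonneg _))
  have hKl : Tendsto (fun m => (n : ℂ) • (h m * (h m)ᴴ) - 1) U (𝓝 ((n : ℂ) • (h0 * h0ᴴ) - 1)) := by
    have c1 : Continuous fun p : Matrix (Fin n) (Fin n) ℂ => (n : ℂ) • (p * pᴴ) - 1 := by fun_prop
    exact (c1.tendsto h0).comp hlim
  have hη0 : Tendsto η U (𝓝 0) := by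
    by_cases hd : h0.det = 0
    · obtain ⟨P, hP, htr, hPf, hPm⟩ := exists_proj (LinearMap.range h0.mulVecLin)
      have hnn := trace_nonneg hg ha haS hsum hsemi hq hqr hr0 hP htr hPf
      set rr := finrank ℂ (LinearMap.range h0.mulVecLin) with hrr
      have hrn : rr < n := by
        have h1 : (LinearMap.range h0.mulVecLin) ≠ ⊤ := by
          intro ht
          have := LinearMap.range_eq_top.1 ht
          obtain ⟨x, hx0, hx⟩ := Matrix.exists_mulVec_eq_zero_iff.2 hd
          have hi := LinearMap.injective_iff_surjective.2 this
          exact hx0 (hi (by rw [Matrix.mulVecLin_apply, hx, map_zero]))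
        have := Submodule.finrank_lt (lt_top_iff_ne_top.2 h1).ne
        rwa [Module.finrank_fintype_fun_eq_card, Fintype.card_fin] at this
      have hPh : P * h0 = h0 := mul_eq_of fun x => hPf _ ⟨x, rfl⟩
      set T : Matrix (Fin n) (Fin n) ℂ → ℝ := fun M => (P * M).trace.re with hT
      have hTc : Continuous T := by
        rw [hT]
        exact Complex.continuous_re.comp (by fun_prop)
      have hT0 : T ((n : ℂ) • (h0 * h0ᴴ) - 1) = n - rr := by
        rw [hT]; simp only
        rw [Matrix.mul_sub, Matrix.mul_smul, ← Matrix.mul_assoc, hPh, Matrix.mul_one, Matrix.trace_sub,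
          Matrix.trace_smul, htr, Matrix.trace_mul_comm, Complex.sub_re, Complex.natCast_re, smul_eq_mul,
          ← Complex.ofReal_natCast, Complex.re_ofReal_mul]
        have : (h0ᴴ * h0).trace.re = 1 := hh0
        rw [this, mul_one]
      have hpos : (0 : ℝ) < n - rr := by
        have : (rr : ℝ) < n := by exact_mod_cast hrn
        linarith
      have l1 : Tendsto (fun m => T ((n : ℂ) • (h m * (h m)ᴴ) - 1)) U (𝓝 (n - rr)) := by
        rw [← hT0]; exact (hTc.tendsto _).comp hKl
      have l2 : Tendsto (fun m => T (E (Q m))) U (𝓝 (T (E q))) := (hTc.tendsto _).comp hEl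
      have e1 : ∀ m, T (E (Q m)) = - (η m * T ((n : ℂ) • (h m * (h m)ᴴ) - 1)) := by
        intro m
        have : E (Q m) = - ((η m : ℂ) • ((n : ℂ) • (h m * (h m)ᴴ) - 1)) := eq_neg_of_add_eq_zero_left (hst m)
        rw [this, hT]; simp only
        rw [Matrix.mul_neg, Matrix.trace_neg, Complex.neg_re, Matrix.mul_smul, Matrix.trace_smul,
          smul_eq_mul, Complex.re_ofReal_mul]
      have l3 : Tendsto (fun m => - T (E (Q m)) / T ((n : ℂ) • (h m * (h m)ᴴ) - 1)) U
          (𝓝 (- T (E q) / (n - rr))) := l2.neg.div l1 hpos.ne'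
      have l4 : Tendsto η U (𝓝 (- T (E q) / (n - rr))) := by
        refine l3.congr' ?_
        filter_upwards [l1.eventually (lt_mem_nhds hpos)] with m hm
        rw [e1, neg_neg, mul_div_assoc, div_self hm.ne', mul_one]
      have l5 : 0 ≤ - T (E q) / (n - rr) := ge_of_tendsto' l4 hηn
      have l6 : - T (E q) / (n - rr) ≤ 0 := div_nonpos_of_nonpos_of_nonneg (neg_nonpos.2 hnn) hpos.le
      rwa [le_antisymm l6 l5] at l4
    · have l1 : Tendsto (fun m : ℕ => 1 / ((m : ℝ) + 1)) U (𝓝 0) :=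
        tendsto_one_div_add_atTop_nhds_zero_nat.mono_left Nat.hyperfilter_le_atTop
      have c1 : Continuous fun M : Matrix (Fin n) (Fin n) ℂ => Complex.normSq M.det :=
        Complex.continuous_normSq.comp (by fun_prop)
      have l2 := ((c1.tendsto h0).comp hlim).inv₀ (by simpa using hd)
      have l3 := l1.mul l2
      rw [zero_mul] at l3
      exact l3
  have hfin : Tendsto (fun m => E (Q m) + (η m : ℂ) • ((n : ℂ) • (h m * (h m)ᴴ) - 1)) U
      (𝓝 (E q + ((0 : ℝ) : ℂ) • ((n : ℂ) • (h0 * h0ᴴ) - 1))) :=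
    hEl.add (((Complex.continuous_ofReal.tendsto _).comp hη0).smul hKl)
  have hz : (fun m => E (Q m) + (η m : ℂ) • ((n : ℂ) • (h m * (h m)ᴴ) - 1)) = fun _ => 0 := by
    funext m; exact hst m
  rw [hz] at hfin
  have := tendsto_nhds_unique hfin tendsto_const_nhds
  rw [Complex.ofReal_zero, zero_smul, add_zero] at this
  exact ⟨q, hq, sub_eq_zero.1 this⟩

end HornC


namespace HornD
open Finset Matrix Module HornB HornC

lemma exists_cd {n : ℕ} {A : Matrix (Fin n) (Fin n) ℂ} (hA : A.IsHermitian) (μ : Fin n → ℕ)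
    (h : HasOrdSpecC A (fun i => (μ i : ℝ))) :
    ∃ Q : Matrix (Fin n) (Fin n) ℂ, Qᴴ * Q = 1 ∧ A = cd Q (fun i => (μ i : ℂ)) := by
  set B : Matrix (Fin n) (Fin n) ℂ := diagonal (fun i => (μ i : ℂ)) with hBdef
  have hB : B.IsHermitian := by
    rw [Matrix.IsHermitian, hBdef, Matrix.diagonal_conjTranspose]
    congr 1
    funext i
    simp
  have hc : A.charpoly = B.charpoly := by
    rw [h.2, hBdef, Matrix.charpoly_diagonal]
    simp
  have he := (Matrix.IsHermitian.eigenvalues_eq_eigenvalues_iff hA hB).2 hc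
  have h1 := hA.spectral_theorem
  have h2 := hB.spectral_theorem
  rw [Unitary.conjStarAlgAut_apply] at h1 h2
  rw [← he] at h2
  set U : Matrix (Fin n) (Fin n) ℂ := (hA.eigenvectorUnitary : Matrix (Fin n) (Fin n) ℂ)
  set V : Matrix (Fin n) (Fin n) ℂ := (hB.eigenvectorUnitary : Matrix (Fin n) (Fin n) ℂ)
  have hU : Uᴴ * U = 1 := (Matrix.mem_unitaryGroup_iff'.1 hA.eigenvectorUnitary.2)
  have hV : V * Vᴴ = 1 := (Matrix.mem_unitaryGroup_iff.1 hB.eigenvectorUnitary.2)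
  have hV' : Vᴴ * V = 1 := (Matrix.mem_unitaryGroup_iff'.1 hB.eigenvectorUnitary.2)
  set d : Matrix (Fin n) (Fin n) ℂ := diagonal (RCLike.ofReal ∘ hA.eigenvalues)
  have h1 : A = U * d * Uᴴ := h1
  have h2 : B = V * d * Vᴴ := h2
  refine ⟨U * Vᴴ, ?_, ?_⟩
  · rw [Matrix.conjTranspose_mul, Matrix.conjTranspose_conjTranspose]
    calc V * Uᴴ * (U * Vᴴ) = V * (Uᴴ * U) * Vᴴ := by simp only [Matrix.mul_assoc]
      _ = 1 := by rw [hU, Matrix.mul_one, hV]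
  · rw [cd, ← hBdef, h2, h1, Matrix.conjTranspose_mul, Matrix.conjTranspose_conjTranspose]
    calc U * d * Uᴴ = U * (1 * d * 1) * Uᴴ := by rw [Matrix.one_mul, Matrix.mul_one]
      _ = U * ((Vᴴ * V) * d * (Vᴴ * V)) * Uᴴ := by rw [hV']
      _ = _ := by simp only [Matrix.mul_assoc]

lemma charpoly_cd {n : ℕ} {Q : Matrix (Fin n) (Fin n) ℂ} (hQ : Qᴴ * Q = 1) (b : Fin n → ℂ) :
    (cd Q b).charpoly = ∏ i, (Polynomial.X - Polynomial.C (b i)) := by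
  rw [cd, Matrix.charpoly_mul_comm, ← Matrix.mul_assoc, hQ, Matrix.one_mul, Matrix.charpoly_diagonal]

lemma cd_compl {n : ℕ} {Q : Matrix (Fin n) (Fin n) ℂ} (hQ : Qᴴ * Q = 1) (b : Fin n → ℕ) (D : ℕ)
    (hb : ∀ i, b i ≤ D) :
    cd Q (fun i => ((D - b i : ℕ) : ℂ)) = (D : ℂ) • 1 - cd Q (fun i => (b i : ℂ)) := by
  have h1 : diagonal (fun i => ((D - b i : ℕ) : ℂ)) = (D : ℂ) • (1 : Matrix (Fin n) (Fin n) ℂ) -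
      diagonal (fun i => (b i : ℂ)) := by
    rw [← Matrix.diagonal_one, ← Matrix.diagonal_smul, Matrix.diagonal_sub]
    congr 1
    funext i
    simp [Nat.cast_sub (hb i)]
  rw [cd, cd, h1, Matrix.mul_sub, Matrix.sub_mul, Matrix.mul_smul, Matrix.smul_mul, Matrix.mul_one,
    mul_eq_one_comm.1 hQ]

lemma cd_fix {n : ℕ} {Q : Matrix (Fin n) (Fin n) ℂ} (hQ : Qᴴ * Q = 1) (b : Fin n → ℕ) (s : ℕ)
    {x : Fin n → ℂ} (hx : x ∈ Fsub Qᴴ b s) : cd Q (ind b s) *ᵥ x = x := by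
  rw [cd, ← Matrix.mulVec_mulVec, ← Matrix.mulVec_mulVec]
  have : diagonal (ind b s) *ᵥ (Qᴴ *ᵥ x) = Qᴴ *ᵥ x := by
    funext i
    rw [Matrix.mulVec_diagonal]
    simp only [ind]
    split_ifs with h
    · rw [one_mul]
    · rw [hx i (not_lt.1 h), mul_zero]
  rw [this, Matrix.mulVec_mulVec, mul_eq_one_comm.1 hQ, Matrix.one_mulVec]

/-- Klyachko's necessary direction -/
lemma semist_of_unitary {n : ℕ} {a : Fin 3 → Fin n → ℕ} {S D : ℕ} (haS : ∀ c i, a c i ≤ S)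
    {Q : Fin 3 → Matrix (Fin n) (Fin n) ℂ} (hQ : ∀ c, (Q c)ᴴ * Q c = 1)
    (h : ∑ c, cd (Q c) (fun i => (a c i : ℂ)) = (D : ℂ) • 1) (W : Submodule ℂ (Fin n → ℂ)) :
    ∑ c, ∑ s ∈ range S, finrank ℂ (W ⊓ Fsub (Q c)ᴴ (a c) s : Submodule ℂ (Fin n → ℂ)) ≤
      D * finrank ℂ W := by
  obtain ⟨P, hP, htr, hPf, -⟩ := exists_proj W
  have k1 : ∀ c s, (finrank ℂ (W ⊓ Fsub (Q c)ᴴ (a c) s : Submodule ℂ (Fin n → ℂ)) : ℝ) ≤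
      (P * cd (Q c) (ind (a c) s)).trace.re := fun c s =>
    trace_ge hP (cd_ind_proj (hQ c) _ _) _ (fun x hx => hPf x hx.1) (fun x hx => cd_fix (hQ c) _ _ hx.2)
  have k2 : ∑ c, ∑ s ∈ range S, (P * cd (Q c) (ind (a c) s)).trace.re = D * finrank ℂ W := by
    have := congrArg (fun M => (P * M).trace.re) h
    simp only [Matrix.mul_sum, Matrix.trace_sum, Complex.re_sum, Matrix.mul_smul, Matrix.mul_one,
      Matrix.trace_smul, htr, smul_eq_mul] at this
    rw [← Nat.cast_mul, Complex.natCast_re, Nat.cast_mul] at this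
    rw [← this]
    refine Finset.sum_congr rfl fun c _ => ?_
    rw [← cd_sum (Q c) (a c) S (haS c), Matrix.mul_sum, Matrix.trace_sum, Complex.re_sum]
  have k3 : ((∑ c, ∑ s ∈ range S, finrank ℂ (W ⊓ Fsub (Q c)ᴴ (a c) s : Submodule ℂ (Fin n → ℂ)) : ℕ) : ℝ) ≤
      (D * finrank ℂ W : ℕ) := by
    push_cast
    rw [← k2]
    exact Finset.sum_le_sum fun c _ => Finset.sum_le_sum fun s _ => k1 c s
  exact_mod_cast k3

lemma sum_of_unitary {n : ℕ} {a : Fin 3 → Fin n → ℕ} {D : ℕ}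
    {Q : Fin 3 → Matrix (Fin n) (Fin n) ℂ} (hQ : ∀ c, (Q c)ᴴ * Q c = 1)
    (h : ∑ c, cd (Q c) (fun i => (a c i : ℂ)) = (D : ℂ) • 1) : ∑ c, ∑ i, a c i = n * D := by
  have := congrArg Matrix.trace h
  rw [Matrix.trace_sum, Matrix.trace_smul, Matrix.trace_one, Fintype.card_fin] at this
  have e : ∀ c, (cd (Q c) (fun i => (a c i : ℂ))).trace = ∑ i, (a c i : ℂ) := fun c => by
    rw [cd, Matrix.trace_mul_comm, ← Matrix.mul_assoc, hQ, Matrix.one_mul, Matrix.trace_diagonal]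
  simp only [e] at this
  rw [smul_eq_mul] at this
  have h2 : ((∑ c, ∑ i, a c i : ℕ) : ℂ) = ((n * D : ℕ) : ℂ) := by
    push_cast; rw [this, mul_comm]
  exact_mod_cast h2

/-- three weights -/
def wts (n : ℕ) (α β γ : ℕ → ℕ) (D : ℕ) : Fin 3 → Fin n → ℕ :=
  ![fun i => α i, fun i => β i, fun i => D - γ i]

/-- Hermitian matrices to unitary triple -/
theorem unitary_of_herm {n : ℕ} {α β γ : ℕ → ℕ} {D : ℕ} (hD : ∀ i < n, γ i ≤ D)
    {A B : Matrix (Fin n) (Fin n) ℂ} (hA : A.IsHermitian) (hB : B.IsHermitian)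
    (h1 : HasOrdSpecC A (fun i => (α i.1 : ℝ))) (h2 : HasOrdSpecC B (fun i => (β i.1 : ℝ)))
    (h3 : HasOrdSpecC (A + B) (fun i => (γ i.1 : ℝ))) :
    ∃ Q : Fin 3 → Matrix (Fin n) (Fin n) ℂ, (∀ c, (Q c)ᴴ * Q c = 1) ∧
      ∑ c, cd (Q c) (fun i => (wts n α β γ D c i : ℂ)) = (D : ℂ) • 1 := by
  obtain ⟨q1, u1, e1⟩ := exists_cd hA (fun i => α i) h1
  obtain ⟨q2, u2, e2⟩ := exists_cd hB (fun i => β i) h2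
  obtain ⟨q3, u3, e3⟩ := exists_cd (hA.add hB) (fun i => γ i) h3
  refine ⟨![q1, q2, q3], ?_, ?_⟩
  · intro c; fin_cases c <;> simp [u1, u2, u3]
  · have e4 := cd_compl u3 (fun i : Fin n => γ i) D (fun i => hD i i.2)
    rw [← e3] at e4
    rw [Fin.sum_univ_three]
    change cd q1 (fun i => (α i : ℂ)) + cd q2 (fun i => (β i : ℂ)) + cd q3 (fun i => ((D - γ i : ℕ) : ℂ)) = _
    rw [e4, ← e1, ← e2]
    abel

/-- three weights with third one reversed -/
def wts' (n : ℕ) (α β γ : ℕ → ℕ) (D : ℕ) : Fin 3 → Fin n → ℕ :=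
  ![fun i => α i, fun i => β i, fun i => D - γ (Fin.rev i)]

theorem herm_of_unitary {n : ℕ} {α β γ : ℕ → ℕ} {D : ℕ} (hD : ∀ i < n, γ i ≤ D)
    (hα : Antitone α) (hβ : Antitone β) (hγ : Antitone γ)
    {Q : Fin 3 → Matrix (Fin n) (Fin n) ℂ} (hQ : ∀ c, (Q c)ᴴ * Q c = 1)
    (h : ∑ c, cd (Q c) (fun i => (wts' n α β γ D c i : ℂ)) = (D : ℂ) • 1) :
    ∃ A B : Matrix (Fin n) (Fin n) ℂ, A.IsHermitian ∧ B.IsHermitian ∧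
      HasOrdSpecC A (fun i => (α i.1 : ℝ)) ∧ HasOrdSpecC B (fun i => (β i.1 : ℝ)) ∧
      HasOrdSpecC (A + B) (fun i => (γ i.1 : ℝ)) := by
  refine ⟨cd (Q 0) (fun i => (α i : ℂ)), cd (Q 1) (fun i => (β i : ℂ)), cd_herm _ _, cd_herm _ _,
    ⟨?_, ?_⟩, ⟨?_, ?_⟩, ⟨?_, ?_⟩⟩
  · intro i j hij; exact Nat.cast_le.2 (hα hij)
  · rw [charpoly_cd (hQ 0)]; simp
  · intro i j hij; exact Nat.cast_le.2 (hβ hij)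
  · rw [charpoly_cd (hQ 1)]; simp
  · intro i j hij; exact Nat.cast_le.2 (hγ hij)
  · rw [Fin.sum_univ_three] at h
    change cd (Q 0) (fun i => (α i : ℂ)) + cd (Q 1) (fun i => (β i : ℂ)) +
      cd (Q 2) (fun i => ((D - γ (Fin.rev i) : ℕ) : ℂ)) = _ at h
    rw [cd_compl (hQ 2) (fun i : Fin n => γ (Fin.rev i)) D (fun i => hD _ (Fin.rev i).2)] at h
    have e : cd (Q 0) (fun i => (α i : ℂ)) + cd (Q 1) (fun i => (β i : ℂ)) =
        cd (Q 2) (fun i : Fin n => (γ (Fin.rev i) : ℂ)) := by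
      have := sub_eq_zero.2 h
      rw [← sub_eq_zero, ← this]; abel
    rw [e, charpoly_cd (hQ 2)]
    rw [← Equiv.prod_comp Fin.revPerm]
    simp

end HornD


namespace HornH
open Finset Matrix Module HornB HornC HornD HornA

theorem herm_of_arr {n : ℕ} (hn : 0 < n) {α β γ : ℕ → ℕ} (hα : Antitone α) (hβ : Antitone β)
    (hγ : Antitone γ)
    (hsum : ∑ i ∈ range n, γ i = ∑ i ∈ range n, α i + ∑ i ∈ range n, β i) (h : LRArr n α β γ) :
    ∃ A B : Matrix (Fin n) (Fin n) ℂ, A.IsHermitian ∧ B.IsHermitian ∧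
      HasOrdSpecC A (fun i => (α i.1 : ℝ)) ∧ HasOrdSpecC B (fun i => (β i.1 : ℝ)) ∧
      HasOrdSpecC (A + B) (fun i => (γ i.1 : ℝ)) := by
  obtain ⟨lam, h1, h2, h3, h4, h5, h6⟩ := h
  have hnn : ∀ i q, i ≤ n → q < n → 0 ≤ lam i q := by
    intro i
    induction i with
    | zero => intro q _ hq; rw [h1 q hq]; positivity
    | succ i ih => intro q hi hq; exact (ih q (by omega) hq).trans (h3 i q (by omega) hq)
  set D := γ 0 with hDdef
  set S := α 0 + β 0 + γ 0 with hS
  have kk : ∀ i q, i < n → q < n → ((lam (i + 1) q - lam i q).toNat : ℤ) = lam (i + 1) q - lam i q :=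
    fun i q hi hq => Int.toNat_of_nonneg (by have := h3 i q hi hq; omega)
  have hD : ∀ i < n, γ i ≤ D := fun i _ => hγ (Nat.zero_le i)
  have hαS : ∀ i, α i ≤ S := fun i => by have := hα (Nat.zero_le i); omega
  have hβS : ∀ i, β i ≤ S := fun i => by have := hβ (Nat.zero_le i); omega
  obtain ⟨Q, V, hQ, hV, hW⟩ := semist n α β γ S D (fun i _ => hαS i) (fun i _ => hβS i) hD (by omega)
    (fun i q => (lam (i + 1) q - lam i q).toNat) (fun i q => (lam i q).toNat)
    (by
      intro i m hi hm
      zify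
      rw [Finset.sum_congr rfl fun q hq => kk (i + 1) q hi (by have := mem_range.1 hq; omega),
        Finset.sum_congr rfl fun q hq => kk i q (by omega) (by have := mem_range.1 hq; omega)]
      exact h5 i m hi hm)
    (by
      intro i hi
      zify
      rw [Finset.sum_congr rfl fun q hq => kk i q hi (mem_range.1 hq)]
      exact h6 i hi)
    (by intro q hq; rw [h1 q hq]; simp)
    (by intro q hq; rw [h2 q hq]; simp)
    (by
      intro i q hi hq
      have := h3 i q hi hq
      have := hnn i q (by omega) hq
      omega)
    (by
      intro i q hi hq
      have := h4 i q hi hq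
      omega)
  let J : Matrix (Fin n) (Fin n) ℂ := (1 : Matrix (Fin n) (Fin n) ℂ).submatrix Fin.rev id
  have hJ : J.det ≠ 0 := by
    have : J = (1 : Matrix (Fin n) (Fin n) ℂ).submatrix (Fin.revPerm : Equiv.Perm (Fin n)) id := by
      rfl
    rw [this, Matrix.det_permute, Matrix.det_one, mul_one]
    rcases Int.units_eq_one_or (Equiv.Perm.sign (Fin.revPerm : Equiv.Perm (Fin n))) with h | h <;>
      rw [h] <;> simp
  have hJx : ∀ (x : Fin n → ℂ) i, (J *ᵥ x) i = x (Fin.rev i) := by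
    intro x i
    simp [J, Matrix.mulVec, dotProduct, Matrix.one_apply]
  have hJF : ∀ s, Fsub J (fun i : Fin n => D - γ (Fin.rev i)) s = Fsub 1 (fun i : Fin n => D - γ i) s := by
    intro s
    ext x
    simp only [mem_Fsub, hJx, Matrix.one_mulVec]
    constructor
    · intro h i hi
      have := h (Fin.rev i)
      rw [Fin.rev_rev] at this
      exact this hi
    · intro h i hi
      exact h _ hi
  obtain ⟨q, hq, hqs⟩ := unitary_of_semist hn (g := ![Q, V, J]) (a := wts' n α β γ D) (S := S) (D := D)
    (by intro c; fin_cases c <;> simp [hQ, hV, hJ])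
    (by
      intro c
      fin_cases c
      · exact fun i j hij => hα hij
      · exact fun i j hij => hβ hij
      · intro i j hij
        have : γ (Fin.rev i) ≤ γ (Fin.rev j) := hγ (Fin.rev_le_rev.2 hij)
        show D - γ (Fin.rev j) ≤ D - γ (Fin.rev i)
        omega)
    (by
      intro c i
      fin_cases c
      · exact hαS _
      · exact hβS _
      · show D - γ (Fin.rev i) ≤ S
        omega)
    (by
      rw [Fin.sum_univ_three]
      change ∑ i : Fin n, α i + ∑ i : Fin n, β i + ∑ i : Fin n, (D - γ (Fin.rev i)) = _
      rw [Fin.sum_univ_eq_sum_range (fun i => α i), Fin.sum_univ_eq_sum_range (fun i => β i)]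
      have e1 : ∑ i : Fin n, (D - γ (Fin.rev i)) = ∑ i : Fin n, (D - γ i) :=
        Equiv.sum_comp Fin.revPerm (fun i : Fin n => D - γ i)
      rw [e1, Fin.sum_univ_eq_sum_range (fun i => D - γ i), ← hsum, ← Finset.sum_add_distrib]
      rw [Finset.sum_congr rfl fun i hi => show γ i + (D - γ i) = D by
        have := hD i (mem_range.1 hi); omega]
      simp)
    (by
      intro W
      rw [Fin.sum_univ_three]
      change ∑ s ∈ range S, finrank ℂ (W ⊓ Fsub Q (fun i => α i) s : Submodule ℂ (Fin n → ℂ)) +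
        ∑ s ∈ range S, finrank ℂ (W ⊓ Fsub V (fun i => β i) s : Submodule ℂ (Fin n → ℂ)) +
        ∑ s ∈ range S, finrank ℂ (W ⊓ Fsub J (fun i : Fin n => D - γ (Fin.rev i)) s :
          Submodule ℂ (Fin n → ℂ)) ≤ _
      have e : ∀ s, finrank ℂ (W ⊓ Fsub J (fun i : Fin n => D - γ (Fin.rev i)) s :
          Submodule ℂ (Fin n → ℂ)) = finrank ℂ (W ⊓ Fsub 1 (fun i : Fin n => D - γ i) s :
          Submodule ℂ (Fin n → ℂ)) := fun s => by rw [hJF s]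
      rw [Finset.sum_congr rfl fun s _ => e s]
      exact hW W)
  exact herm_of_unitary hD hα hβ hγ hq hqs

end HornH


namespace HornF
open Finset Matrix Module HornB HornE

/-- coefficient sequence -/
noncomputable def ph (n : ℕ) : (Fin n → (PowerSeries ℂ)) →ₗ[ℂ] (ℤ → Fin n → ℂ) where
  toFun x := fun u i => if 0 ≤ u then PowerSeries.coeff u.toNat (x i) else 0
  map_add' x y := by
    funext u i
    simp only [Pi.add_apply, map_add]
    split_ifs <;> simp
  map_smul' c x := by
    funext u i
    simp only [Pi.smul_apply, RingHom.id_apply, smul_eq_mul]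
    split_ifs <;> simp

variable {n : ℕ}

lemma ph_apply (x : Fin n → (PowerSeries ℂ)) (u : ℤ) (i : Fin n) :
    ph n x u i = if 0 ≤ u then PowerSeries.coeff u.toNat (x i) else 0 := rfl

lemma ph_nat (x : Fin n → (PowerSeries ℂ)) (u : ℕ) (i : Fin n) : ph n x u i = PowerSeries.coeff u (x i) := by
  rw [ph_apply, if_pos (by positivity)]; simp

lemma ph_inj : Function.Injective (ph n) := by
  intro x y h
  funext i
  ext u
  rw [← ph_nat, ← ph_nat, h]

lemma ph_Os (x : Fin n → (PowerSeries ℂ)) : ph n x ∈ (Os ℂ 0 : Submodule ℂ (ℤ → Fin n → ℂ)) := by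
  intro u hu
  funext i
  rw [ph_apply, if_neg (by omega)]; rfl

lemma ph_surj {x : ℤ → Fin n → ℂ} (hx : x ∈ (Os ℂ 0 : Submodule ℂ (ℤ → Fin n → ℂ))) : ∃ y, ph n y = x := by
  refine ⟨fun i => PowerSeries.mk fun m => x m i, ?_⟩
  funext u i
  rw [ph_apply]
  split_ifs with h
  · rw [PowerSeries.coeff_mk, Int.toNat_of_nonneg h]
  · rw [hx u (by omega)]; rfl

lemma ph_X (x : Fin n → (PowerSeries ℂ)) : ph n ((PowerSeries.X : (PowerSeries ℂ)) • x) = sh (k := ℂ) 1 (ph n x) := by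
  funext u i
  rw [sh_apply, ph_apply, ph_apply, Pi.smul_apply, smul_eq_mul]
  by_cases h : 1 ≤ u
  · rw [if_pos (by omega), if_pos (by omega)]
    have : u.toNat = (u - 1).toNat + 1 := by omega
    rw [this, PowerSeries.coeff_succ_X_mul]
  · rw [if_neg (show ¬ (0 ≤ u - 1) by omega)]
    split_ifs with h0
    · have : u.toNat = 0 := by omega
      rw [this]; simp
    · rfl

lemma ph_X_pow (m : ℕ) (x : Fin n → (PowerSeries ℂ)) : ph n ((PowerSeries.X : (PowerSeries ℂ)) ^ m • x) = sh (k := ℂ) m (ph n x) := by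
  induction m with
  | zero => rw [pow_zero, one_smul, Nat.cast_zero, sh_zero]
  | succ m ih => rw [pow_succ', mul_smul, ph_X, ih, sh_sh]; congr 2; push_cast; ring

/-- constant matrices -/
noncomputable def cm (g : Matrix (Fin n) (Fin n) ℂ) : Matrix (Fin n) (Fin n) (PowerSeries ℂ) := g.map (PowerSeries.C)

lemma cm_mul (g g' : Matrix (Fin n) (Fin n) ℂ) : cm (g * g') = cm g * cm g' := by
  rw [cm, cm, cm, Matrix.map_mul]

lemma cm_one : cm (1 : Matrix (Fin n) (Fin n) ℂ) = 1 := by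
  rw [cm, Matrix.map_one _ (map_zero _) (map_one _)]

lemma ph_cm (g : Matrix (Fin n) (Fin n) ℂ) (x : Fin n → (PowerSeries ℂ)) (u : ℤ) : ph n (cm g *ᵥ x) u = g *ᵥ ph n x u := by
  funext i
  simp only [ph_apply, Matrix.mulVec, dotProduct, cm, Matrix.map_apply]
  split_ifs with h
  · rw [map_sum]
    refine Finset.sum_congr rfl fun j _ => ?_
    rw [PowerSeries.coeff_C_mul]
  · simp

/-- lattice spanned by the columns of `T`, shifted by `-N` -/
noncomputable def Ps (N : ℕ) (T : Matrix (Fin n) (Fin n) (PowerSeries ℂ)) : Submodule ℂ (ℤ → Fin n → ℂ) :=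
  (LinearMap.range ((ph n).comp (T.mulVecLin.restrictScalars ℂ))).map (sh (-(N : ℤ)))

lemma mem_Ps {N : ℕ} {T : Matrix (Fin n) (Fin n) (PowerSeries ℂ)} {x : ℤ → Fin n → ℂ} :
    x ∈ Ps N T ↔ ∃ y, x = sh (k := ℂ) (-(N : ℤ)) (ph n (T *ᵥ y)) := by
  constructor
  · rintro ⟨_, ⟨y, rfl⟩, rfl⟩; exact ⟨y, rfl⟩
  · rintro ⟨y, rfl⟩; exact ⟨_, ⟨y, rfl⟩, rfl⟩

lemma Ps_X_pow (N m : ℕ) (T : Matrix (Fin n) (Fin n) (PowerSeries ℂ)) :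
    Ps (N + m) ((PowerSeries.X : (PowerSeries ℂ)) ^ m • T) = Ps N T := by
  ext x
  rw [mem_Ps, mem_Ps]
  refine exists_congr fun y => ?_
  rw [Matrix.smul_mulVec, ph_X_pow, sh_sh]
  have : (-((N + m : ℕ) : ℤ) + m) = -(N : ℤ) := by push_cast; ring
  rw [this]

lemma Ps_le {N : ℕ} {T T' : Matrix (Fin n) (Fin n) (PowerSeries ℂ)} (h : Ps N T' ≤ Ps N T) : ∃ k, T' = T * k := by
  have : ∀ j, ∃ y, T *ᵥ y = T' *ᵥ (Pi.single j 1) := by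
    intro j
    obtain ⟨y, hy⟩ := mem_Ps.1 (h (mem_Ps.2 ⟨Pi.single j 1, rfl⟩))
    exact ⟨y, (ph_inj (sh_inj _ hy)).symm⟩
  choose y hy using this
  refine ⟨Matrix.of fun i j => y j i, ?_⟩
  apply Matrix.ext
  intro i j
  have := congrFun (hy j) i
  rw [Matrix.mulVec_single_one] at this
  rw [Matrix.mul_apply]
  exact this.symm

lemma Ps_eq {N : ℕ} {T T' : Matrix (Fin n) (Fin n) (PowerSeries ℂ)} (hT : T.det ≠ 0) (h : Ps N T' = Ps N T) :
    ∃ k, T' = T * k ∧ IsUnit k.det := by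
  obtain ⟨k, hk⟩ := Ps_le h.le
  obtain ⟨k', hk'⟩ := Ps_le h.ge
  refine ⟨k, hk, ?_⟩
  have e : T.det = T.det * (k.det * k'.det) := by
    conv_lhs => rw [hk', hk]
    rw [Matrix.det_mul, Matrix.det_mul, mul_assoc]
  have : k.det * k'.det = 1 := by
    apply mul_left_cancel₀ hT
    rw [← e, mul_one]
  exact IsUnit.of_mul_eq_one _ this

/-- Hermite form -/
lemma hermite (N : Submodule (PowerSeries ℂ) (Fin n → (PowerSeries ℂ))) (c : ℕ)
    (hc : ∀ i, ((PowerSeries.X : (PowerSeries ℂ)) ^ c) • (Pi.single i (1 : (PowerSeries ℂ)) : Fin n → (PowerSeries ℂ)) ∈ N) :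
    ∃ T : Matrix (Fin n) (Fin n) (PowerSeries ℂ), (∀ i j, j < i → T i j = 0) ∧ (∀ i, T i i ≠ 0) ∧
      ∀ x, x ∈ N ↔ ∃ y, x = T *ᵥ y := by
  let Z : Fin n → Submodule (PowerSeries ℂ) (Fin n → (PowerSeries ℂ)) := fun i =>
    { carrier := {x | x ∈ N ∧ ∀ q, i < q → x q = 0}
      add_mem' := fun {a b} ha hb => ⟨N.add_mem ha.1 hb.1, fun q hq => by
        rw [Pi.add_apply, ha.2 q hq, hb.2 q hq, add_zero]⟩
      zero_mem' := ⟨N.zero_mem, fun _ _ => rfl⟩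
      smul_mem' := fun r a ha => ⟨N.smul_mem r ha.1, fun q hq => by
        rw [Pi.smul_apply, ha.2 q hq, smul_zero]⟩ }
  let I : Fin n → Ideal (PowerSeries ℂ) := fun i => (Z i).map (LinearMap.proj i)
  have hI : ∀ i, ∃ x ∈ Z i, ∀ z ∈ Z i, ∃ w, z i = w * x i := by
    intro i
    obtain ⟨t, ht⟩ := (IsPrincipalIdealRing.principal (I i)).principal
    have : t ∈ I i := by rw [ht]; exact Submodule.mem_span_singleton_self t
    obtain ⟨x, hx, hxt⟩ := this
    refine ⟨x, hx, fun z hz => ?_⟩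
    have hz' : z i ∈ I i := ⟨z, hz, rfl⟩
    rw [ht, Submodule.mem_span_singleton] at hz'
    obtain ⟨w, hw⟩ := hz'
    refine ⟨w, ?_⟩
    rw [← hw, ← hxt]; rfl
  choose x hx hxd using hI
  refine ⟨Matrix.of fun i j => x j i, ?_, ?_, ?_⟩
  · intro i j hij; exact (hx j).2 i hij
  · intro i h0
    have h0 : x i i = 0 := h0
    obtain ⟨w, hw⟩ := hxd i (((PowerSeries.X : (PowerSeries ℂ)) ^ c) • (Pi.single i (1 : (PowerSeries ℂ)) : Fin n → (PowerSeries ℂ)))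
      ⟨hc i, fun q hq => by simp [Pi.single_apply, hq.ne']⟩
    rw [h0, mul_zero] at hw
    simp at hw
  · set T : Matrix (Fin n) (Fin n) (PowerSeries ℂ) := Matrix.of fun i j => x j i with hT
    have hcol : ∀ j (w : (PowerSeries ℂ)), T *ᵥ (Pi.single j w) = w • x j := by
      intro j w
      funext i
      rw [Matrix.mulVec_single]
      simp [hT, mul_comm]
    intro z
    constructor
    · have key : ∀ r : ℕ, ∀ z ∈ N, (∀ q : Fin n, r ≤ q → z q = 0) → ∃ y, z = T *ᵥ y := by
        intro r
        induction r with
        | zero =>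
          intro z _ h
          exact ⟨0, by rw [Matrix.mulVec_zero]; funext q; exact h q (Nat.zero_le _)⟩
        | succ r ih =>
          intro z hz h
          by_cases hr : r < n
          · obtain ⟨w, hw⟩ := hxd ⟨r, hr⟩ z ⟨hz, fun q hq => h q hq⟩
            obtain ⟨y, hy⟩ := ih (z - w • x ⟨r, hr⟩) (N.sub_mem hz (N.smul_mem _ (hx _).1)) (by
              intro q hq
              rw [Pi.sub_apply, Pi.smul_apply, smul_eq_mul]
              rcases hq.lt_or_eq with h1 | h1
              · rw [h q h1, (hx ⟨r, hr⟩).2 q h1, mul_zero, sub_zero]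
              · have : q = ⟨r, hr⟩ := Fin.ext h1.symm
                rw [this, hw, sub_self])
            refine ⟨y + Pi.single ⟨r, hr⟩ w, ?_⟩
            rw [Matrix.mulVec_add, ← hy, hcol, sub_add_cancel]
          · exact ih z hz fun q hq => absurd q.2 (by omega)
      intro hz
      exact key n z hz fun q hq => absurd q.2 (by omega)
    · rintro ⟨y, rfl⟩
      have : T *ᵥ y = ∑ j, y j • x j := by
        funext i
        simp [Matrix.mulVec, dotProduct, hT, Finset.sum_apply, mul_comm]
      rw [this]
      exact N.sum_mem fun j _ => N.smul_mem _ (hx j).1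

/-- triangular basis of a lattice -/
lemma exists_tri {L : Submodule ℂ (ℤ → Fin n → ℂ)} {c : ℤ} {N : ℕ} (h1 : Os ℂ c ≤ L)
    (h2 : L ≤ Os ℂ (-(N : ℤ))) (hs : Stab L) {g : Matrix (Fin n) (Fin n) ℂ} (hg : g.det ≠ 0) :
    ∃ T : Matrix (Fin n) (Fin n) (PowerSeries ℂ), (∀ i j, j < i → T i j = 0) ∧ (∀ i, T i i ≠ 0) ∧
      L = Ps N (cm g⁻¹ * T) := by
  have hu := isUnit_iff_ne_zero.2 hg
  have hbig : ∀ (m : ℕ) (z : Fin n → (PowerSeries ℂ)), c + N ≤ m →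
      sh (k := ℂ) (-(N : ℤ)) (ph n ((PowerSeries.X : (PowerSeries ℂ)) ^ m • z)) ∈ L := by
    intro m z hm
    apply h1
    intro u hu
    rw [ph_X_pow, sh_sh, sh_apply]
    exact ph_Os z _ (by omega)
  have hsX : ∀ (m : ℕ) (z : Fin n → (PowerSeries ℂ)), sh (k := ℂ) (-(N : ℤ)) (ph n z) ∈ L →
      sh (k := ℂ) (-(N : ℤ)) (ph n ((PowerSeries.X : (PowerSeries ℂ)) ^ m • z)) ∈ L := by
    intro m z hz
    induction m with
    | zero => rwa [pow_zero, one_smul]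
    | succ m ih =>
      rw [pow_succ', mul_smul, ph_X, sh_sh, add_comm, ← sh_sh]
      exact hs _ ih
  let M : Submodule (PowerSeries ℂ) (Fin n → (PowerSeries ℂ)) :=
    { carrier := {x | sh (k := ℂ) (-(N : ℤ)) (ph n (cm g⁻¹ *ᵥ x)) ∈ L}
      add_mem' := fun {a b} ha hb => by
        simp only [Set.mem_ofPred_eq] at ha hb ⊢
        rw [Matrix.mulVec_add, map_add, map_add]
        exact L.add_mem ha hb
      zero_mem' := by
        simp only [Set.mem_ofPred_eq]
        rw [Matrix.mulVec_zero, map_zero, map_zero]; exact L.zero_mem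
      smul_mem' := fun f a ha => by
        simp only [Set.mem_ofPred_eq] at ha ⊢
        rw [Matrix.mulVec_smul]
        set z := cm g⁻¹ *ᵥ a
        have hp : ∀ p : Polynomial ℂ, sh (k := ℂ) (-(N : ℤ)) (ph n ((p : (PowerSeries ℂ)) • z)) ∈ L := by
          intro p
          induction p using Polynomial.induction_on' with
          | add p q hp hq =>
            rw [Polynomial.coe_add, add_smul, map_add, map_add]
            exact L.add_mem hp hq
          | monomial m r =>
            rw [← Polynomial.C_mul_X_pow_eq_monomial, Polynomial.coe_mul, Polynomial.coe_C, Polynomial.coe_pow,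
              Polynomial.coe_X, ← PowerSeries.smul_eq_C_mul,
              smul_assoc, map_smul, map_smul]
            exact L.smul_mem _ (hsX m z ha)
        rw [PowerSeries.eq_X_pow_mul_shift_add_trunc (c + N).toNat f, add_smul, mul_smul, map_add, map_add]
        exact L.add_mem (hbig _ _ (Int.self_le_toNat _)) (hp _) }
  obtain ⟨T, t1, t2, t3⟩ := hermite M (c + N).toNat (fun i => by
    show sh (k := ℂ) (-(N : ℤ)) (ph n (cm g⁻¹ *ᵥ _)) ∈ L
    rw [Matrix.mulVec_smul]
    exact hbig _ _ (Int.self_le_toNat _))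
  refine ⟨T, t1, t2, ?_⟩
  ext x
  rw [mem_Ps]
  constructor
  · intro hx
    have h3 : sh (k := ℂ) (N : ℤ) x ∈ (Os ℂ 0 : Submodule ℂ (ℤ → Fin n → ℂ)) := by
      intro u hu
      exact h2 hx _ (by omega)
    obtain ⟨y, hy⟩ := ph_surj h3
    have e : x = sh (k := ℂ) (-(N : ℤ)) (ph n y) := by
      rw [hy, sh_sh, neg_add_cancel, sh_zero]
    have e2 : cm g⁻¹ *ᵥ (cm g *ᵥ y) = y := by
      rw [Matrix.mulVec_mulVec, ← cm_mul, Matrix.nonsing_inv_mul _ hu, cm_one, Matrix.one_mulVec]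
    have : cm g *ᵥ y ∈ M := by
      show sh (k := ℂ) (-(N : ℤ)) (ph n (cm g⁻¹ *ᵥ _)) ∈ L
      rw [e2, ← e]; exact hx
    obtain ⟨w, hw⟩ := (t3 _).1 this
    exact ⟨w, by rw [← Matrix.mulVec_mulVec, ← hw, e2, e]⟩
  · rintro ⟨w, rfl⟩
    have : T *ᵥ w ∈ M := (t3 _).2 ⟨w, rfl⟩
    rw [← Matrix.mulVec_mulVec]; exact this

lemma tri_zero {T : Matrix (Fin n) (Fin n) (PowerSeries ℂ)} (h1 : ∀ i j, j < i → T i j = 0) (h2 : ∀ i, T i i ≠ 0)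
    {b : Fin n → ℕ} (hb : Antitone b) {s : ℕ} {y : Fin n → (PowerSeries ℂ)} :
    (∀ i, b i ≤ s → (T *ᵥ y) i = 0) ↔ ∀ i, b i ≤ s → y i = 0 := by
  constructor
  · intro h
    have key : ∀ m : ℕ, ∀ i : Fin n, n ≤ i + m → b i ≤ s → y i = 0 := by
      intro m
      induction m with
      | zero => intro i hi; exact absurd i.2 (by omega)
      | succ m ih =>
        intro i hi hbi
        have e := h i hbi
        rw [Matrix.mulVec, dotProduct, Finset.sum_eq_single i] at e
        · exact (mul_eq_zero.1 e).resolve_left (h2 i)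
        · intro j _ hj
          rcases lt_or_gt_of_ne hj with h3 | h3
          · rw [h1 i j h3, zero_mul]
          · rw [ih j (by have : (i : ℕ) < j := h3; omega) ((hb h3.le).trans hbi), mul_zero]
        · simp
    intro i hi
    exact key n i (by omega) hi
  · intro h i hi
    rw [Matrix.mulVec, dotProduct]
    refine Finset.sum_eq_zero fun j _ => ?_
    rcases lt_or_ge j i with h3 | h3
    · rw [h1 i j h3, zero_mul]
    · rw [h j ((hb h3).trans hi), mul_zero]

lemma mm_tri {T : Matrix (Fin n) (Fin n) (PowerSeries ℂ)} (h1 : ∀ i j, j < i → T i j = 0) (h2 : ∀ i, T i i ≠ 0)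
    {b : Fin n → ℕ} (hb : Antitone b) (s N : ℕ) {g : Matrix (Fin n) (Fin n) ℂ} (hg : g.det ≠ 0) :
    mm (Fsub g b s) (Ps N (cm g⁻¹ * T)) =
      Ps (N + 1) (cm g⁻¹ * (T * diagonal fun i => if s < b i then 1 else PowerSeries.X)) := by
  have hu := isUnit_iff_ne_zero.2 hg
  have hX : ∀ z : Fin n → (PowerSeries ℂ), sh (k := ℂ) (-((N + 1 : ℕ) : ℤ)) (ph n ((PowerSeries.X : (PowerSeries ℂ)) • z)) =
      sh (k := ℂ) (-(N : ℤ)) (ph n z) := by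
    intro z
    rw [ph_X, sh_sh]; congr 2; push_cast; ring
  have hhat : ∀ y, sh (k := ℂ) (-(N : ℤ)) (ph n ((cm g⁻¹ * T) *ᵥ y)) ∈ hat (Fsub g b s) ↔
      ∀ i, b i ≤ s → y i = 0 := by
    intro y
    rw [← tri_zero h1 h2 hb, mem_hat]
    simp only [mem_Fsub, sh_apply, ← Matrix.mulVec_mulVec _ (cm g⁻¹), ph_cm]
    simp only [Matrix.mulVec_mulVec _ g, Matrix.mul_nonsing_inv _ hu, Matrix.one_mulVec]
    constructor
    · intro h i hi
      ext u
      have := h (u - N) i hi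
      rw [sub_neg_eq_add, sub_add_cancel, ph_nat] at this
      rw [this]; simp
    · intro h u i hi
      rw [ph_apply, h i hi]; simp
  apply le_antisymm
  · apply sup_le
    · intro x hx
      obtain ⟨y, rfl⟩ := mem_Ps.1 hx
      refine mem_Ps.2 ⟨fun i => if s < b i then PowerSeries.X * y i else y i, ?_⟩
      rw [← hX, ← Matrix.mulVec_smul]
      congr 2
      rw [← Matrix.mul_assoc, ← Matrix.mulVec_mulVec _ (cm g⁻¹ * T)]
      congr 1
      funext i
      rw [Matrix.mulVec_diagonal]
      simp only [Pi.smul_apply, smul_eq_mul]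
      split_ifs <;> simp
    · rintro _ ⟨x, ⟨hx1, hx2⟩, rfl⟩
      obtain ⟨y, rfl⟩ := mem_Ps.1 hx1
      have hy := (hhat y).1 hx2
      refine mem_Ps.2 ⟨y, ?_⟩
      rw [sh_sh]
      congr 2
      · push_cast; ring
      · rw [← Matrix.mul_assoc, ← Matrix.mulVec_mulVec _ (cm g⁻¹ * T)]
        congr 1
        funext i
        rw [Matrix.mulVec_diagonal]
        split_ifs with h
        · rw [one_mul]
        · rw [hy i (not_lt.1 h), mul_zero]
  · intro x hx
    obtain ⟨y, rfl⟩ := mem_Ps.1 hx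
    have e : (cm g⁻¹ * (T * diagonal fun i => if s < b i then 1 else PowerSeries.X)) *ᵥ y =
        (cm g⁻¹ * T) *ᵥ (fun i => if s < b i then y i else 0) +
        (PowerSeries.X : (PowerSeries ℂ)) • ((cm g⁻¹ * T) *ᵥ (fun i => if s < b i then 0 else y i)) := by
      rw [← Matrix.mul_assoc, ← Matrix.mulVec_mulVec, ← Matrix.mulVec_smul, ← Matrix.mulVec_add]
      congr 1
      funext i
      rw [Matrix.mulVec_diagonal]
      simp only [Pi.add_apply, Pi.smul_apply, smul_eq_mul]
      split_ifs <;> simp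
    rw [e, map_add, map_add]
    refine Submodule.add_mem _ ?_ ?_
    · apply Submodule.mem_sup_right
      refine ⟨sh (k := ℂ) (-(N : ℤ)) (ph n ((cm g⁻¹ * T) *ᵥ (fun i => if s < b i then y i else 0))),
        ⟨mem_Ps.2 ⟨_, rfl⟩, ?_⟩, ?_⟩
      · refine (hhat _).2 fun i hi => ?_
        rw [if_neg (by omega)]
      · rw [sh_sh]; congr 2; push_cast; ring
    · rw [hX]
      exact Submodule.mem_sup_left (mem_Ps.2 ⟨_, rfl⟩)

/-- diagonal matrix of powers -/
noncomputable def dg (b : Fin n → ℕ) : Matrix (Fin n) (Fin n) (PowerSeries ℂ) := diagonal fun i => PowerSeries.X ^ b i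

lemma dg_mul (a b : Fin n → ℕ) : dg a * dg b = dg (fun i => a i + b i) := by
  simp only [dg, Matrix.diagonal_mul_diagonal, pow_add]

lemma mmf_tri {T : Matrix (Fin n) (Fin n) (PowerSeries ℂ)} (h1 : ∀ i j, j < i → T i j = 0) (h2 : ∀ i, T i i ≠ 0)
    {b : Fin n → ℕ} (hb : Antitone b) (N m : ℕ) {g : Matrix (Fin n) (Fin n) ℂ} (hg : g.det ≠ 0) :
    mmf ((List.range m).map (Fsub g b)) (Ps N (cm g⁻¹ * T)) =
      Ps (N + m) (cm g⁻¹ * (T * dg fun i => m - b i)) := by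
  induction m with
  | zero =>
    have : (dg fun i => 0 - b i) = (1 : Matrix (Fin n) (Fin n) (PowerSeries ℂ)) := by simp [dg]
    rw [this, Matrix.mul_one]
    simp [mmf]
  | succ m ih =>
    rw [List.range_succ, List.map_append, mmf, List.foldl_append]
    rw [mmf] at ih
    rw [ih]
    simp only [List.map_cons, List.map_nil, List.foldl_cons, List.foldl_nil]
    rw [mm_tri _ _ hb m (N + m) hg]
    · have e : (dg fun i => m - b i) * (diagonal fun i => if m < b i then 1 else PowerSeries.X) =
          dg fun i => m + 1 - b i := by
        rw [dg, Matrix.diagonal_mul_diagonal, dg]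
        congr 1
        funext i
        split_ifs with h
        · rw [mul_one]; congr 1; omega
        · rw [← pow_succ]; congr 1; omega
      rw [Matrix.mul_assoc T, e, add_assoc]
    · intro i j hij
      rw [dg, Matrix.mul_diagonal, h1 i j hij, zero_mul]
    · intro i
      rw [dg, Matrix.mul_diagonal]
      exact mul_ne_zero (h2 i) (pow_ne_zero _ PowerSeries.X_ne_zero)

end HornF


namespace HornF
open Finset Matrix Module HornB HornE

variable {n : ℕ}

lemma mmf_append {V : Type*} [AddCommGroup V] [Module ℂ V] (l1 l2 : List (Submodule ℂ V))
    (L : Submodule ℂ (ℤ → V)) : mmf (l1 ++ l2) L = mmf l2 (mmf l1 L) := by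
  simp [mmf, List.foldl_append]

lemma tri_det {T : Matrix (Fin n) (Fin n) (PowerSeries ℂ)} (h1 : ∀ i j, j < i → T i j = 0)
    (h2 : ∀ i, T i i ≠ 0) {g : Matrix (Fin n) (Fin n) ℂ} (hg : g.det ≠ 0) : (cm g⁻¹ * T).det ≠ 0 := by
  rw [Matrix.det_mul]
  refine mul_ne_zero ?_ ?_
  · have : (cm g⁻¹).det * (cm g).det = 1 := by
      rw [← Matrix.det_mul, ← cm_mul, Matrix.nonsing_inv_mul _ (isUnit_iff_ne_zero.2 hg), cm_one,
        Matrix.det_one]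
    exact left_ne_zero_of_mul_eq_one this
  · rw [Matrix.det_of_isUpperTriangular (fun i j h => h1 i j h)]
    exact Finset.prod_ne_zero_iff.2 fun i _ => h2 i

lemma Ps_map_sh (N D : ℕ) (T : Matrix (Fin n) (Fin n) (PowerSeries ℂ)) :
    (Ps N T).map (sh (k := ℂ) (-(D:ℤ))) = Ps (N + D) T := by
  rw [Ps, Ps, map_sh_sh]
  congr 2
  push_cast
  ring

lemma list_sum_range (f : ℕ → ℕ) (S : ℕ) : ((List.range S).map f).sum = ∑ s ∈ range S, f s := by
  rfl

theorem lat_aux {S D : ℕ} (g : Fin 3 → Matrix (Fin n) (Fin n) ℂ) (hg : ∀ c, (g c).det ≠ 0)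
    (a : Fin 3 → Fin n → ℕ) (ha : ∀ c, Antitone (a c)) (haS : ∀ c i, a c i ≤ S)
    (hsum : ∑ c, ∑ i, a c i = n * D)
    (hss : ∀ W : Submodule ℂ (Fin n → ℂ), ∑ c, ∑ s ∈ range S,
      finrank ℂ (W ⊓ Fsub (g c) (a c) s : Submodule ℂ (Fin n → ℂ)) ≤ D * finrank ℂ W) :
    ∃ k1 k2 k3 : Matrix (Fin n) (Fin n) (PowerSeries ℂ), IsUnit k1.det ∧ IsUnit k2.det ∧ IsUnit k3.det ∧
      (PowerSeries.X : PowerSeries ℂ) ^ D • ((dg fun i => S - a 0 i) * k1 * (dg fun i => S - a 1 i) * k2 *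
        (dg fun i => S - a 2 i) * k3) = (PowerSeries.X : PowerSeries ℂ) ^ (3 * S) • 1 := by
  set l : Fin 3 → List (Submodule ℂ (Fin n → ℂ)) := fun c => (List.range S).map (Fsub (g c) (a c)) with hl
  obtain ⟨M, c, hM1, hM2, hM3, hM4⟩ := exists_fixed_lattice (l 0 ++ l 1 ++ l 2) D
    (by
      intro W
      refine le_trans (le_of_eq ?_) (hss W)
      rw [Fin.sum_univ_three]
      simp only [hl, List.map_append, List.sum_append, List.map_map]
      rfl)
    (by
      have := fun c => HornC.sum_finrank_Fsub (hg c) (a c) S (haS c)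
      rw [Module.finrank_fintype_fun_eq_card, Fintype.card_fin, mul_comm, ← hsum, Fin.sum_univ_three,
        ← this, ← this, ← this]
      simp only [hl, List.map_append, List.sum_append, List.map_map]
      rfl)
  have hlen : ∀ c, (l c).length = S := by intro c; simp [hl]
  rw [mmf_append, mmf_append] at hM4
  set L1 := mmf (l 0) M with hL1
  set L2 := mmf (l 1) L1 with hL2
  have u1 : Os ℂ (c:ℤ) ≤ L1 := hM1.trans (le_mmf _ _)
  have u2 : Os ℂ (c:ℤ) ≤ L2 := u1.trans (le_mmf _ _)
  have v1 : L1 ≤ Os ℂ (-((c + S : ℕ) : ℤ)) := by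
    have := mmf_le_Os (l 0) hM2
    rw [hlen] at this
    convert this using 2
    push_cast; ring
  have v2 : L2 ≤ Os ℂ (-((c + S + S : ℕ) : ℤ)) := by
    have := mmf_le_Os (l 1) v1
    rw [hlen] at this
    convert this using 2
    push_cast; ring
  have s1 : Stab L1 := mmf_stab _ hM3
  have s2 : Stab L2 := mmf_stab _ s1
  obtain ⟨T0, p0, q0, e0⟩ := exists_tri hM1 hM2 hM3 (hg 0)
  obtain ⟨T1, p1, q1, e1⟩ := exists_tri u1 v1 s1 (hg 1)
  obtain ⟨T2, p2, q2, e2⟩ := exists_tri u2 v2 s2 (hg 2)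
  have m0 := mmf_tri p0 q0 (ha 0) c S (hg 0)
  have m1 := mmf_tri p1 q1 (ha 1) (c + S) S (hg 1)
  have m2 := mmf_tri p2 q2 (ha 2) (c + S + S) S (hg 2)
  have d0 := tri_det p0 q0 (hg 0)
  have d1 := tri_det p1 q1 (hg 1)
  have d2 := tri_det p2 q2 (hg 2)
  rw [← e0] at m0
  rw [← e1] at m1
  rw [← e2] at m2
  change L1 = _ at m0
  change L2 = _ at m1
  change mmf (l 2) L2 = _ at m2
  rw [hM4, e0, Ps_map_sh] at m2
  rw [e1] at m0
  rw [e2] at m1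
  rw [← Matrix.mul_assoc] at m0 m1 m2
  generalize cm (g 0)⁻¹ * T0 = B0 at *
  generalize cm (g 1)⁻¹ * T1 = B1 at *
  generalize cm (g 2)⁻¹ * T2 = B2 at *
  have hdg : ∀ b : Fin n → ℕ, (dg b).det ≠ 0 := by
    intro b
    rw [dg, Matrix.det_diagonal]
    exact Finset.prod_ne_zero_iff.2 fun i _ => pow_ne_zero _ PowerSeries.X_ne_zero
  obtain ⟨k1, f1, w1⟩ := Ps_eq (by rw [Matrix.det_mul]; exact mul_ne_zero d0 (hdg _)) m0
  obtain ⟨k2, f2, w2⟩ := Ps_eq (by rw [Matrix.det_mul]; exact mul_ne_zero d1 (hdg _)) m1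
  rw [← Ps_X_pow (c + D) (3 * S), ← Ps_X_pow (c + S + S + S) D,
    show c + S + S + S + D = c + D + 3 * S by ring] at m2
  obtain ⟨k3, f3, w3⟩ := Ps_eq (by
    rw [Matrix.det_smul, Matrix.det_mul]
    exact mul_ne_zero (pow_ne_zero _ (pow_ne_zero _ PowerSeries.X_ne_zero)) (mul_ne_zero d2 (hdg _))) m2
  refine ⟨k1, k2, k3, w1, w2, w3, ?_⟩
  have key : B0 * ((PowerSeries.X : PowerSeries ℂ) ^ D • ((dg fun i => S - a 0 i) * k1 * (dg fun i => S - a 1 i) * k2 *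
        (dg fun i => S - a 2 i) * k3)) = B0 * ((PowerSeries.X : PowerSeries ℂ) ^ (3 * S) • 1) := by
    rw [Matrix.mul_smul, Matrix.mul_smul, Matrix.mul_one, f3, f2, f1]
    simp only [Matrix.mul_assoc, Matrix.smul_mul]
  have key2 := congrArg (fun M => B0.adjugate * M) key
  simp only [← Matrix.mul_assoc, Matrix.adjugate_mul] at key2
  simp only [Matrix.smul_mul, Matrix.one_mul] at key2
  apply Matrix.ext
  intro i j
  have := congrFun (congrFun key2 i) j
  rw [Matrix.smul_apply, Matrix.smul_apply B0.det] at this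
  simpa only [Matrix.mul_assoc] using mul_left_cancel₀ d0 this

lemma cd_rev (Q : Matrix (Fin n) (Fin n) ℂ) (b : Fin n → ℂ) :
    HornC.cd (Q.submatrix id Fin.rev) (fun i => b (Fin.rev i)) = HornC.cd Q b := by
  apply Matrix.ext
  intro i j
  rw [HornC.cd, HornC.cd, Matrix.mul_apply, Matrix.mul_apply]
  simp only [Matrix.mul_diagonal, Matrix.conjTranspose_apply, Matrix.submatrix_apply, id]
  exact Equiv.sum_comp Fin.revPerm (fun x => Q i x * b x * star (Q j x))

lemma unitary_rev {Q : Matrix (Fin n) (Fin n) ℂ} (hQ : Qᴴ * Q = 1) :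
    (Q.submatrix id Fin.rev)ᴴ * Q.submatrix id Fin.rev = 1 := by
  have : (Q.submatrix id Fin.rev)ᴴ * Q.submatrix id Fin.rev =
      (Qᴴ * Q).submatrix (Fin.revPerm : Equiv.Perm (Fin n)) (Fin.revPerm : Equiv.Perm (Fin n)) := by
    apply Matrix.ext
    intro i j
    rw [Matrix.submatrix_apply, Matrix.mul_apply, Matrix.mul_apply]
    rfl
  rw [this, hQ, Matrix.submatrix_one_equiv]

lemma unit_cancel_dg {S : ℕ} {M N : Matrix (Fin n) (Fin n) (PowerSeries ℂ)}
    (h : (PowerSeries.X : PowerSeries ℂ) ^ S • M = (PowerSeries.X : PowerSeries ℂ) ^ S • N) : M = N := by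
  apply Matrix.ext
  intro i j
  have := congrFun (congrFun h i) j
  rw [Matrix.smul_apply, Matrix.smul_apply] at this
  exact mul_left_cancel₀ (pow_ne_zero _ PowerSeries.X_ne_zero) this

lemma dg_const (S : ℕ) : (dg fun _ : Fin n => S) = (PowerSeries.X : PowerSeries ℂ) ^ S • 1 := by
  rw [dg, ← Matrix.diagonal_one, ← Matrix.diagonal_smul]
  congr 1
  funext i
  simp

lemma dg_rev (b : Fin n → ℕ) : ∃ J : Matrix (Fin n) (Fin n) (PowerSeries ℂ), IsUnit J.det ∧
    (dg fun i => b (Fin.rev i)) = J * dg b * J := by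
  let J : Matrix (Fin n) (Fin n) (PowerSeries ℂ) :=
    (1 : Matrix (Fin n) (Fin n) (PowerSeries ℂ)).submatrix (Fin.revPerm : Equiv.Perm (Fin n)) id
  have hJ : ∀ i j, J i j = if Fin.rev i = j then 1 else 0 := by
    intro i j; rfl
  refine ⟨J, ?_, ?_⟩
  · rw [Matrix.det_permute, Matrix.det_one, mul_one]
    rcases Int.units_eq_one_or (Equiv.Perm.sign (Fin.revPerm : Equiv.Perm (Fin n))) with h | h <;>
      rw [h] <;> simp
  · apply Matrix.ext
    intro i j
    rw [Matrix.mul_apply]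
    simp only [dg, Matrix.mul_diagonal, hJ, ite_mul, one_mul, zero_mul]
    rw [Finset.sum_ite_eq, if_pos (mem_univ _), Fin.rev_rev, Matrix.diagonal_apply]
    split_ifs <;> simp

/-- The lattice statement. -/
theorem lat_of_unitary {α β γ : ℕ → ℕ} {D : ℕ} (hα : Antitone α) (hβ : Antitone β) (hγ : Antitone γ)
    (hD : ∀ i < n, γ i ≤ D) {Q : Fin 3 → Matrix (Fin n) (Fin n) ℂ} (hQ : ∀ c, (Q c)ᴴ * Q c = 1)
    (h : ∑ c, HornC.cd (Q c) (fun i => (HornD.wts n α β γ D c i : ℂ)) = (D : ℂ) • 1) :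
    ∃ k1 k2 k3 : Matrix (Fin n) (Fin n) (PowerSeries ℂ), IsUnit k1.det ∧ IsUnit k2.det ∧ IsUnit k3.det ∧
      (dg fun i : Fin n => β i) * k1 * (dg fun i : Fin n => α i) = k2 * (dg fun i : Fin n => γ i) * k3 := by
  set Q' : Fin 3 → Matrix (Fin n) (Fin n) ℂ := ![Q 0, Q 1, (Q 2).submatrix id Fin.rev] with hQ'def
  set S := α 0 + β 0 + D with hS
  have hQ' : ∀ c, (Q' c)ᴴ * Q' c = 1 := by
    intro c
    fin_cases c
    · exact hQ 0
    · exact hQ 1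
    · exact unitary_rev (hQ 2)
  have h' : ∑ c, HornC.cd (Q' c) (fun i => (HornD.wts' n α β γ D c i : ℂ)) = (D : ℂ) • 1 := by
    rw [← h, Fin.sum_univ_three, Fin.sum_univ_three]
    congr 1
    exact cd_rev (Q 2) (fun i => (HornD.wts n α β γ D 2 i : ℂ))
  have haS : ∀ c i, HornD.wts' n α β γ D c i ≤ S := by
    intro c i
    fin_cases c
    · show α i ≤ S
      have := hα (Nat.zero_le i); omega
    · show β i ≤ S
      have := hβ (Nat.zero_le i); omega
    · show D - γ (Fin.rev i) ≤ S
      omega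
  have ha : ∀ c, Antitone (HornD.wts' n α β γ D c) := by
    intro c
    fin_cases c
    · exact fun i j hij => hα hij
    · exact fun i j hij => hβ hij
    · intro i j hij
      have : γ (Fin.rev i) ≤ γ (Fin.rev j) := hγ (Fin.rev_le_rev.2 hij)
      show D - γ (Fin.rev j) ≤ D - γ (Fin.rev i)
      omega
  have hdet : ∀ c, ((Q' c)ᴴ).det ≠ 0 := by
    intro c
    have := congrArg Matrix.det (hQ' c)
    rw [Matrix.det_mul, Matrix.det_one] at this
    exact left_ne_zero_of_mul_eq_one this
  obtain ⟨k1, k2, k3, w1, w2, w3, e⟩ := lat_aux (fun c => (Q' c)ᴴ) hdet (HornD.wts' n α β γ D) ha haS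
    (HornD.sum_of_unitary hQ' h') (HornD.semist_of_unitary haS hQ' h')
  obtain ⟨J, wJ, eJ⟩ := dg_rev (fun i : Fin n => γ i)
  refine ⟨k1⁻¹, k2 * J, J * k3, ?_, ?_, ?_, ?_⟩
  · exact Matrix.isUnit_nonsing_inv_det k1 w1
  · rw [Matrix.det_mul]; exact w2.mul wJ
  · rw [Matrix.det_mul]; exact wJ.mul w3
  · have e1 : (PowerSeries.X : PowerSeries ℂ) ^ D • (dg fun i => S - HornD.wts' n α β γ D 2 i) =
        (PowerSeries.X : PowerSeries ℂ) ^ S • (dg fun i : Fin n => γ (Fin.rev i)) := by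
      rw [← Matrix.one_mul (dg fun i => S - _), ← Matrix.smul_mul, ← dg_const, dg_mul,
        ← Matrix.one_mul (dg fun i => γ _), ← Matrix.smul_mul, ← dg_const, dg_mul]
      congr 1
      funext i
      show D + (S - (D - γ (Fin.rev i))) = S + γ (Fin.rev i)
      have := hD (Fin.rev i) (Fin.rev i).2
      omega
    have e2 : (dg fun i : Fin n => α i) * (dg fun i => S - HornD.wts' n α β γ D 0 i) =
        (PowerSeries.X : PowerSeries ℂ) ^ S • 1 := by
      rw [dg_mul, ← dg_const]
      congr 1
      funext i
      have := haS 0 i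
      show α i + (S - α i) = S
      change α i ≤ S at this
      omega
    have e3 : (dg fun i : Fin n => β i) * (dg fun i => S - HornD.wts' n α β γ D 1 i) =
        (PowerSeries.X : PowerSeries ℂ) ^ S • 1 := by
      rw [dg_mul, ← dg_const]
      congr 1
      funext i
      have := haS 1 i
      show β i + (S - β i) = S
      change β i ≤ S at this
      omega
    generalize (dg fun i => S - HornD.wts' n α β γ D 0 i) = A0 at *
    generalize (dg fun i => S - HornD.wts' n α β γ D 1 i) = A1 at *
    generalize (dg fun i => S - HornD.wts' n α β γ D 2 i) = A2 at *
    generalize (dg fun i : Fin n => α i) = Aα at *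
    generalize (dg fun i : Fin n => β i) = Aβ at *
    have e4 : (PowerSeries.X : PowerSeries ℂ) ^ (S + S) • (k1 * A1 * k2 * (dg fun i : Fin n => γ (Fin.rev i)) * k3)
        = (PowerSeries.X : PowerSeries ℂ) ^ (S + S) • ((PowerSeries.X : PowerSeries ℂ) ^ S • Aα) := by
      calc _ = (Aα * A0) * k1 * A1 * k2 * ((PowerSeries.X : PowerSeries ℂ) ^ D • A2) * k3 := by
            rw [e1, e2, pow_add]
            simp only [Matrix.smul_mul, Matrix.mul_smul, Matrix.one_mul, smul_smul]
        _ = Aα * ((PowerSeries.X : PowerSeries ℂ) ^ D • (A0 * k1 * A1 * k2 * A2 * k3)) := by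
            simp only [Matrix.smul_mul, Matrix.mul_smul, Matrix.mul_assoc]
        _ = _ := by
            rw [e, Matrix.mul_smul, Matrix.mul_one, smul_smul, ← pow_add]
            congr 2
            ring
    have e5 := unit_cancel_dg e4
    apply unit_cancel_dg (S := S)
    rw [← Matrix.mul_smul, ← e5]
    calc _ = Aβ * ((k1⁻¹ * k1) * (A1 * k2 * (dg fun i : Fin n => γ (Fin.rev i)) * k3)) := by
          simp only [Matrix.mul_assoc]
      _ = (Aβ * A1) * (k2 * (dg fun i : Fin n => γ (Fin.rev i)) * k3) := by
          rw [Matrix.nonsing_inv_mul _ w1, Matrix.one_mul]; simp only [Matrix.mul_assoc]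
      _ = _ := by
          rw [e3, eJ, Matrix.smul_mul, Matrix.one_mul]; simp only [Matrix.mul_assoc]

end HornF


namespace HornG
open Finset

/-- From a hive to an array of Littlewood--Richardson type. -/
theorem arr_of_hive {n : ℕ} {α β γ : ℕ → ℕ} (hγ : Antitone γ) (H : ℕ → ℕ → ℤ)
    (hsum : (∑ i ∈ range n, (γ i : ℤ)) = ∑ i ∈ range n, (α i : ℤ) + ∑ i ∈ range n, (β i : ℤ))
    (b1 : ∀ j ≤ n, H j 0 = ∑ i ∈ range j, (α i : ℤ))
    (b2 : ∀ l ≤ n, H 0 l = ∑ i ∈ range l, (γ i : ℤ))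
    (b3 : ∀ j l, j + l = n → H j l = ∑ i ∈ range n, (α i : ℤ) + ∑ i ∈ range l, (β i : ℤ))
    (r1 : ∀ j l, j + l + 2 ≤ n → H j l + H (j + 1) (l + 1) ≤ H (j + 1) l + H j (l + 1))
    (r2 : ∀ j l, j + l + 2 ≤ n → H (j + 2) l + H j (l + 1) ≤ H (j + 1) l + H (j + 1) (l + 1))
    (r3 : ∀ j l, j + l + 2 ≤ n → H j (l + 2) + H (j + 1) l ≤ H j (l + 1) + H (j + 1) (l + 1)) :
    HornA.LRArr n α β γ := by
  set lam : ℕ → ℕ → ℤ := fun i q => if q < i then (γ q : ℤ) else H (q + 1 - i) i - H (q - i) i with hlam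
  have lt : ∀ i q, q < i → lam i q = γ q := fun i q h => if_pos h
  have ge : ∀ i j, lam i (i + j) = H (j + 1) i - H j i := by
    intro i j
    rw [hlam]
    simp only
    rw [if_neg (by omega), show i + j + 1 - i = j + 1 by omega, show i + j - i = j by omega]
  have P1 : ∀ i m, m ≤ i → ∑ q ∈ range m, lam i q = ∑ q ∈ range m, (γ q : ℤ) := fun i m h =>
    Finset.sum_congr rfl fun q hq => lt i q (by have := mem_range.1 hq; omega)
  have P2 : ∀ i j, i ≤ n → ∑ q ∈ range (i + j), lam i q = H j i := by
    intro i j hi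
    induction j with
    | zero => rw [add_zero, P1 i i le_rfl, b2 i hi]
    | succ j ih => rw [← add_assoc, Finset.sum_range_succ, ih, ge]; ring
  have kk : ∀ d i, i + d + 1 = n → H 1 i ≤ H 0 (i + 1) := by
    intro d
    induction d with
    | zero =>
      intro i hi
      rw [b3 1 i (by omega), b3 0 (i + 1) (by omega), Finset.sum_range_succ]
      have : (0:ℤ) ≤ β i := by positivity
      linarith
    | succ d ih =>
      intro i hi
      have h1 := ih (i + 1) (by omega)
      have h2 := r3 0 i (by omega)
      simp only [zero_add, add_assoc, Nat.reduceAdd] at h1 h2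
      linarith
  refine ⟨lam, ?_, ?_, ?_, ?_, ?_, ?_⟩
  · intro q hq
    have := ge 0 q
    rw [zero_add] at this
    rw [this, b1 _ (by omega), b1 _ (by omega), Finset.sum_range_succ]
    ring
  · intro q hq
    exact lt n q hq
  · intro i q hi hq
    rcases lt_trichotomy q i with h | h | h
    · rw [lt i q h, lt (i + 1) q (by omega)]
    · subst h
      have := ge q 0
      rw [add_zero] at this
      rw [this, lt (q + 1) q (by omega), b2 q (by omega), zero_add]
      have h1 := kk (n - 1 - q) q (by omega)
      rw [b2 _ (by omega), Finset.sum_range_succ] at h1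
      linarith
    · obtain ⟨j, rfl⟩ : ∃ j, q = i + 1 + j := ⟨q - i - 1, by omega⟩
      rw [ge (i + 1) j, add_assoc i 1 j, ge i (1 + j), add_comm 1 j]
      have := r2 j i (by omega)
      simp only [add_assoc, Nat.reduceAdd] at *
      linarith
  · intro i q hi hq
    rcases lt_or_ge q i with h | h
    · rw [lt i q h, lt (i + 1) (q + 1) (by omega)]
      exact_mod_cast hγ (Nat.le_succ q)
    · obtain ⟨j, rfl⟩ := Nat.exists_eq_add_of_le h
      rw [ge i j, show i + j + 1 = (i + 1) + j by ring, ge (i + 1) j]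
      have := r1 j i (by omega)
      linarith
  · intro i m hi hm
    rw [Finset.sum_sub_distrib, Finset.sum_sub_distrib]
    rcases le_or_gt m i with h | h
    · rw [P1 _ _ (show m + 1 ≤ i + 2 by omega), P1 _ _ (show m + 1 ≤ i + 1 by omega),
        P1 _ _ (show m ≤ i + 1 by omega), P1 _ _ h]
      simp
    · obtain ⟨j, rfl⟩ : ∃ j, m = i + 1 + j := ⟨m - i - 1, by omega⟩
      have e1 := P2 (i + 2) j (by omega)
      have e2 := P2 (i + 1) (j + 1) (by omega)
      have e3 := P2 (i + 1) j (by omega)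
      have e4 := P2 i (j + 1) (by omega)
      rw [show i + 1 + j + 1 = i + 2 + j by ring, e1, e3, show i + 2 + j = i + 1 + (j + 1) by ring, e2,
        show i + 1 + j = i + (j + 1) by ring, e4]
      have := r3 j i (by omega)
      linarith
  · intro i hi
    rw [Finset.sum_sub_distrib]
    have e1 := P2 (i + 1) (n - i - 1) (by omega)
    have e2 := P2 i (n - i) (by omega)
    rw [show i + 1 + (n - i - 1) = n by omega] at e1
    rw [show i + (n - i) = n by omega] at e2
    rw [e1, e2, b3 _ _ (by omega), b3 _ _ (by omega), Finset.sum_range_succ]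
    ring

end HornG


namespace HornG
open Finset Matrix

variable {n : ℕ}

/-- columns of prescribed types -/
noncomputable def mt (Ms : Fin 3 → Matrix (Fin n) (Fin n) (PowerSeries ℂ)) (t : Fin n → Fin 3)
    (v : Fin n → Fin n → PowerSeries ℂ) : Matrix (Fin n) (Fin n) (PowerSeries ℂ) :=
  Matrix.of fun r p => (Ms (t p) *ᵥ v p) r

/-- generic order of the determinant -/
noncomputable def hh (Ms : Fin 3 → Matrix (Fin n) (Fin n) (PowerSeries ℂ)) (t : Fin n → Fin 3) : ℕ :=
  sInf {m | ∃ v, PowerSeries.coeff m (mt Ms t v).det ≠ 0}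

variable {Ms : Fin 3 → Matrix (Fin n) (Fin n) (PowerSeries ℂ)}

lemma hh_dvd (t : Fin n → Fin 3) (v : Fin n → Fin n → PowerSeries ℂ) :
    (PowerSeries.X : PowerSeries ℂ) ^ hh Ms t ∣ (mt Ms t v).det := by
  rw [PowerSeries.X_pow_dvd_iff]
  intro m hm
  by_contra h
  exact Nat.notMem_of_lt_sInf hm ⟨v, h⟩

lemma hh_att (hM : ∀ c, (Ms c).det ≠ 0) (t : Fin n → Fin 3) :
    ∃ v, PowerSeries.coeff (hh Ms t) (mt Ms t v).det ≠ 0 := by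
  apply Nat.sInf_mem (s := {m | ∃ v, PowerSeries.coeff m (mt Ms t v).det ≠ 0})
  have h1 : mt Ms t (fun p => (Ms (t p)).adjugate *ᵥ Pi.single p 1) =
      diagonal (fun p => (Ms (t p)).det) := by
    apply Matrix.ext
    intro r p
    rw [mt, Matrix.of_apply, Matrix.mulVec_mulVec, Matrix.mul_adjugate, Matrix.smul_mulVec,
      Matrix.one_mulVec, Matrix.diagonal_apply, Pi.smul_apply, Pi.single_apply]
    by_cases h : r = p
    · subst h; simp
    · simp [h]
  have h2 : (mt Ms t (fun p => (Ms (t p)).adjugate *ᵥ Pi.single p 1)).det ≠ 0 := by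
    rw [h1, Matrix.det_diagonal]
    exact Finset.prod_ne_zero_iff.2 fun i _ => hM _
  obtain ⟨m, hm⟩ := PowerSeries.exists_coeff_ne_zero_iff_ne_zero.2 h2
  exact ⟨m, _, hm⟩

lemma mt_perm (t : Fin n → Fin 3) (σ : Equiv.Perm (Fin n)) (v : Fin n → Fin n → PowerSeries ℂ) (m : ℕ)
    (h : PowerSeries.coeff m (mt Ms t v).det ≠ 0) :
    PowerSeries.coeff m (mt Ms (t ∘ σ) (v ∘ σ)).det ≠ 0 := by
  have e : mt Ms (t ∘ σ) (v ∘ σ) = (mt Ms t v).submatrix id σ := rfl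
  rw [e, Matrix.det_permute']
  rcases Int.units_eq_one_or (Equiv.Perm.sign σ) with hs | hs <;> rw [hs]
  · simpa using h
  · simpa using h

lemma hh_perm (t : Fin n → Fin 3) (σ : Equiv.Perm (Fin n)) : hh Ms (t ∘ σ) = hh Ms t := by
  rw [hh, hh]
  congr 1
  ext m
  constructor
  · rintro ⟨v, hv⟩
    refine ⟨v ∘ σ.symm, ?_⟩
    have := mt_perm _ σ.symm v m hv
    rwa [Function.comp_assoc, show (σ : Fin n → Fin n) ∘ σ.symm = id by funext x; simp,
      Function.comp_id] at this
  · rintro ⟨v, hv⟩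
    exact ⟨v ∘ σ, mt_perm t σ v m hv⟩

lemma mt_update (t : Fin n → Fin 3) (w : Fin n → Fin n → PowerSeries ℂ) (p : Fin n) (e : Fin 3)
    (u : Fin n → PowerSeries ℂ) :
    mt Ms (Function.update t p e) (Function.update w p u) = (mt Ms t w).updateCol p (Ms e *ᵥ u) := by
  apply Matrix.ext
  intro r c
  rw [mt, Matrix.of_apply, Matrix.updateCol_apply]
  by_cases h : c = p
  · subst h; simp
  · simp [h, mt]

lemma pluecker {R : Type*} [CommRing R] [IsDomain R] (N : Matrix (Fin n) (Fin n) R) {p q : Fin n}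
    (hpq : p ≠ q) (a b c d : Fin n → R) :
    ((N.updateCol p a).updateCol q b).det * ((N.updateCol p c).updateCol q d).det =
      ((N.updateCol p c).updateCol q b).det * ((N.updateCol p a).updateCol q d).det +
      ((N.updateCol p a).updateCol q c).det * ((N.updateCol p b).updateCol q d).det := by
  set A := (N.updateCol p a).updateCol q b with hA
  have h1 := Matrix.mulVec_cramer A c
  -- determinant as a linear function of the column `p`
  have lin : ∀ x, ((N.updateCol p x).updateCol q d).det = ∑ r, x r * (((N.updateCol q d)).adjugate p r) := by
    intro x
    rw [Matrix.updateCol_comm _ hpq, ← Matrix.cramer_apply, Matrix.cramer_eq_adjugate_mulVec]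
    simp [Matrix.mulVec, dotProduct, mul_comm]
  have h2 : A.det * ((N.updateCol p c).updateCol q d).det =
      ∑ k, A.cramer c k * ((N.updateCol p (fun r => A r k)).updateCol q d).det := by
    rw [lin, Finset.mul_sum]
    simp only [lin, Finset.mul_sum]
    rw [Finset.sum_comm]
    refine Finset.sum_congr rfl fun r _ => ?_
    have := congrFun h1 r
    rw [Pi.smul_apply, smul_eq_mul] at this
    rw [← mul_assoc, ← this, Matrix.mulVec, dotProduct, Finset.sum_mul]
    exact Finset.sum_congr rfl fun k _ => by ring
  rw [h2]
  have h3 : ∀ k, k ≠ p → k ≠ q → A.cramer c k * ((N.updateCol p (fun r => A r k)).updateCol q d).det = 0 := by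
    intro k hk hk'
    rw [Matrix.det_zero_of_column_eq hk, mul_zero]
    intro r
    simp [hA, Matrix.updateCol_apply, hk, hk', hpq]
  rw [Finset.sum_eq_add p q hpq (fun k _ hk => h3 k hk.1 hk.2) (by simp) (by simp)]
  rw [Matrix.cramer_apply, Matrix.cramer_apply]
  have e1 : A.updateCol p c = (N.updateCol p c).updateCol q b := by
    rw [hA]
    apply Matrix.ext
    intro r k
    simp only [Matrix.updateCol_apply]
    split_ifs with h1 h2 <;> try rfl
    exact absurd (h1.symm.trans h2) hpq
  have e2 : A.updateCol q c = (N.updateCol p a).updateCol q c := by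
    rw [hA]
    apply Matrix.ext
    intro r k
    simp only [Matrix.updateCol_apply]
    split_ifs <;> rfl
  have e3 : (fun r => A r p) = a := by
    funext r
    simp [hA, Matrix.updateCol_apply, hpq]
  have e4 : (fun r => A r q) = b := by
    funext r
    simp [hA, Matrix.updateCol_apply]
  rw [e1, e2, e3, e4]

lemma affine_poly (A B : Matrix (Fin n) (Fin n) (PowerSeries ℂ)) (m : ℕ) :
    ∃ P : Polynomial ℂ, ∀ s : ℂ, P.eval s = PowerSeries.coeff m (A + PowerSeries.C s • B).det := by
  let A' := (PowerSeries.map (Polynomial.C : ℂ →+* Polynomial ℂ)).mapMatrix A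
  let B' := (PowerSeries.map (Polynomial.C : ℂ →+* Polynomial ℂ)).mapMatrix B
  refine ⟨PowerSeries.coeff m (A' + PowerSeries.C (Polynomial.X : Polynomial ℂ) • B').det, fun s => ?_⟩
  have hid : ∀ f : PowerSeries ℂ, PowerSeries.map (Polynomial.evalRingHom s)
      (PowerSeries.map (Polynomial.C : ℂ →+* Polynomial ℂ) f) = f := by
    intro f
    ext k
    simp
  have : (PowerSeries.map (Polynomial.evalRingHom s)).mapMatrix
      (A' + PowerSeries.C (Polynomial.X : Polynomial ℂ) • B') = A + PowerSeries.C s • B := by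
    apply Matrix.ext
    intro i j
    simp [A', B', hid]
  rw [← this, ← RingHom.map_det, PowerSeries.coeff_map]
  rfl

lemma mt_add_smul (t : Fin n → Fin 3) (v w : Fin n → Fin n → PowerSeries ℂ) (s : PowerSeries ℂ) :
    mt Ms t (v + s • w) = mt Ms t v + s • mt Ms t w := by
  apply Matrix.ext
  intro r p
  simp [mt, Matrix.mulVec_add, Matrix.mulVec_smul]

lemma le_of_coeff_dvd {f g : PowerSeries ℂ} {a b c : ℕ} (hf : (PowerSeries.X : PowerSeries ℂ) ^ a ∣ f)
    (hg : (PowerSeries.X : PowerSeries ℂ) ^ b ∣ g)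
    (hf' : PowerSeries.coeff a f ≠ 0) (hg' : PowerSeries.coeff b g ≠ 0)
    (h : (PowerSeries.X : PowerSeries ℂ) ^ c ∣ f * g) : c ≤ a + b := by
  by_contra hc
  push Not at hc
  obtain ⟨f, rfl⟩ := hf
  obtain ⟨g, rfl⟩ := hg
  rw [PowerSeries.X_pow_dvd_iff] at h
  have := h (a + b) hc
  rw [show (PowerSeries.X : PowerSeries ℂ) ^ a * f * (PowerSeries.X ^ b * g) =
    PowerSeries.X ^ (a + b) * (f * g) by ring] at this
  simp only [PowerSeries.coeff_X_pow_mul'] at hf' hg' this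
  simp at hf' hg' this
  tauto

theorem hh_pluecker (hM : ∀ c, (Ms c).det ≠ 0) (t : Fin n → Fin 3) {p q : Fin n} (hpq : p ≠ q)
    (e1 e2 e3 : Fin 3) :
    hh Ms (Function.update (Function.update t p e1) q e2) +
      hh Ms (Function.update (Function.update t p e1) q e3) ≤
    hh Ms (Function.update (Function.update t p e1) q e1) +
      hh Ms (Function.update (Function.update t p e2) q e3) := by
  set U : Fin 3 → Fin 3 → Fin n → Fin 3 := fun x y => Function.update (Function.update t p x) q y with hU
  change hh Ms (U e1 e2) + hh Ms (U e1 e3) ≤ hh Ms (U e1 e1) + hh Ms (U e2 e3)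
  obtain ⟨v, hv⟩ := hh_att hM (U e1 e1)
  obtain ⟨v', hv'⟩ := hh_att hM (U e2 e3)
  let δ : Fin n → Fin n → PowerSeries ℂ := fun r => if r = p ∨ r = q then 0 else v' r - v r
  obtain ⟨P1, hP1⟩ := affine_poly (mt Ms (U e1 e1) v) (mt Ms (U e1 e1) δ) (hh Ms (U e1 e1))
  obtain ⟨P2, hP2⟩ := affine_poly (mt Ms (U e2 e3) (v' - δ)) (mt Ms (U e2 e3) δ) (hh Ms (U e2 e3))
  have n1 : P1 ≠ 0 := by
    intro h0
    have := hP1 0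
    rw [h0, ← mt_add_smul] at this
    simp at this
    exact hv this.symm
  have n2 : P2 ≠ 0 := by
    intro h0
    have := hP2 1
    rw [h0, ← mt_add_smul] at this
    simp at this
    exact hv' this.symm
  obtain ⟨s, hs⟩ : ∃ s, (P1 * P2).eval s ≠ 0 := by
    by_contra h
    push Not at h
    exact mul_ne_zero n1 n2 (Polynomial.funext (by simpa using h))
  rw [Polynomial.eval_mul] at hs
  have c1 := left_ne_zero_of_mul hs
  have c2 := right_ne_zero_of_mul hs
  rw [hP1, ← mt_add_smul] at c1
  rw [hP2, ← mt_add_smul] at c2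
  set w : Fin n → Fin n → PowerSeries ℂ := v + PowerSeries.C s • δ with hw
  have w1 : w = Function.update (Function.update w p (v p)) q (v q) := by
    funext r
    by_cases h : r = q
    · subst h; simp [hw, δ]
    · by_cases h2 : r = p
      · subst h2; simp [hw, δ, h]
      · simp [h, h2]
  have w2 : v' - δ + PowerSeries.C s • δ = Function.update (Function.update w p (v' p)) q (v' q) := by
    funext r
    by_cases h : r = q
    · subst h; simp [δ]
    · by_cases h2 : r = p
      · subst h2; simp [δ, h]
      · simp [hw, δ, h, h2]
  rw [w1] at c1
  rw [w2] at c2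
  have mU : ∀ x y u u', mt Ms (U x y) (Function.update (Function.update w p u) q u') =
      ((mt Ms t w).updateCol p (Ms x *ᵥ u)).updateCol q (Ms y *ᵥ u') := by
    intro x y u u'
    rw [mt_update, mt_update]
  have pl := pluecker (mt Ms t w) hpq (Ms e1 *ᵥ v p) (Ms e1 *ᵥ v q) (Ms e2 *ᵥ v' p) (Ms e3 *ᵥ v' q)
  rw [← mU, ← mU, ← mU, ← mU, ← mU, ← mU] at pl
  have hsw : hh Ms (U e2 e1) = hh Ms (U e1 e2) := by
    rw [← hh_perm (U e1 e2) (Equiv.swap p q)]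
    congr 1
    funext r
    simp only [hU, Function.comp]
    by_cases h : r = q
    · subst h; simp [hpq]
    · by_cases h2 : r = p
      · subst h2; simp [hpq]
      · rw [Equiv.swap_apply_of_ne_of_ne h2 h]; simp [h, h2]
  refine le_of_coeff_dvd (hh_dvd _ _) (hh_dvd _ _) c1 c2 ?_
  rw [pl]
  refine dvd_add ?_ ?_
  · rw [pow_add, ← hsw]
    exact mul_dvd_mul (hh_dvd _ _) (hh_dvd _ _)
  · rw [pow_add]
    exact mul_dvd_mul (hh_dvd _ _) (hh_dvd _ _)

end HornG


namespace HornG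
open Finset Matrix HornF

variable {n : ℕ} {Ms : Fin 3 → Matrix (Fin n) (Fin n) (PowerSeries ℂ)}

lemma perm_of_cnt (t t' : Fin n → Fin 3)
    (h : ∀ y, (univ.filter fun p => t p = y).card = (univ.filter fun p => t' p = y).card) :
    ∃ σ : Equiv.Perm (Fin n), t' = t ∘ σ := by
  have e : ∀ y, Nonempty ({p // t' p = y} ≃ {p // t p = y}) := by
    intro y
    refine ⟨Fintype.equivOfCardEq ?_⟩
    rw [Fintype.card_subtype, Fintype.card_subtype, h y]
  have e : ∀ y, {p // t' p = y} ≃ {p // t p = y} := fun y => (e y).some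
  refine ⟨(Equiv.sigmaFiberEquiv t').symm.trans ((Equiv.sigmaCongrRight e).trans (Equiv.sigmaFiberEquiv t)), ?_⟩
  funext p
  simp only [Function.comp, Equiv.trans_apply]
  exact ((e (t' p) ⟨p, rfl⟩).2).symm

/-- the standard word of types -/
def std (n i j : ℕ) : Fin n → Fin 3 := fun p => if p.1 < i then 0 else if p.1 < i + j then 1 else 2

lemma card_lt (n m : ℕ) (h : m ≤ n) : (univ.filter fun p : Fin n => p.1 < m).card = m := by
  have := Fin.card_filter_val_lt (n := n) (m := m)
  omega

lemma cnt_std (n i j : ℕ) (h : i + j ≤ n) (y : Fin 3) :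
    (univ.filter fun p => std n i j p = y).card = ![i, j, n - i - j] y := by
  have h1 := card_lt n i (by omega)
  have h2 := card_lt n (i + j) h
  have h0 : (univ.filter fun p => std n i j p = 0).card = i := by
    refine Eq.trans ?_ h1
    congr 1
    ext p
    simp only [mem_filter, mem_univ, true_and]
    simp only [std]
    split_ifs <;> simp_all
  have h01 : (univ.filter fun p => std n i j p = 0).card + (univ.filter fun p => std n i j p = 1).card = i + j := by
    refine Eq.trans ?_ h2
    rw [← Finset.card_union_of_disjoint]
    · congr 1
      ext p
      simp only [mem_union, mem_filter, mem_univ, true_and]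
      simp only [std]
      split_ifs <;> simp_all
      omega
    · rw [Finset.disjoint_filter]
      intro p _ h h'
      rw [h] at h'
      exact absurd h' (by decide)
  have h012 : ∑ y, (univ.filter fun p => std n i j p = y).card = n := by
    have := Finset.card_eq_sum_card_fiberwise (f := std n i j) (s := univ) (t := univ) (by simp)
    rw [← this]
    simp
  rw [Fin.sum_univ_three] at h012
  fin_cases y
  · exact h0
  · show _ = j
    change (univ.filter fun p => std n i j p = 1).card = j
    omega
  · change (univ.filter fun p => std n i j p = 2).card = n - i - j
    omega

lemma cnt_update (t : Fin n → Fin 3) (p : Fin n) (e y : Fin 3) :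
    (univ.filter fun r => Function.update t p e r = y).card + (if t p = y then 1 else 0) =
      (univ.filter fun r => t r = y).card + (if e = y then 1 else 0) := by
  have : ∀ t : Fin n → Fin 3, (univ.filter fun r => t r = y).card =
      (if t p = y then 1 else 0) + ∑ r ∈ univ.erase p, if t r = y then 1 else 0 := by
    intro t
    rw [Finset.card_filter]
    exact (Finset.add_sum_erase univ (fun r => if t r = y then 1 else 0) (mem_univ p)).symm
  rw [this t, this (Function.update t p e)]
  have h2 : ∑ r ∈ univ.erase p, (if Function.update t p e r = y then 1 else 0) =
      ∑ r ∈ univ.erase p, if t r = y then 1 else 0 :=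
    Finset.sum_congr rfl fun r hr => by rw [Function.update_of_ne (Finset.ne_of_mem_erase hr)]
  rw [h2, Function.update_self]
  ring

lemma hh_eq_std (t : Fin n → Fin 3) (i j : ℕ) (hij : i + j ≤ n)
    (h0 : (univ.filter fun p => t p = 0).card = i) (h1 : (univ.filter fun p => t p = 1).card = j) :
    hh Ms t = hh Ms (std n i j) := by
  have h012 : ∑ y, (univ.filter fun p => t p = y).card = n := by
    have := Finset.card_eq_sum_card_fiberwise (f := t) (s := univ) (t := univ) (by simp)
    rw [← this]
    simp
  rw [Fin.sum_univ_three] at h012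
  obtain ⟨σ, hσ⟩ := perm_of_cnt (std n i j) t (by
    intro y
    rw [cnt_std n i j hij]
    fin_cases y
    · exact h0.symm
    · exact h1.symm
    · change n - i - j = (univ.filter fun p => t p = 2).card
      omega)
  rw [hσ, hh_perm]

lemma hh_two (i j : ℕ) (hij : i + j + 2 ≤ n) : ∃ (t : Fin n → Fin 3) (p q : Fin n), p ≠ q ∧
    ∀ e e', hh Ms (Function.update (Function.update t p e) q e') =
      hh Ms (std n (i + (if e = 0 then 1 else 0) + (if e' = 0 then 1 else 0))
        (j + (if e = 1 then 1 else 0) + (if e' = 1 then 1 else 0))) := by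
  have hp : (⟨0, by omega⟩ : Fin n) ≠ ⟨1, by omega⟩ := by simp
  refine ⟨std n (i + 2) j, ⟨0, by omega⟩, ⟨1, by omega⟩, hp, ?_⟩
  intro e e'
  have s0 : std n (i + 2) j ⟨0, by omega⟩ = 0 := by simp [std]
  have s1 : std n (i + 2) j ⟨1, by omega⟩ = 0 := by simp [std]
  have c := fun y => cnt_std n (i + 2) j (by omega) y
  apply hh_eq_std
  · have : ∀ e : Fin 3, ¬ (e = 0 ∧ e = 1) := by decide
    have a1 := this e
    have a2 := this e'
    split_ifs <;> simp_all <;> omega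
  · have u1 := cnt_update (std n (i + 2) j) ⟨0, by omega⟩ e 0
    have u2 := cnt_update (Function.update (std n (i + 2) j) ⟨0, by omega⟩ e) ⟨1, by omega⟩ e' 0
    rw [Function.update_of_ne hp.symm, s1] at u2
    rw [s0, c] at u1
    simp only [if_true, Matrix.cons_val_zero] at u1 u2
    omega
  · have u1 := cnt_update (std n (i + 2) j) ⟨0, by omega⟩ e 1
    have u2 := cnt_update (Function.update (std n (i + 2) j) ⟨0, by omega⟩ e) ⟨1, by omega⟩ e' 1
    rw [Function.update_of_ne hp.symm, s1] at u2
    rw [s0, c] at u1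
    simp only [Fin.zero_eq_one_iff, Matrix.cons_val_one, Nat.reduceEqDiff, if_false, Matrix.cons_val_zero] at u1 u2
    omega

lemma bdry_dvd (lam : Fin n → ℕ) (hl : Antitone lam) (m : ℕ) (w : Matrix (Fin n) (Fin n) (PowerSeries ℂ))
    (z : Matrix (Fin n) (Fin n) (PowerSeries ℂ)) :
    (PowerSeries.X : PowerSeries ℂ) ^ (∑ p : Fin n, if p.1 < m then 0 else lam p) ∣
      (Matrix.of fun r p => if p.1 < m then w r p else PowerSeries.X ^ lam r * z r p).det := by
  rw [Matrix.det_apply]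
  refine Finset.dvd_sum fun σ _ => ?_
  rw [Units.smul_def, zsmul_eq_mul]
  refine Dvd.dvd.mul_left ?_ _
  have h1 : (∑ p : Fin n, if p.1 < m then 0 else lam p) ≤ ∑ p : Fin n, if p.1 < m then 0 else lam (σ p) := by
    have := Antivary.sum_mul_le_sum_mul_comp_perm (f := fun p : Fin n => if p.1 < m then 0 else 1) (g := lam)
      (σ := σ) (by
        intro i j hij
        have hlt : j < i := by
          by_contra h
          push Not at h
          exact absurd (hl h) (not_le.2 hij)
        simp only
        have : j.1 < i.1 := hlt
        split_ifs <;> omega)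
    simpa only [ite_mul, zero_mul, one_mul] using this
  refine (pow_dvd_pow _ h1).trans ?_
  rw [← Finset.prod_pow_eq_pow_sum]
  refine Finset.prod_dvd_prod_of_dvd _ _ fun p _ => ?_
  rw [Matrix.of_apply]
  split_ifs
  · simp
  · exact Dvd.intro _ rfl

lemma hh_bdry (A B : Fin 3) (t : Fin n → Fin 3) (m : ℕ) (ht : ∀ p, t p = if p.1 < m then A else B)
    (P a b : Matrix (Fin n) (Fin n) (PowerSeries ℂ)) (lam : Fin n → ℕ) (hl : Antitone lam)
    (hA : Ms A = P * a) (hB : Ms B = P * dg lam * b) (ha : IsUnit a.det) (hb : IsUnit b.det)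
    (e : ℕ) (u : PowerSeries ℂ) (hu : IsUnit u) (hP : P.det = PowerSeries.X ^ e * u) :
    hh Ms t = e + ∑ p : Fin n, if p.1 < m then 0 else lam p := by
  have fac : ∀ v, mt Ms t v = P * (Matrix.of fun r p => if p.1 < m then (a *ᵥ v p) r else
      PowerSeries.X ^ lam r * (b *ᵥ v p) r) := by
    intro v
    apply Matrix.ext
    intro r p
    rw [mt, Matrix.of_apply, ht, Matrix.mul_apply]
    split_ifs with h
    · rw [hA, ← Matrix.mulVec_mulVec]
      simp only [Matrix.of_apply, h, if_true]
      rfl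
    · rw [hB, ← Matrix.mulVec_mulVec, ← Matrix.mulVec_mulVec]
      simp only [Matrix.of_apply, h, if_false]
      rw [Matrix.mulVec, dotProduct]
      refine Finset.sum_congr rfl fun x _ => ?_
      rw [dg, Matrix.mulVec_diagonal]
  have mem : ∃ v, PowerSeries.coeff (e + ∑ p : Fin n, if p.1 < m then 0 else lam p) (mt Ms t v).det ≠ 0 := by
    refine ⟨fun p => if p.1 < m then a⁻¹ *ᵥ Pi.single p 1 else b⁻¹ *ᵥ Pi.single p 1, ?_⟩
    rw [fac]
    have : (Matrix.of fun r (p : Fin n) => if p.1 < m then (a *ᵥ (if p.1 < m then a⁻¹ *ᵥ Pi.single p 1 else b⁻¹ *ᵥ Pi.single p 1)) r else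
      PowerSeries.X ^ lam r * (b *ᵥ (if p.1 < m then a⁻¹ *ᵥ Pi.single p 1 else b⁻¹ *ᵥ Pi.single p 1)) r) =
        dg fun p => if p.1 < m then 0 else lam p := by
      apply Matrix.ext
      intro r p
      rw [Matrix.of_apply, dg, Matrix.diagonal_apply]
      by_cases hrp : r = p
      · subst hrp
        rw [if_pos rfl]
        split_ifs
        · rw [Matrix.mulVec_mulVec, Matrix.mul_nonsing_inv _ ha]; simp
        · rw [Matrix.mulVec_mulVec, Matrix.mul_nonsing_inv _ hb]; simp
      · rw [if_neg hrp]
        split_ifs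
        · rw [Matrix.mulVec_mulVec, Matrix.mul_nonsing_inv _ ha]; simp [hrp]
        · rw [Matrix.mulVec_mulVec, Matrix.mul_nonsing_inv _ hb]; simp [hrp]
    rw [this, Matrix.det_mul, hP, dg, Matrix.det_diagonal, Finset.prod_pow_eq_pow_sum,
      show ∀ x y z : PowerSeries ℂ, x * y * z = x * z * y by intros; ring, ← pow_add]
    rw [PowerSeries.coeff_X_pow_mul', if_pos le_rfl, Nat.sub_self]
    have := PowerSeries.isUnit_iff_constantCoeff.1 hu
    simpa using this.ne_zero
  apply le_antisymm
  · exact Nat.sInf_le mem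
  · have hne : ∀ m', (∃ v, PowerSeries.coeff m' (mt Ms t v).det ≠ 0) → (e + ∑ p : Fin n, if p.1 < m then 0 else lam p) ≤ m' := by
      rintro m' ⟨v, hv⟩
      by_contra hlt
      push Not at hlt
      apply hv
      have : (PowerSeries.X : PowerSeries ℂ) ^ (e + ∑ p : Fin n, if p.1 < m then 0 else lam p) ∣ (mt Ms t v).det := by
        rw [fac, Matrix.det_mul, hP, pow_add]
        exact mul_dvd_mul (Dvd.intro _ rfl) (bdry_dvd lam hl m _ _)
      exact PowerSeries.X_pow_dvd_iff.1 this m' hlt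
    exact hne _ (Nat.sInf_mem (s := {m | ∃ v, PowerSeries.coeff m (mt Ms t v).det ≠ 0}) ⟨_, mem⟩)

end HornG


namespace HornG
open Finset Matrix HornF

variable {n : ℕ}

lemma sum_if_lt (lam : ℕ → ℕ) (m : ℕ) (hm : m ≤ n) :
    (∑ p : Fin n, if p.1 < m then 0 else lam p) + ∑ q ∈ range m, lam q = ∑ q ∈ range n, lam q := by
  rw [Fin.sum_univ_eq_sum_range (fun p => if p < m then 0 else lam p)]
  obtain ⟨k, rfl⟩ := Nat.exists_eq_add_of_le hm
  rw [Finset.sum_range_add, Finset.sum_range_add]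
  rw [Finset.sum_eq_zero (fun x hx => if_pos (mem_range.1 hx)), zero_add, add_comm]
  congr 1
  exact Finset.sum_congr rfl fun x _ => if_neg (by omega)

theorem arr_of_lat {α β γ : ℕ → ℕ} (hα : Antitone α) (hβ : Antitone β) (hγ : Antitone γ)
    (hsum : ∑ i ∈ range n, γ i = ∑ i ∈ range n, α i + ∑ i ∈ range n, β i)
    (k1 k2 k3 : Matrix (Fin n) (Fin n) (PowerSeries ℂ)) (w1 : IsUnit k1.det) (w2 : IsUnit k2.det)
    (w3 : IsUnit k3.det)
    (h : (dg fun i : Fin n => β i) * k1 * (dg fun i : Fin n => α i) = k2 * (dg fun i : Fin n => γ i) * k3) :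
    HornA.LRArr n α β γ := by
  set Ms : Fin 3 → Matrix (Fin n) (Fin n) (PowerSeries ℂ) :=
    ![1, dg fun i : Fin n => β i, (dg fun i : Fin n => β i) * k1 * (dg fun i : Fin n => α i)] with hMs
  have M0 : Ms 0 = 1 := rfl
  have M1 : Ms 1 = dg fun i : Fin n => β i := rfl
  have M2 : Ms 2 = (dg fun i : Fin n => β i) * k1 * (dg fun i : Fin n => α i) := rfl
  have hdet : ∀ b : Fin n → ℕ, (dg b).det = PowerSeries.X ^ (∑ i, b i) := by
    intro b
    rw [dg, Matrix.det_diagonal, Finset.prod_pow_eq_pow_sum]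
  have hdg : ∀ b : Fin n → ℕ, (dg b).det ≠ 0 := by
    intro b
    rw [hdet]
    exact pow_ne_zero _ PowerSeries.X_ne_zero
  have hM : ∀ c, (Ms c).det ≠ 0 := by
    intro c
    fin_cases c
    · show (1 : Matrix (Fin n) (Fin n) (PowerSeries ℂ)).det ≠ 0
      rw [Matrix.det_one]; exact one_ne_zero
    · exact hdg _
    · show ((dg fun i : Fin n => β i) * k1 * (dg fun i : Fin n => α i)).det ≠ 0
      rw [Matrix.det_mul, Matrix.det_mul]
      exact mul_ne_zero (mul_ne_zero (hdg _) w1.ne_zero) (hdg _)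
  have i1 := Matrix.isUnit_nonsing_inv_det k1 w1
  have i2 := Matrix.isUnit_nonsing_inv_det k2 w2
  have u0 : IsUnit (1 : Matrix (Fin n) (Fin n) (PowerSeries ℂ)).det := by rw [Matrix.det_one]; exact isUnit_one
  have B1 : ∀ j ≤ n, hh Ms (std n 0 j) + ∑ i ∈ range j, α i = ∑ i ∈ range n, γ i := by
    intro j hj
    rw [hh_bdry 1 2 (std n 0 j) j (by intro p; simp [std]) ((dg fun i : Fin n => β i) * k1) k1⁻¹ 1
      (fun i : Fin n => α i) (fun i j hij => hα hij)
      (by rw [M1, Matrix.mul_assoc, Matrix.mul_nonsing_inv _ w1, Matrix.mul_one])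
      (by rw [M2, Matrix.mul_one]) i1 u0 (∑ i : Fin n, β i) k1.det w1
      (by rw [Matrix.det_mul, hdet]), Fin.sum_univ_eq_sum_range (fun i => β i)]
    have := sum_if_lt α j hj
    omega
  have B2 : ∀ l ≤ n, hh Ms (std n l 0) + ∑ i ∈ range l, γ i = ∑ i ∈ range n, γ i := by
    intro l hl
    rw [hh_bdry 0 2 (std n l 0) l (by intro p; simp only [std]; split_ifs <;> first | rfl | omega) k2 k2⁻¹ k3
      (fun i : Fin n => γ i) (fun i j hij => hγ hij)
      (by rw [M0, Matrix.mul_nonsing_inv _ w2])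
      (by rw [M2, h]) i2 w3 0 k2.det w2
      (by rw [pow_zero, one_mul])]
    have := sum_if_lt γ l hl
    omega
  have B3 : ∀ j l, j + l = n → hh Ms (std n l j) + ∑ i ∈ range l, β i = ∑ i ∈ range n, β i := by
    intro j l hl
    rw [hh_bdry 0 1 (std n l j) l (by
        intro p
        have := p.2
        simp only [std]
        split_ifs <;> first | rfl | omega) 1 1 1
      (fun i : Fin n => β i) (fun i j hij => hβ hij)
      (by rw [M0, Matrix.mul_one])
      (by rw [M1, Matrix.mul_one, Matrix.one_mul]) u0 u0 0 1 isUnit_one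
      (by rw [pow_zero, one_mul, Matrix.det_one])]
    have := sum_if_lt β l (by omega : l ≤ n)
    omega
  have R : ∀ i j, i + j + 2 ≤ n →
      (hh Ms (std n (i + 1) (j + 1)) + hh Ms (std n (i + 1) j) ≤ hh Ms (std n (i + 2) j) + hh Ms (std n i (j + 1))) ∧
      (hh Ms (std n (i + 1) (j + 1)) + hh Ms (std n i (j + 1)) ≤ hh Ms (std n i (j + 2)) + hh Ms (std n (i + 1) j)) ∧
      (hh Ms (std n (i + 1) j) + hh Ms (std n i (j + 1)) ≤ hh Ms (std n i j) + hh Ms (std n (i + 1) (j + 1))) := by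
    intro i j hij
    obtain ⟨t, p, q, hpq, ht⟩ := hh_two (Ms := Ms) i j hij
    have p0 := hh_pluecker hM t hpq 0 1 2
    have p1 := hh_pluecker hM t hpq 1 0 2
    have p2 := hh_pluecker hM t hpq 2 0 1
    simp only [ht] at p0 p1 p2
    simp at p0 p1 p2
    simp only [add_assoc, Nat.reduceAdd] at p0 p1 p2
    refine ⟨p0, p1, p2⟩
  refine arr_of_hive hγ (fun j l => (∑ i ∈ range n, γ i : ℕ) - (hh Ms (std n l j) : ℤ)) (by exact_mod_cast hsum)
    ?_ ?_ ?_ ?_ ?_ ?_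
  · intro j hj
    have := B1 j hj
    zify at this
    push_cast
    linarith
  · intro l hl
    have := B2 l hl
    zify at this
    push_cast
    linarith
  · intro j l hjl
    have := B3 j l hjl
    zify at this hsum
    push_cast
    linarith
  · intro j l hjl
    have := (R l j (by omega)).2.2
    zify at this
    push_cast
    linarith
  · intro j l hjl
    have := (R l j (by omega)).2.1
    zify at this
    push_cast
    linarith
  · intro j l hjl
    have := (R l j (by omega)).1
    zify at this
    push_cast
    linarith

end HornG


namespace HornH
open Finset Matrix

theorem arr_of_herm {n : ℕ} {α β γ : ℕ → ℕ} (hα : Antitone α) (hβ : Antitone β) (hγ : Antitone γ)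
    {A B : Matrix (Fin n) (Fin n) ℂ} (hA : A.IsHermitian) (hB : B.IsHermitian)
    (h1 : HasOrdSpecC A (fun i => (α i.1 : ℝ))) (h2 : HasOrdSpecC B (fun i => (β i.1 : ℝ)))
    (h3 : HasOrdSpecC (A + B) (fun i => (γ i.1 : ℝ))) :
    (∑ i ∈ range n, γ i = ∑ i ∈ range n, α i + ∑ i ∈ range n, β i) ∧ HornA.LRArr n α β γ := by
  have hD : ∀ i < n, γ i ≤ γ 0 := fun i _ => hγ (Nat.zero_le i)
  obtain ⟨Q, hQ, hQs⟩ := HornD.unitary_of_herm hD hA hB h1 h2 h3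
  have hsum : ∑ i ∈ range n, γ i = ∑ i ∈ range n, α i + ∑ i ∈ range n, β i := by
    have := HornD.sum_of_unitary hQ hQs
    rw [Fin.sum_univ_three] at this
    change ∑ i : Fin n, α i + ∑ i : Fin n, β i + ∑ i : Fin n, (γ 0 - γ i) = _ at this
    rw [Fin.sum_univ_eq_sum_range (fun i => α i), Fin.sum_univ_eq_sum_range (fun i => β i),
      Fin.sum_univ_eq_sum_range (fun i => γ 0 - γ i)] at this
    have h4 : ∑ i ∈ range n, γ i + ∑ i ∈ range n, (γ 0 - γ i) = n * γ 0 := by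
      rw [← Finset.sum_add_distrib, Finset.sum_congr rfl fun i hi => show γ i + (γ 0 - γ i) = γ 0 by
        have := hD i (mem_range.1 hi); omega]
      simp
    omega
  obtain ⟨k1, k2, k3, w1, w2, w3, h⟩ := HornF.lat_of_unitary hα hβ hγ hD hQ hQs
  exact ⟨hsum, HornG.arr_of_lat hα hβ hγ hsum k1 k2 k3 w1 w2 w3 h⟩

end HornH


/-- Horn's conjecture, after Klyachko and Knutson–Tao.  For
partitions `α, β, γ` with at most `n` parts, there exist `n×n` complex Hermitian
matrices `A, B` with ordered spectra `α, β` such that `A + B` has ordered spectrum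
`γ`, iff `|γ| = |α| + |β|` and `c^γ_{αβ} ≠ 0`. -/
theorem hermitian_sum_spectrum_iff_lr (n : ℕ) (α β γ : ℕ → ℕ)
    (hα : IsPartition α) (hβ : IsPartition β) (hγ : IsPartition γ)
    (hαparts : ∀ m, n ≤ m → α m = 0) (hβparts : ∀ m, n ≤ m → β m = 0)
    (hγparts : ∀ m, n ≤ m → γ m = 0) :
    (∃ A B : Matrix (Fin n) (Fin n) ℂ, A.IsHermitian ∧ B.IsHermitian ∧
      HasOrdSpecC A (fun i => (α i.1 : ℝ)) ∧ HasOrdSpecC B (fun i => (β i.1 : ℝ)) ∧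
      HasOrdSpecC (A + B) (fun i => (γ i.1 : ℝ))) ↔
    ((∑ i ∈ Finset.range n, γ i = ∑ i ∈ Finset.range n, α i + ∑ i ∈ Finset.range n, β i) ∧
      LR α β γ ≠ 0) := by
  constructor
  · rintro ⟨A, B, hA, hB, h1, h2, h3⟩
    obtain ⟨hs, harr⟩ := HornH.arr_of_herm hα.1 hβ.1 hγ.1 hA hB h1 h2 h3
    exact ⟨hs, (HornA.lr_iff_arr hα.1 hγ.1 hβparts hγparts hs).2 harr⟩
  · rintro ⟨hs, hlr⟩
    rcases Nat.eq_zero_or_pos n with h0 | hn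
    · subst h0
      refine ⟨0, 0, Matrix.isHermitian_zero, Matrix.isHermitian_zero, ?_, ?_, ?_⟩ <;>
        exact ⟨fun i => i.elim0, by simp [Matrix.charpoly, Matrix.det_isEmpty]⟩
    · exact HornH.herm_of_arr hn hα.1 hβ.1 hγ.1 hs ((HornA.lr_iff_arr hα.1 hγ.1 hβparts hγparts hs).1 hlr)
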